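/- For every β > 0 there exists a constant C > 0 depending only on β such that for every integer n ≥ 1 and every θ ∈ (0,π], | E[ |N_n(0,θ) − nθ/(2π)|² ] − (2/(π²β)) ln(2+nθ) | ≤ C, where E denotes expectation with respect to μ_{β,n}. In particular the variance of the counting function admits matching uniform upper and lower logarithmic bounds. -/

import Mathlib

open MeasureTheory ProbabilityTheory Filter

noncomputable section

/-- The normalization constant `C_{β,n} = (2π)^n Γ(1+βn/2)/Γ(1+β/2)^n`. -/
def cbeConst (β : ℝ) (n : ℕ) : ℝ :=
  (2 * Real.pi) ^ n * Real.Gamma (1 + β * n / 2) / Real.Gamma (1 + β / 2) ^ n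

/-- The circular β-ensemble: the measure on `[0,2π)^n` with density
`(1/C_{β,n}) ∏_{j<k} |e^{iθ_j} − e^{iθ_k}|^β` with respect to Lebesgue measure. -/
def cbe (β : ℝ) (n : ℕ) : Measure (Fin n → ℝ) :=
  ((volume : Measure (Fin n → ℝ)).restrict
      (Set.univ.pi fun _ => Set.Ico 0 (2 * Real.pi))).withDensity
    (fun y => ENNReal.ofReal ((1 / cbeConst β n) *
      ∏ p ∈ Finset.univ.filter (fun p : Fin n × Fin n => p.1 < p.2),
        ‖Complex.exp (Complex.I * (y p.1 : ℂ)) - Complex.exp (Complex.I * (y p.2 : ℂ))‖ ^ β))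

/-- `countIn a b y` is the number of indices `j` with `y j ∈ [a, b)`. -/
def countIn {n : ℕ} (a b : ℝ) (y : Fin n → ℝ) : ℕ :=
  (Finset.univ.filter fun j => a ≤ y j ∧ y j < b).card

/-- The matrix of evaluations of polynomials of degree at most `n` factors through the
Vandermonde matrix. -/
theorem eval_matrix_eq_vandermonde_mul {n : ℕ} (a : Fin (n + 1) → ℝ)
    (p : Fin (n + 1) → Polynomial ℝ) (hp : ∀ j, (p j).natDegree < n + 1) :
    (Matrix.of fun k j => (p j).eval (a k)) =
      Matrix.vandermonde a * Matrix.of fun (d j : Fin (n + 1)) => (p j).coeff d := by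
  ext k j
  rw [Matrix.mul_apply, Matrix.of_apply, Polynomial.eval_eq_sum_range' (hp j), Finset.sum_range]
  exact Finset.sum_congr rfl fun i _ => by simp [Matrix.vandermonde_apply, mul_comm]

/-- The bordered Cauchy matrix, whose first column is constant equal to one. -/
def borderedCauchy {n : ℕ} (a : Fin (n + 1) → ℝ) (b : Fin n → ℝ) :
    Matrix (Fin (n + 1)) (Fin (n + 1)) ℝ :=
  Matrix.of fun k => Fin.cons 1 fun j => (a k - b j)⁻¹

/-- The absolute value of the Vandermonde determinant. -/
def absVand {n : ℕ} (y : Fin n → ℝ) : ℝ := |(Matrix.vandermonde y).det|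

/-- The polynomials whose values form the numerators of the bordered Cauchy matrix. -/
def nodePoly {n : ℕ} (b : Fin n → ℝ) : Fin (n + 1) → Polynomial ℝ :=
  Fin.cons (∏ l, (Polynomial.X - Polynomial.C (b l)))
    fun j => ∏ l ∈ Finset.univ.erase j, (Polynomial.X - Polynomial.C (b l))

theorem natDegree_nodePoly_zero {n : ℕ} (b : Fin n → ℝ) : (nodePoly b 0).natDegree = n := by
  simp [nodePoly]

theorem natDegree_nodePoly_succ {n : ℕ} (b : Fin n → ℝ) (j : Fin n) :
    (nodePoly b j.succ).natDegree < n := by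
  have : 0 < n := j.pos
  simp [nodePoly, Finset.card_erase_of_mem]
  omega

theorem prod_erase_sub_eq {n : ℕ} (b : Fin n → ℝ) :
    ∏ j, ∏ l ∈ Finset.univ.erase j, |b j - b l| = absVand b ^ 2 := by
  have h1 : absVand b = ∏ i, ∏ j ∈ Finset.Ioi i, |b j - b i| := by
    simp [absVand, Matrix.det_vandermonde, Finset.abs_prod]
  have h2 : absVand b = ∏ i, ∏ j ∈ Finset.Iio i, |b i - b j| := by
    rw [h1, Finset.prod_comm' (t' := Finset.univ) (s' := fun i => Finset.Iio i)]
    simp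
  have h3 : ∀ j : Fin n, Finset.univ.erase j = Finset.Iio j ∪ Finset.Ioi j := by
    intro j; ext k; simp
  rw [sq]
  nth_rewrite 1 [h2]
  rw [h1, ← Finset.prod_mul_distrib]
  refine Finset.prod_congr rfl fun j _ => ?_
  rw [h3, Finset.prod_union]
  · congr 1
    exact Finset.prod_congr rfl fun k _ => abs_sub_comm _ _
  · rw [Finset.disjoint_left]; intro k; simp; intro h; exact h.le

theorem abs_det_coeff_nodePoly {n : ℕ} (b : Fin n → ℝ) (hb : Function.Injective b) :
    |(Matrix.of fun (d j : Fin (n + 1)) => (nodePoly b j).coeff d).det| = absVand b := by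
  set Cf := Matrix.of fun (d j : Fin (n + 1)) => (nodePoly b j).coeff d with hCf
  let W : Matrix (Fin (n + 1)) (Fin (n + 1)) ℝ :=
    Matrix.of (Fin.cons (Pi.single (Fin.last n) 1) fun i d => b i ^ (d : ℕ))
  have hW : |W.det| = absVand b := by
    rw [Matrix.det_succ_row_zero, Finset.sum_eq_single (Fin.last n)]
    · simp only [abs_mul, abs_pow, abs_neg, abs_one, one_pow, one_mul]
      have : W 0 (Fin.last n) = 1 := by simp [W]
      rw [this, abs_one, one_mul, absVand]
      congr 2
      ext i j
      simp [W, Matrix.vandermonde_apply]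
    · intro d _ hd
      simp [W, hd]
    · simp
  have hprod : W * Cf = Matrix.diagonal
      (Fin.cons 1 fun j => ∏ l ∈ Finset.univ.erase j, (b j - b l)) := by
    ext i j
    rw [Matrix.mul_apply]
    refine Fin.cases ?_ (fun i => ?_) i
    · have h0 : ∑ k, W 0 k * Cf k j = (nodePoly b j).coeff n := by
        rw [Finset.sum_eq_single (Fin.last n)]
        · simp [W, Cf]
        · intro d _ hd; simp [W, hd]
        · simp
      rw [h0]
      refine Fin.cases ?_ (fun j => ?_) j
      · have hm : (nodePoly b 0).Monic := by
          simp only [nodePoly, Fin.cons_zero]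
          exact Polynomial.monic_prod_of_monic _ _ fun l _ => Polynomial.monic_X_sub_C _
        have := hm.coeff_natDegree
        rw [natDegree_nodePoly_zero] at this
        simp [this]
      · rw [Polynomial.coeff_eq_zero_of_natDegree_lt (natDegree_nodePoly_succ b j)]
        rw [Matrix.diagonal_apply_ne _ (Fin.succ_ne_zero j).symm]
    · have h0 : ∑ k, W i.succ k * Cf k j = (nodePoly b j).eval (b i) := by
        rw [Polynomial.eval_eq_sum_range' (n := n + 1), Finset.sum_range]
        · exact Finset.sum_congr rfl fun d _ => by simp [W, Cf, mul_comm]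
        · refine Fin.cases ?_ (fun j => ?_) j
          · rw [natDegree_nodePoly_zero]; omega
          · have := natDegree_nodePoly_succ b j; omega
      rw [h0]
      refine Fin.cases ?_ (fun j => ?_) j
      · rw [Matrix.diagonal_apply_ne _ (Fin.succ_ne_zero i)]
        simp only [nodePoly, Fin.cons_zero, Polynomial.eval_prod]
        exact Finset.prod_eq_zero (Finset.mem_univ i) (by simp)
      · simp only [nodePoly, Fin.cons_succ, Polynomial.eval_prod, Polynomial.eval_sub,
          Polynomial.eval_X, Polynomial.eval_C]
        by_cases hij : i = j
        · subst hij; simp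
        · rw [Matrix.diagonal_apply_ne _ (by simpa using hij)]
          exact Finset.prod_eq_zero (Finset.mem_erase.2 ⟨hij, Finset.mem_univ i⟩) (by simp)
  have hdet := congrArg (fun A => |Matrix.det A|) hprod
  simp only [Matrix.det_mul, Matrix.det_diagonal, abs_mul, Fin.prod_univ_succ, Fin.cons_zero,
    Fin.cons_succ, one_mul, Finset.abs_prod] at hdet
  rw [prod_erase_sub_eq, hW, sq] at hdet
  have hne : absVand b ≠ 0 := by
    rw [absVand, abs_ne_zero]
    exact Matrix.det_vandermonde_ne_zero_iff.2 hb
  exact mul_left_cancel₀ hne hdet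

theorem abs_det_borderedCauchy {n : ℕ} (a : Fin (n + 1) → ℝ) (b : Fin n → ℝ)
    (hb : Function.Injective b) (hab : ∀ k j, a k ≠ b j) :
    |(borderedCauchy a b).det| * ∏ k, ∏ j, |a k - b j| = absVand a * absVand b := by
  have h1 : Matrix.diagonal (fun k => ∏ l, (a k - b l)) * borderedCauchy a b =
      Matrix.of fun k j => (nodePoly b j).eval (a k) := by
    ext k j
    rw [Matrix.diagonal_mul]
    refine Fin.cases ?_ (fun j => ?_) j
    · simp [borderedCauchy, nodePoly, Polynomial.eval_prod]
    · simp only [borderedCauchy, nodePoly, Matrix.of_apply, Fin.cons_succ, Polynomial.eval_prod,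
        Polynomial.eval_sub, Polynomial.eval_X, Polynomial.eval_C]
      rw [← Finset.mul_prod_erase _ _ (Finset.mem_univ j)]
      have := sub_ne_zero.2 (hab k j)
      field_simp
  rw [eval_matrix_eq_vandermonde_mul a (nodePoly b) (fun j => by
    refine Fin.cases ?_ (fun j => ?_) j
    · rw [natDegree_nodePoly_zero]; omega
    · have := natDegree_nodePoly_succ b j; omega)] at h1
  have hdet := congrArg (fun A => |Matrix.det A|) h1
  simp only [Matrix.det_mul, Matrix.det_diagonal, abs_mul, Finset.abs_prod] at hdet
  rw [abs_det_coeff_nodePoly b hb] at hdet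
  rw [mul_comm, hdet]; rfl

/-- Strict interlacing of `n + 1` reals with `n` reals. -/
def Interlaces {n : ℕ} (y : Fin (n + 1) → ℝ) (x : Fin n → ℝ) : Prop :=
  ∀ i : Fin n, y i.castSucc < x i ∧ x i < y i.succ

theorem Interlaces.strictMono_outer {n : ℕ} {y : Fin (n + 1) → ℝ} {x : Fin n → ℝ}
    (h : Interlaces y x) : StrictMono y :=
  Fin.strictMono_iff_lt_succ.2 fun i => (h i).1.trans (h i).2

theorem Interlaces.strictMono_inner {n : ℕ} {y : Fin (n + 1) → ℝ} {x : Fin n → ℝ}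
    (h : Interlaces y x) : StrictMono x := by
  cases n with
  | zero => exact fun i => i.elim0
  | succ n =>
    refine Fin.strictMono_iff_lt_succ.2 fun i => (h i.castSucc).2.trans ?_
    rw [Fin.succ_castSucc]
    exact (h i.succ).1

theorem Interlaces.lt_or_lt {n : ℕ} {y : Fin (n + 1) → ℝ} {x : Fin n → ℝ}
    (h : Interlaces y x) (i : Fin (n + 1)) (j : Fin n) :
    (j.castSucc < i ∧ x j < y i) ∨ (i ≤ j.castSucc ∧ y i < x j) := by
  rcases lt_or_ge j.castSucc i with hji | hji
  · refine Or.inl ⟨hji, (h j).2.trans_le (h.strictMono_outer.monotone ?_)⟩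
    exact Fin.castSucc_lt_iff_succ_le.1 hji
  · exact Or.inr ⟨hji, (h.strictMono_outer.monotone hji).trans_lt (h j).1⟩

theorem Interlaces.ne {n : ℕ} {y : Fin (n + 1) → ℝ} {x : Fin n → ℝ}
    (h : Interlaces y x) (i : Fin (n + 1)) (j : Fin n) : y i ≠ x j := by
  rcases h.lt_or_lt i j with h | h
  · exact h.2.ne'
  · exact h.2.ne

/-- The derivative at the node `y i` of the polynomial with roots `y`. -/
def nodeDen {n : ℕ} (y : Fin (n + 1) → ℝ) (i : Fin (n + 1)) : ℝ :=
  ∏ j : Fin n, (y i - y (i.succAbove j))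

/-- The residues of `∏ (u - x) / ∏ (u - y)`. -/
def innerWeight {n : ℕ} (y : Fin (n + 1) → ℝ) (x : Fin n → ℝ) (i : Fin (n + 1)) : ℝ :=
  (∏ j, (y i - x j)) / nodeDen y i

/-- The negated residues of `∏ (u - z) / ∏ (u - y)`. -/
def outerWeight {n : ℕ} (y : Fin (n + 1) → ℝ) (z : Fin (n + 2) → ℝ) (i : Fin (n + 1)) : ℝ :=
  -(∏ k, (y i - z k)) / nodeDen y i

theorem nodeDen_ne_zero {n : ℕ} {y : Fin (n + 1) → ℝ} (hy : Function.Injective y)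
    (i : Fin (n + 1)) : nodeDen y i ≠ 0 :=
  Finset.prod_ne_zero_iff.2 fun j _ => sub_ne_zero.2 fun h => Fin.succAbove_ne i j (hy h).symm

theorem innerWeight_pos {n : ℕ} {y : Fin (n + 1) → ℝ} {x : Fin n → ℝ} (h : Interlaces y x)
    (i : Fin (n + 1)) : 0 < innerWeight y x i := by
  rw [innerWeight, nodeDen, ← Finset.prod_div_distrib]
  refine Finset.prod_pos fun j _ => ?_
  rcases h.lt_or_lt i j with ⟨hij, hx⟩ | ⟨hij, hx⟩
  · rw [Fin.succAbove_of_castSucc_lt _ _ hij]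
    exact div_pos (sub_pos.2 hx) (sub_pos.2 (h.strictMono_outer hij))
  · rw [Fin.succAbove_of_le_castSucc _ _ hij]
    refine div_pos_of_neg_of_neg (sub_neg.2 hx) (sub_neg.2 (h.strictMono_outer ?_))
    exact hij.trans_lt Fin.castSucc_lt_succ

theorem outerWeight_pos {n : ℕ} {y : Fin (n + 1) → ℝ} {z : Fin (n + 2) → ℝ}
    (h : Interlaces z y) (i : Fin (n + 1)) : 0 < outerWeight y z i := by
  have hx : Interlaces y fun j : Fin n => z j.succ.castSucc := fun j => by
    constructor
    · have := (h j.castSucc).2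
      rwa [Fin.succ_castSucc] at this
    · exact (h j.succ).1
  have h0 : z 0 < y i := (h.strictMono_outer.monotone (Fin.zero_le _)).trans_lt (h i).1
  have h1 : y i < z (Fin.last _) := (h i).2.trans_le (h.strictMono_outer.monotone (Fin.le_last _))
  have : outerWeight y z i = (y i - z 0) * (z (Fin.last _) - y i) *
      innerWeight y (fun j : Fin n => z j.succ.castSucc) i := by
    rw [outerWeight, innerWeight, Fin.prod_univ_castSucc, Fin.prod_univ_succ]
    simp only [Fin.castSucc_zero]
    ring
  rw [this]
  exact mul_pos (mul_pos (sub_pos.2 h0) (sub_pos.2 h1)) (innerWeight_pos hx i)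

/-- The monic polynomial with prescribed roots. -/
def rootPoly {n : ℕ} (y : Fin n → ℝ) : Polynomial ℝ := ∏ i, (Polynomial.X - Polynomial.C (y i))

theorem rootPoly_monic {n : ℕ} (y : Fin n → ℝ) : (rootPoly y).Monic :=
  Polynomial.monic_prod_of_monic _ _ fun _ _ => Polynomial.monic_X_sub_C _

theorem natDegree_rootPoly {n : ℕ} (y : Fin n → ℝ) : (rootPoly y).natDegree = n := by
  simp [rootPoly]

theorem eval_rootPoly {n : ℕ} (y : Fin n → ℝ) (u : ℝ) : (rootPoly y).eval u = ∏ i, (u - y i) := by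
  simp [rootPoly, Polynomial.eval_prod]

theorem rootPoly_coeff_self {n : ℕ} (y : Fin n → ℝ) : (rootPoly y).coeff n = 1 := by
  have := (rootPoly_monic y).coeff_natDegree
  rwa [natDegree_rootPoly] at this

theorem rootPoly_coeff_pred {n : ℕ} (y : Fin (n + 1) → ℝ) :
    (rootPoly y).coeff n = -∑ i, y i := by
  have := Polynomial.prod_X_sub_C_nextCoeff (s := Finset.univ) y
  rw [Polynomial.nextCoeff_of_natDegree_pos] at this
  · have h := natDegree_rootPoly y
    rw [rootPoly] at h
    rw [h] at this
    exact this
  · have h := natDegree_rootPoly y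
    rw [rootPoly] at h
    omega

theorem rootPoly_cons {n : ℕ} (T : ℝ) (y : Fin n → ℝ) :
    rootPoly (Fin.cons T y : Fin (n + 1) → ℝ) =
      (Polynomial.X - Polynomial.C T) * rootPoly y := by
  simp [rootPoly, Fin.prod_univ_succ]

theorem rootPoly_eq_succAbove {n : ℕ} (y : Fin (n + 1) → ℝ) (i : Fin (n + 1)) :
    rootPoly y = (Polynomial.X - Polynomial.C (y i)) * rootPoly (fun j => y (i.succAbove j)) := by
  simp [rootPoly, Fin.prod_univ_succAbove _ i]

theorem rootPoly_injOn {n : ℕ} {x y : Fin n → ℝ} (hx : StrictMono x) (hy : StrictMono y)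
    (h : rootPoly x = rootPoly y) : x = y := by
  have hr : ∀ z : Fin n → ℝ, Set.range z = {u | (rootPoly z).eval u = 0} := by
    intro z; ext u
    simp only [Set.mem_range, eval_rootPoly, Set.mem_ofPred_eq, Finset.prod_eq_zero_iff,
      Finset.mem_univ, true_and, sub_eq_zero]
    exact exists_congr fun _ => eq_comm
  rw [← StrictMono.range_inj hx hy, hr, hr, h]

theorem eval_rootPoly_succAbove_self {n : ℕ} (y : Fin (n + 1) → ℝ) (i : Fin (n + 1)) :
    (rootPoly fun j => y (i.succAbove j)).eval (y i) = nodeDen y i := by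
  rw [eval_rootPoly, nodeDen]

theorem eval_rootPoly_succAbove_of_ne {n : ℕ} (y : Fin (n + 1) → ℝ) {i k : Fin (n + 1)}
    (h : k ≠ i) : (rootPoly fun j => y (i.succAbove j)).eval (y k) = 0 := by
  obtain ⟨j, rfl⟩ := Fin.exists_succAbove_eq h
  rw [eval_rootPoly]
  exact Finset.prod_eq_zero (Finset.mem_univ j) (sub_self _)

theorem eval_sum_rootPoly_succAbove {n : ℕ} (y : Fin (n + 1) → ℝ) (r : Fin (n + 1) → ℝ)
    (k : Fin (n + 1)) :
    (∑ i, Polynomial.C (r i) * rootPoly fun j => y (i.succAbove j)).eval (y k) =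
      r k * nodeDen y k := by
  rw [Polynomial.eval_finsetSum, Finset.sum_eq_single k]
  · simp [eval_rootPoly_succAbove_self]
  · intro i _ hi
    simp [eval_rootPoly_succAbove_of_ne y hi.symm]
  · simp

theorem natDegree_sum_rootPoly_succAbove_le {n : ℕ} (y : Fin (n + 1) → ℝ) (r : Fin (n + 1) → ℝ) :
    (∑ i, Polynomial.C (r i) * rootPoly fun j => y (i.succAbove j)).natDegree ≤ n :=
  Polynomial.natDegree_sum_le_of_forall_le _ _ fun _ _ =>
    (Polynomial.natDegree_C_mul_le _ _).trans (natDegree_rootPoly _).le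

theorem coeff_sum_rootPoly_succAbove {n : ℕ} (y : Fin (n + 1) → ℝ) (r : Fin (n + 1) → ℝ) :
    (∑ i, Polynomial.C (r i) * rootPoly fun j => y (i.succAbove j)).coeff n = ∑ i, r i := by
  simp [Polynomial.finsetSum_coeff, rootPoly_coeff_self]

/-- Polynomials of small degree agreeing at distinct nodes are equal. -/
theorem poly_eq_of_eval_nodes {m : ℕ} {y : Fin m → ℝ} (hy : Function.Injective y)
    {P Q : Polynomial ℝ} (hd : (P - Q).degree < m) (h : ∀ i, P.eval (y i) = Q.eval (y i)) :
    P = Q :=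
  Polynomial.eq_of_degree_sub_lt_of_eval_index_eq Finset.univ hy.injOn (by simpa using hd)
    fun i _ => h i

theorem degree_sub_lt_of_coeff_eq {m : ℕ} {P Q : Polynomial ℝ} (hP : P.natDegree ≤ m)
    (hQ : Q.natDegree ≤ m) (h : P.coeff m = Q.coeff m) : (P - Q).degree < m := by
  rw [Polynomial.degree_lt_iff_coeff_zero]
  intro k hk
  rcases hk.eq_or_lt with rfl | hk
  · simp [h]
  · rw [Polynomial.coeff_sub, Polynomial.coeff_eq_zero_of_natDegree_lt (hP.trans_lt hk),
      Polynomial.coeff_eq_zero_of_natDegree_lt (hQ.trans_lt hk), sub_zero]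

theorem degree_rootPoly_sub_lt {m : ℕ} {z w : Fin (m + 1) → ℝ} (h : ∑ i, z i = ∑ i, w i) :
    (rootPoly z - rootPoly w).degree < m := by
  rw [Polynomial.degree_lt_iff_coeff_zero]
  intro k hk
  rcases hk.eq_or_lt with rfl | hk
  · simp [rootPoly_coeff_pred, h]
  · have := degree_sub_lt_of_coeff_eq (natDegree_rootPoly z).le (natDegree_rootPoly w).le
      (by rw [rootPoly_coeff_self, rootPoly_coeff_self])
    exact (Polynomial.degree_lt_iff_coeff_zero _ _).1 this k hk

/-- Lagrange interpolation at the nodes `y`. -/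
theorem poly_eq_sum_rootPoly {n : ℕ} {y : Fin (n + 1) → ℝ} (hy : Function.Injective y)
    {P : Polynomial ℝ} (hP : P.degree < (n + 1 : ℕ)) :
    P = ∑ i, Polynomial.C (P.eval (y i) / nodeDen y i) * rootPoly fun j => y (i.succAbove j) := by
  refine poly_eq_of_eval_nodes hy ?_ fun i => ?_
  · refine (Polynomial.degree_sub_le _ _).trans_lt (max_lt hP ?_)
    exact (Polynomial.degree_le_of_natDegree_le
      (natDegree_sum_rootPoly_succAbove_le y _)).trans_lt (by exact_mod_cast Nat.lt_succ_self n)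
  · rw [eval_sum_rootPoly_succAbove, div_mul_cancel₀ _ (nodeDen_ne_zero hy i)]

theorem rootPoly_eq_sum_innerWeight {n : ℕ} {y : Fin (n + 1) → ℝ} (hy : Function.Injective y)
    (x : Fin n → ℝ) :
    rootPoly x = ∑ i, Polynomial.C (innerWeight y x i) *
      rootPoly fun j => y (i.succAbove j) := by
  have h := poly_eq_sum_rootPoly hy (P := rootPoly x) ?_
  · simpa only [innerWeight, eval_rootPoly] using h
  · rw [Polynomial.degree_eq_natDegree (rootPoly_monic x).ne_zero, natDegree_rootPoly]
    exact_mod_cast Nat.lt_succ_self n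

theorem sum_innerWeight {n : ℕ} {y : Fin (n + 1) → ℝ} (hy : Function.Injective y)
    (x : Fin n → ℝ) : ∑ i, innerWeight y x i = 1 := by
  have h := congrArg (fun P => P.coeff n) (rootPoly_eq_sum_innerWeight hy x)
  simp only [rootPoly_coeff_self, coeff_sum_rootPoly_succAbove] at h
  exact h.symm

theorem rootPoly_eq_outerWeight {n : ℕ} {y : Fin (n + 1) → ℝ} (hy : Function.Injective y)
    (z : Fin (n + 2) → ℝ) :
    rootPoly z = (Polynomial.X - Polynomial.C (∑ k, z k - ∑ i, y i)) * rootPoly y -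
      ∑ i, Polynomial.C (outerWeight y z i) * rootPoly fun j => y (i.succAbove j) := by
  have hd : (rootPoly z - rootPoly (Fin.cons (∑ k, z k - ∑ i, y i) y :
      Fin (n + 2) → ℝ)).degree < (n + 1 : ℕ) :=
    degree_rootPoly_sub_lt (by rw [Fin.sum_univ_succ (n := n + 1) (f := Fin.cons _ y)]; simp)
  have h := poly_eq_sum_rootPoly hy hd
  rw [rootPoly_cons] at h
  have he : ∀ i, (rootPoly z - (Polynomial.X - Polynomial.C (∑ k, z k - ∑ i, y i)) *
      rootPoly y).eval (y i) / nodeDen y i = - outerWeight y z i := by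
    intro i
    have : ∏ j, (y i - y j) = 0 := Finset.prod_eq_zero (Finset.mem_univ i) (sub_self _)
    simp [eval_rootPoly, this, outerWeight, neg_div]
  simp only [he, Polynomial.C_neg, neg_mul, Finset.sum_neg_distrib] at h
  linear_combination h

theorem sum_innerWeight_mul {n : ℕ} {y : Fin (n + 1) → ℝ} (hy : Function.Injective y)
    (x : Fin n → ℝ) : ∑ i, innerWeight y x i * y i = ∑ i, y i - ∑ j, x j := by
  have h := congrArg (fun P => Polynomial.X * P) (rootPoly_eq_sum_innerWeight hy x)
  have h2 : ∀ i, Polynomial.X * (Polynomial.C (innerWeight y x i) *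
      rootPoly fun j => y (i.succAbove j)) = Polynomial.C (innerWeight y x i) * rootPoly y +
        Polynomial.C (innerWeight y x i * y i) * rootPoly fun j => y (i.succAbove j) := by
    intro i
    rw [rootPoly_eq_succAbove y i, Polynomial.C_mul]; ring
  simp only [Finset.mul_sum, h2, Finset.sum_add_distrib] at h
  have h3 := congrArg (fun P => P.coeff n) h
  have h4 : Polynomial.X * rootPoly x = rootPoly (Fin.cons 0 x : Fin (n + 1) → ℝ) := by
    rw [rootPoly_cons]; simp
  simp only [h4, Polynomial.coeff_add, coeff_sum_rootPoly_succAbove, rootPoly_coeff_pred,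
    ← Finset.sum_mul, ← map_sum, sum_innerWeight hy, Polynomial.coeff_C_mul] at h3
  rw [Fin.sum_univ_succ] at h3
  simp at h3
  linarith

theorem exists_root_of_mul_neg {f : ℝ → ℝ} (hf : Continuous f) {a b : ℝ} (hab : a < b)
    (h : f a * f b < 0) : ∃ c, (a < c ∧ c < b) ∧ f c = 0 := by
  rcases mul_neg_iff.1 h with ⟨h1, h2⟩ | ⟨h1, h2⟩
  · obtain ⟨c, hc, h⟩ := intermediate_value_Ioo' hab.le hf.continuousOn ⟨h2, h1⟩
    exact ⟨c, hc, h⟩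
  · obtain ⟨c, hc, h⟩ := intermediate_value_Ioo hab.le hf.continuousOn ⟨h1, h2⟩
    exact ⟨c, hc, h⟩

theorem nodeDen_mul_succ_neg {n : ℕ} {y : Fin (n + 1) → ℝ} (hy : StrictMono y) (i : Fin n) :
    nodeDen y i.castSucc * nodeDen y i.succ < 0 := by
  have hpos : ∀ j : Fin n, j ≠ i → i.castSucc.succAbove j = i.succ.succAbove j ∧
      0 < (y i.castSucc - y (i.succ.succAbove j)) * (y i.succ - y (i.succ.succAbove j)) := by
    intro j hj
    rcases lt_or_gt_of_ne hj with h | h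
    · rw [Fin.succAbove_of_castSucc_lt _ _ (show j.castSucc < i.castSucc from h),
        Fin.succAbove_of_castSucc_lt _ _
          (show j.castSucc < i.succ from (show j.castSucc < i.castSucc from h).trans
            Fin.castSucc_lt_succ)]
      refine ⟨rfl, mul_pos (sub_pos.2 (hy h)) (sub_pos.2 (hy ?_))⟩
      exact (show j.castSucc < i.castSucc from h).trans Fin.castSucc_lt_succ
    · have h' : i.succ ≤ j.castSucc := Fin.castSucc_lt_iff_succ_le.1 h
      rw [Fin.succAbove_of_le_castSucc _ _ (show i.castSucc ≤ j.castSucc from h.le),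
        Fin.succAbove_of_le_castSucc _ _ h']
      refine ⟨rfl, mul_pos_of_neg_of_neg (sub_neg.2 (hy ?_)) (sub_neg.2 (hy ?_))⟩
      · exact (show i.castSucc < j.castSucc from h).trans Fin.castSucc_lt_succ
      · exact h'.trans_lt Fin.castSucc_lt_succ
  rw [nodeDen, nodeDen, ← Finset.prod_mul_distrib, ← Finset.mul_prod_erase _ _ (Finset.mem_univ i)]
  refine mul_neg_of_neg_of_pos ?_ (Finset.prod_pos fun j hj => ?_)
  · have := hy (Fin.castSucc_lt_succ (i := i))
    simp only [Fin.succAbove_castSucc_self, Fin.succAbove_succ_self]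
    nlinarith
  · obtain ⟨h1, h2⟩ := hpos j (Finset.ne_of_mem_erase hj)
    rwa [h1]

theorem exists_interlacing_roots {n : ℕ} {y : Fin (n + 1) → ℝ} (hy : StrictMono y)
    (P : Polynomial ℝ) (h : ∀ i, 0 < P.eval (y i) * nodeDen y i) :
    ∃ x : Fin n → ℝ, Interlaces y x ∧ ∀ j, P.eval (x j) = 0 := by
  have : ∀ i : Fin n, ∃ c, (y i.castSucc < c ∧ c < y i.succ) ∧ P.eval c = 0 := by
    intro i
    refine exists_root_of_mul_neg P.continuous (hy Fin.castSucc_lt_succ) ?_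
    have h1 := mul_pos (h i.castSucc) (h i.succ)
    have h2 := nodeDen_mul_succ_neg hy i
    by_contra! h3
    nlinarith [mul_nonpos_of_nonneg_of_nonpos h3 h2.le]
  choose x hx using this
  exact ⟨x, fun i => (hx i).1, fun i => (hx i).2⟩

theorem exists_innerWeight_eq {n : ℕ} {y : Fin (n + 1) → ℝ} (hy : StrictMono y)
    {r : Fin (n + 1) → ℝ} (hr : ∀ i, 0 < r i) :
    ∃ x : Fin n → ℝ, Interlaces y x ∧ ∀ i, (∑ k, r k) * innerWeight y x i = r i := by
  set Q := ∑ i, Polynomial.C (r i) * rootPoly fun j => y (i.succAbove j) with hQ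
  obtain ⟨x, hx, hroot⟩ := exists_interlacing_roots hy Q fun i => by
    rw [hQ, eval_sum_rootPoly_succAbove, mul_assoc]
    exact mul_pos (hr i) (mul_self_pos.2 (nodeDen_ne_zero hy.injective i))
  refine ⟨x, hx, fun i => ?_⟩
  have hQx : Q = Polynomial.C (∑ k, r k) * rootPoly x := by
    refine poly_eq_of_eval_nodes hx.strictMono_inner.injective ?_ fun j => ?_
    · refine degree_sub_lt_of_coeff_eq (natDegree_sum_rootPoly_succAbove_le y r)
        ((Polynomial.natDegree_C_mul_le _ _).trans (natDegree_rootPoly _).le) ?_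
      rw [hQ, coeff_sum_rootPoly_succAbove, Polynomial.coeff_C_mul, rootPoly_coeff_self, mul_one]
    · rw [hroot, Polynomial.eval_mul, eval_rootPoly,
        Finset.prod_eq_zero (Finset.mem_univ j) (sub_self _), mul_zero]
  have h := congrArg (Polynomial.eval (y i)) hQx
  rw [hQ, eval_sum_rootPoly_succAbove, Polynomial.eval_mul, eval_rootPoly, Polynomial.eval_C] at h
  rw [innerWeight, ← mul_div_assoc, ← h, mul_div_assoc, div_self (nodeDen_ne_zero hy.injective i),
    mul_one]

theorem Interlaces.cons_snoc {n : ℕ} {y : Fin (n + 1) → ℝ} {x : Fin n → ℝ} (h : Interlaces y x)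
    {a b : ℝ} (ha : a < y 0) (hb : y (Fin.last n) < b) :
    Interlaces (Fin.cons a (Fin.snoc x b : Fin (n + 1) → ℝ) : Fin (n + 2) → ℝ) y := by
  intro i
  constructor
  · refine Fin.cases ?_ (fun k => ?_) i
    · simpa using ha
    · rw [← Fin.succ_castSucc, Fin.cons_succ, Fin.snoc_castSucc]
      exact (h k).2
  · rw [Fin.cons_succ]
    refine Fin.lastCases ?_ (fun k => ?_) i
    · simpa using hb
    · rw [Fin.snoc_castSucc]
      exact (h k).1

theorem forall_cons_snoc {n : ℕ} {p : ℝ → Prop} {a b : ℝ} {x : Fin n → ℝ} (ha : p a) (hb : p b)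
    (hx : ∀ j, p (x j)) (k : Fin (n + 2)) :
    p ((Fin.cons a (Fin.snoc x b : Fin (n + 1) → ℝ) : Fin (n + 2) → ℝ) k) := by
  induction k using Fin.cases with
  | zero => simpa using ha
  | succ k =>
    induction k using Fin.lastCases with
    | last => simpa using hb
    | cast k => simpa using hx k

theorem exists_outerWeight_eq {n : ℕ} {y : Fin (n + 1) → ℝ} (hy : StrictMono y)
    {s : Fin (n + 1) → ℝ} (hs : ∀ i, 0 < s i) (T : ℝ) :
    ∃ z : Fin (n + 2) → ℝ, Interlaces z y ∧ ∑ k, z k - ∑ i, y i = T ∧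
      ∀ i, outerWeight y z i = s i := by
  set P := (Polynomial.X - Polynomial.C T) * rootPoly y -
      ∑ i, Polynomial.C (s i) * rootPoly fun j => y (i.succAbove j) with hP
  have hden := nodeDen_ne_zero hy.injective
  have hPy : ∀ i, P.eval (y i) = - s i * nodeDen y i := by
    intro i
    rw [hP, Polynomial.eval_sub, eval_sum_rootPoly_succAbove, Polynomial.eval_mul, eval_rootPoly,
      Finset.prod_eq_zero (Finset.mem_univ i) (sub_self _)]
    ring
  have hfac : ∀ u, (∀ i, u ≠ y i) → P.eval u =
      (∏ i, (u - y i)) * (u - T - ∑ i, s i / (u - y i)) := by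
    intro u hu
    rw [hP, Polynomial.eval_sub, Polynomial.eval_finsetSum, mul_sub, Finset.mul_sum,
      Polynomial.eval_mul, eval_rootPoly, Polynomial.eval_sub, Polynomial.eval_X, Polynomial.eval_C,
      mul_comm]
    congr 1
    refine Finset.sum_congr rfl fun i _ => ?_
    rw [Polynomial.eval_mul, Polynomial.eval_C, eval_rootPoly, Fin.prod_univ_succAbove _ i]
    have := sub_ne_zero.2 (hu i)
    field_simp
  have hsum : 0 < ∑ i, s i := Finset.sum_pos (fun i _ => hs i) Finset.univ_nonempty
  obtain ⟨x, hx, hxroot⟩ := exists_interlacing_roots hy (-P) fun i => by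
    rw [Polynomial.eval_neg, hPy]
    have := mul_pos (hs i) (mul_self_pos.2 (hden i))
    linarith
  obtain ⟨a, ⟨-, ha⟩, haroot⟩ : ∃ c, (min (y 0 - 1) (T - ∑ i, s i - 1) < c ∧ c < y 0) ∧
      P.eval c = 0 := by
    set L := min (y 0 - 1) (T - ∑ i, s i - 1) with hL
    have hL0 : L ≤ y 0 - 1 := min_le_left _ _
    have hL1 : L ≤ T - ∑ i, s i - 1 := min_le_right _ _
    have hLy : ∀ i, L ≤ y i - 1 := fun i => by
      have := hy.monotone (Fin.zero_le i); linarith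
    refine exists_root_of_mul_neg P.continuous (by linarith) ?_
    rw [hfac L (fun i => by have := hLy i; linarith), hPy, Fin.prod_univ_succ]
    have h1 : L - T - ∑ i, s i / (L - y i) < 0 := by
      have : ∑ i, -(s i / (L - y i)) ≤ ∑ i, s i := by
        refine Finset.sum_le_sum fun i _ => ?_
        rw [← div_neg]
        exact div_le_self (hs i).le (by have := hLy i; linarith)
      rw [Finset.sum_neg_distrib] at this
      linarith
    have h2 : 0 < (∏ i : Fin n, (L - y i.succ)) * nodeDen y 0 := by
      rw [nodeDen, ← Finset.prod_mul_distrib]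
      refine Finset.prod_pos fun j _ => ?_
      have h3 := hLy j.succ
      have h4 := hy (Fin.succ_pos j)
      simp only [Fin.zero_succAbove]
      exact mul_pos_of_neg_of_neg (by linarith) (by linarith)
    have h3 : L - y 0 < 0 := by linarith
    have h4 := mul_pos (mul_pos_of_neg_of_neg h1 h3) (mul_pos (hs 0) h2)
    linarith
  obtain ⟨b, ⟨hb, -⟩, hbroot⟩ : ∃ c, (y (Fin.last n) < c ∧
      c < max (y (Fin.last n) + 1) (T + ∑ i, s i + 1)) ∧ P.eval c = 0 := by
    set U := max (y (Fin.last n) + 1) (T + ∑ i, s i + 1) with hU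
    have hU0 : y (Fin.last n) + 1 ≤ U := le_max_left _ _
    have hU1 : T + ∑ i, s i + 1 ≤ U := le_max_right _ _
    have hUy : ∀ i, y i + 1 ≤ U := fun i => by
      have := hy.monotone (Fin.le_last i); linarith
    refine exists_root_of_mul_neg P.continuous (by linarith) ?_
    rw [hfac U (fun i => by have := hUy i; linarith), hPy]
    have h1 : 0 < U - T - ∑ i, s i / (U - y i) := by
      have : ∑ i, s i / (U - y i) ≤ ∑ i, s i :=
        Finset.sum_le_sum fun i _ => div_le_self (hs i).le (by have := hUy i; linarith)
      linarith
    have h2 : 0 < ∏ i, (U - y i) :=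
      Finset.prod_pos fun i _ => by have := hUy i; linarith
    have h3 : 0 < nodeDen y (Fin.last n) := by
      refine Finset.prod_pos fun j _ => sub_pos.2 (hy ?_)
      rw [Fin.succAbove_last]; exact Fin.castSucc_lt_last j
    have h4 := mul_pos (mul_pos h1 h2) (mul_pos (hs (Fin.last n)) h3)
    linarith
  have hz := hx.cons_snoc ha hb
  have hzroot := forall_cons_snoc (p := fun u => P.eval u = 0) haroot hbroot
    (fun j => by simpa using hxroot j)
  generalize (Fin.cons a (Fin.snoc x b : Fin (n + 1) → ℝ) : Fin (n + 2) → ℝ) = z at hz hzroot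
  have hlow := natDegree_sum_rootPoly_succAbove_le y s
  rw [← rootPoly_cons] at hP
  have hdegP : P.natDegree ≤ n + 2 := by
    rw [hP]
    exact (Polynomial.natDegree_sub_le _ _).trans
      (max_le (natDegree_rootPoly _).le (hlow.trans (by omega)))
  have hPz : P = rootPoly z := by
    refine poly_eq_of_eval_nodes hz.strictMono_outer.injective ?_ fun k => ?_
    · refine degree_sub_lt_of_coeff_eq hdegP (natDegree_rootPoly _).le ?_
      · rw [hP, Polynomial.coeff_sub, rootPoly_coeff_self, rootPoly_coeff_self,
          Polynomial.coeff_eq_zero_of_natDegree_lt (by omega), sub_zero]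
    · rw [hzroot, eval_rootPoly, Finset.prod_eq_zero (Finset.mem_univ k) (sub_self _)]
  refine ⟨z, hz, ?_, fun i => ?_⟩
  · have h := congrArg (fun P => Polynomial.coeff P (n + 1)) hPz
    have h0 := Polynomial.coeff_eq_zero_of_natDegree_lt (Nat.lt_succ_of_le hlow)
    simp only [hP, Polynomial.coeff_sub, rootPoly_coeff_pred, Nat.succ_eq_add_one] at h h0
    rw [Fin.sum_univ_succ (f := Fin.cons T y)] at h
    simp only [Fin.cons_zero, Fin.cons_succ, h0] at h
    linarith
  · have h := congrArg (Polynomial.eval (y i)) hPz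
    rw [hPy, eval_rootPoly] at h
    rw [outerWeight, ← h, neg_mul, neg_neg, mul_div_assoc, div_self (hden i), mul_one]

theorem innerWeight_injOn {n : ℕ} {y : Fin (n + 1) → ℝ} {x x' : Fin n → ℝ} {R R' : ℝ}
    (h : Interlaces y x) (h' : Interlaces y x')
    (hR : R ≠ 0) (he : ∀ i, R * innerWeight y x i = R' * innerWeight y x' i) :
    R = R' ∧ x = x' := by
  have hy := h.strictMono_outer.injective
  have hRR : R = R' := by
    have := Finset.sum_congr (rfl : Finset.univ = Finset.univ) fun i _ => he i
    rwa [← Finset.mul_sum, ← Finset.mul_sum, sum_innerWeight hy, sum_innerWeight hy, mul_one,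
      mul_one] at this
  subst hRR
  refine ⟨rfl, rootPoly_injOn h.strictMono_inner h'.strictMono_inner ?_⟩
  rw [rootPoly_eq_sum_innerWeight hy x, rootPoly_eq_sum_innerWeight hy x']
  exact Finset.sum_congr rfl fun i _ => by rw [mul_left_cancel₀ hR (he i)]

theorem outerWeight_injOn {n : ℕ} {y : Fin (n + 1) → ℝ} {z z' : Fin (n + 2) → ℝ}
    (h : Interlaces z y) (h' : Interlaces z' y) (hT : ∑ k, z k = ∑ k, z' k)
    (he : ∀ i, outerWeight y z i = outerWeight y z' i) : z = z' := by
  have hy := h.strictMono_inner.injective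
  refine rootPoly_injOn h.strictMono_outer h'.strictMono_outer ?_
  rw [rootPoly_eq_outerWeight hy z, rootPoly_eq_outerWeight hy z', hT]
  simp only [he]

/-- The continuous linear form `v ↦ ∑ k, c k * v k`. -/
def rowForm {m : ℕ} (c : Fin m → ℝ) : (Fin m → ℝ) →L[ℝ] ℝ :=
  ∑ k, c k • ContinuousLinearMap.proj (R := ℝ) (φ := fun _ : Fin m => ℝ) k

theorem rowForm_apply {m : ℕ} (c v : Fin m → ℝ) : rowForm c v = ∑ k, c k * v k := by
  simp [rowForm]

theorem lintegral_image_eq_lintegral_abs_det_matrix_mul {m : ℕ} {S : Set (Fin m → ℝ)}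
    (hS : MeasurableSet S) {f : (Fin m → ℝ) → Fin m → ℝ}
    {M : (Fin m → ℝ) → Matrix (Fin m) (Fin m) ℝ}
    (hf' : ∀ X ∈ S, ∀ i, HasFDerivAt (fun X => f X i) (rowForm (M X i)) X)
    (hf : Set.InjOn f S) (g : (Fin m → ℝ) → ENNReal) :
    ∫⁻ r in f '' S, g r = ∫⁻ X in S, ENNReal.ofReal |(M X).det| * g (f X) := by
  have h : ∀ X ∈ S, HasFDerivWithinAt f
      (LinearMap.toContinuousLinearMap (Matrix.toLin' (M X))) S X := by
    intro X hX
    refine HasFDerivAt.hasFDerivWithinAt (hasFDerivAt_pi'' fun i => ?_)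
    refine (hf' X hX i).congr_fderiv ?_
    ext v
    simp [rowForm_apply, Matrix.mulVec, dotProduct]
  rw [lintegral_image_eq_lintegral_abs_det_fderiv_mul volume hS h hf]
  simp [ContinuousLinearMap.det]

theorem hasFDerivAt_mul_prod_apply {m : ℕ} (c : ℝ) {g : Fin m → ℝ → ℝ} {g' : Fin m → ℝ}
    {X : Fin m → ℝ} (hg : ∀ k, HasDerivAt (g k) (g' k) (X k)) (h0 : ∀ k, g k (X k) ≠ 0) :
    HasFDerivAt (fun X : Fin m → ℝ => c * ∏ k, g k (X k))
      (rowForm fun k => (c * ∏ k, g k (X k)) * (g' k / g k (X k))) X := by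
  have h1 : ∀ k, HasFDerivAt (fun X : Fin m → ℝ => g k (X k))
      (g' k • ContinuousLinearMap.proj (R := ℝ) (φ := fun _ : Fin m => ℝ) k) X := fun k =>
    (hg k).comp_hasFDerivAt X (hasFDerivAt_apply (𝕜 := ℝ) (F' := fun _ : Fin m => ℝ) k X)
  have h2 := (HasFDerivAt.finsetProd (u := Finset.univ) fun k _ => h1 k).const_mul c
  refine h2.congr_fderiv ?_
  ext v
  simp only [rowForm_apply, smul_apply, sum_apply,
    smul_eq_mul, Finset.mul_sum, ContinuousLinearMap.proj_apply]
  refine Finset.sum_congr rfl fun k _ => ?_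
  rw [← Finset.mul_prod_erase Finset.univ _ (Finset.mem_univ k)]
  field_simp [h0 k]

theorem prod_abs_nodeDen {n : ℕ} (y : Fin (n + 1) → ℝ) : ∏ i, |nodeDen y i| = absVand y ^ 2 := by
  rw [← prod_erase_sub_eq]
  refine Finset.prod_congr rfl fun i _ => ?_
  rw [nodeDen, Finset.abs_prod]
  have h : Finset.univ.erase i = Finset.univ.map (Fin.succAboveEmb i) := by
    ext j
    simp [Fin.exists_succAbove_eq_iff]
  rw [h, Finset.prod_map]
  rfl

theorem absVand_pos {n : ℕ} {y : Fin n → ℝ} (hy : Function.Injective y) : 0 < absVand y :=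
  abs_pos.2 (Matrix.det_vandermonde_ne_zero_iff.2 hy)

/-- The absolute value of the resultant of two families of roots. -/
def absRes {n m : ℕ} (y : Fin n → ℝ) (x : Fin m → ℝ) : ℝ := ∏ i, ∏ j, |y i - x j|

theorem Interlaces.absRes_pos {n : ℕ} {y : Fin (n + 1) → ℝ} {x : Fin n → ℝ}
    (h : Interlaces y x) : 0 < absRes y x :=
  Finset.prod_pos fun i _ => Finset.prod_pos fun j _ => abs_pos.2 (sub_ne_zero.2 (h.ne i j))

theorem absRes_comm {n m : ℕ} (y : Fin n → ℝ) (x : Fin m → ℝ) : absRes y x = absRes x y := by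
  rw [absRes, absRes, Finset.prod_comm]
  simp only [abs_sub_comm]

theorem prod_innerWeight {n : ℕ} {y : Fin (n + 1) → ℝ} {x : Fin n → ℝ} (h : Interlaces y x) :
    ∏ i, innerWeight y x i = absRes y x / absVand y ^ 2 := by
  rw [← prod_abs_nodeDen, absRes, ← Finset.prod_div_distrib]
  refine Finset.prod_congr rfl fun i _ => ?_
  rw [← abs_of_pos (innerWeight_pos h i), innerWeight, abs_div, Finset.abs_prod]

theorem prod_outerWeight {n : ℕ} {y : Fin (n + 1) → ℝ} {z : Fin (n + 2) → ℝ}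
    (h : Interlaces z y) : ∏ i, outerWeight y z i = absRes z y / absVand y ^ 2 := by
  rw [← prod_abs_nodeDen, absRes_comm, absRes, ← Finset.prod_div_distrib]
  refine Finset.prod_congr rfl fun i _ => ?_
  rw [← abs_of_pos (outerWeight_pos h i), outerWeight, abs_div, abs_neg, Finset.abs_prod]

theorem isOpen_interlaces {n : ℕ} :
    IsOpen {p : (Fin (n + 1) → ℝ) × (Fin n → ℝ) | Interlaces p.1 p.2} := by
  rw [show {p : (Fin (n + 1) → ℝ) × (Fin n → ℝ) | Interlaces p.1 p.2} =
    ⋂ i : Fin n, {p | p.1 i.castSucc < p.2 i} ∩ {p | p.2 i < p.1 i.succ} by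
      ext p; simp [Interlaces]]
  refine isOpen_iInter_of_finite fun i => ?_
  exact (isOpen_lt (by fun_prop) (by fun_prop)).inter (isOpen_lt (by fun_prop) (by fun_prop))

theorem lintegral_interlaces_inner {n : ℕ} {y : Fin (n + 1) → ℝ} (hy : StrictMono y)
    (K : (Fin (n + 1) → ℝ) → ENNReal) :
    ∫⁻ r in {r : Fin (n + 1) → ℝ | ∀ i, 0 < r i}, K r =
      ∫⁻ X in {X : Fin (n + 1) → ℝ | 0 < X 0 ∧ Interlaces y (Fin.tail X)},
        ENNReal.ofReal (X 0 ^ n * absVand (Fin.tail X) / absVand y) *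
          K (fun i => X 0 * innerWeight y (Fin.tail X) i) := by
  set S := {X : Fin (n + 1) → ℝ | 0 < X 0 ∧ Interlaces y (Fin.tail X)} with hSdef
  set f : (Fin (n + 1) → ℝ) → Fin (n + 1) → ℝ := fun X i => X 0 * innerWeight y (Fin.tail X) i
    with hf
  have hS : MeasurableSet S := by
    refine IsOpen.measurableSet (IsOpen.inter (s := {X : Fin (n + 1) → ℝ | 0 < X 0})
      (isOpen_lt (by fun_prop) (by fun_prop)) ?_)
    exact isOpen_interlaces.preimage (f := fun X : Fin (n + 1) → ℝ => (y, Fin.tail X))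
      (continuous_const.prodMk (continuous_pi fun i => continuous_apply _))
  have himage : f '' S = {r | ∀ i, 0 < r i} := by
    ext r
    constructor
    · rintro ⟨X, hX, rfl⟩ i
      exact mul_pos hX.1 (innerWeight_pos hX.2 i)
    · intro hr
      obtain ⟨x, hx, h⟩ := exists_innerWeight_eq hy hr
      refine ⟨Fin.cons (∑ k, r k) x, ⟨?_, ?_⟩, ?_⟩
      · simpa using Finset.sum_pos (fun i _ => hr i) Finset.univ_nonempty
      · simpa using hx
      · ext i; simpa [hf] using h i
  have hinj : Set.InjOn f S := by
    intro X hX X' hX' h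
    obtain ⟨h1, h2⟩ := innerWeight_injOn hX.2 hX'.2 hX.1.ne' (fun i => congrFun h i)
    rw [← Fin.cons_self_tail X, ← Fin.cons_self_tail X', h1, h2]
  let M : (Fin (n + 1) → ℝ) → Matrix (Fin (n + 1)) (Fin (n + 1)) ℝ := fun X =>
    Matrix.diagonal (f X) * borderedCauchy y (Fin.tail X) *
      Matrix.diagonal (Fin.cons (X 0)⁻¹ fun _ => -1)
  have hderiv : ∀ X ∈ S, ∀ i, HasFDerivAt (fun X => f X i) (rowForm (M X i)) X := by
    intro X hX i
    have h := hasFDerivAt_mul_prod_apply (nodeDen y i)⁻¹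
      (g := Fin.cons (fun t => t) fun _ t => y i - t) (g' := Fin.cons 1 fun _ => -1) (X := X)
      (Fin.cases (by simpa using hasDerivAt_id' _)
        fun j => by simpa using (hasDerivAt_id (X j.succ)).const_sub (y i))
      (Fin.cases (by simpa using hX.1.ne')
        fun j => by simpa [Fin.tail] using sub_ne_zero.2 (hX.2.ne i j))
    have h1 : ∀ X : Fin (n + 1) → ℝ, (nodeDen y i)⁻¹ *
        ∏ k, (Fin.cons (fun t => t) fun _ t => y i - t : Fin (n + 1) → ℝ → ℝ) k (X k) = f X i := by
      intro X
      simp [Fin.prod_univ_succ, hf, innerWeight, Fin.tail]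
      ring
    simp only [h1] at h
    refine h.congr_fderiv (congrArg rowForm ?_)
    ext k
    induction k using Fin.cases with
    | zero => simp [M, Matrix.mul_diagonal, Matrix.diagonal_mul, borderedCauchy]
    | succ j =>
      simp [M, Matrix.mul_diagonal, Matrix.diagonal_mul, borderedCauchy, Fin.tail, div_eq_mul_inv]
  rw [← himage, lintegral_image_eq_lintegral_abs_det_matrix_mul hS hderiv hinj]
  refine setLIntegral_congr_fun hS fun X hX => ?_
  congr 2
  have hB := abs_det_borderedCauchy y (Fin.tail X) hX.2.strictMono_inner.injective hX.2.ne
  have hP := prod_innerWeight hX.2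
  have hV := absVand_pos hy.injective
  have hW := hX.2.absRes_pos
  change |(borderedCauchy y (Fin.tail X)).det| * absRes y (Fin.tail X) = _ at hB
  rw [← eq_div_iff hW.ne'] at hB
  have hR := hX.1
  simp only [M, Matrix.det_mul, Matrix.det_diagonal, abs_mul, hB, hf, Finset.prod_mul_distrib, hP,
    Fin.prod_univ_succ (n := n) (f := Fin.cons (X 0)⁻¹ fun _ => -1)]
  simp [abs_of_pos hR, abs_div, abs_of_pos hW]
  field_simp
  ring

theorem lintegral_interlaces_outer {n : ℕ} {y : Fin (n + 1) → ℝ} (hy : StrictMono y)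
    {c : Fin (n + 1) → ℝ} (hc : ∀ i, 0 < c i) (K : (Fin (n + 2) → ℝ) → ENNReal) :
    ∫⁻ Q in {Q : Fin (n + 2) → ℝ | ∀ i : Fin (n + 1), 0 < Q i.succ}, K Q =
      ∫⁻ z in {z : Fin (n + 2) → ℝ | Interlaces z y},
        ENNReal.ofReal ((∏ i, c i) * absVand z / absVand y) *
          K (Fin.cons (∑ k, z k - ∑ i, y i) fun i => c i * outerWeight y z i) := by
  set S := {z : Fin (n + 2) → ℝ | Interlaces z y} with hSdef
  set f : (Fin (n + 2) → ℝ) → Fin (n + 2) → ℝ := fun z =>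
    Fin.cons (∑ k, z k - ∑ i, y i) fun i => c i * outerWeight y z i with hf
  have hS : MeasurableSet S := by
    refine IsOpen.measurableSet ?_
    exact isOpen_interlaces.preimage (f := fun z : Fin (n + 2) → ℝ => (z, y)) (by fun_prop)
  have himage : f '' S = {Q | ∀ i : Fin (n + 1), 0 < Q i.succ} := by
    ext Q
    constructor
    · rintro ⟨z, hz, rfl⟩ i
      simpa [hf] using mul_pos (hc i) (outerWeight_pos hz i)
    · intro hQ
      obtain ⟨z, hz, h1, h2⟩ := exists_outerWeight_eq hy (s := fun i => Q i.succ / c i)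
        (fun i => div_pos (hQ i) (hc i)) (Q 0)
      refine ⟨z, hz, ?_⟩
      ext k
      induction k using Fin.cases with
      | zero => simpa [hf] using h1
      | succ i => simp [hf, h2, mul_div_cancel₀ _ (hc i).ne']
  have hinj : Set.InjOn f S := by
    intro z hz z' hz' h
    refine outerWeight_injOn hz hz' ?_ fun i => ?_
    · simpa [hf] using congrFun h 0
    · simpa [hf, (hc i).ne'] using congrFun h i.succ
  let M : (Fin (n + 2) → ℝ) → Matrix (Fin (n + 2)) (Fin (n + 2)) ℝ := fun z =>
    Matrix.diagonal (Fin.cons 1 fun i => c i * outerWeight y z i) * (borderedCauchy z y).transpose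
  have hderiv : ∀ z ∈ S, ∀ i, HasFDerivAt (fun z => f z i) (rowForm (M z i)) z := by
    intro z hz i
    induction i using Fin.cases with
    | zero =>
      have h : ∀ z, f z 0 = rowForm (fun _ => 1) z - ∑ i, y i := fun z => by
        simp [hf, rowForm_apply]
      simp only [h]
      refine ((rowForm fun _ => 1).hasFDerivAt.sub_const _).congr_fderiv (congrArg rowForm ?_)
      ext k
      simp [M, Matrix.diagonal_mul, borderedCauchy]
    | succ i =>
      have h := hasFDerivAt_mul_prod_apply (-(c i) / (nodeDen y i))
        (g := fun _ t => y i - t) (g' := fun _ => -1) (X := z)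
        (fun k => by simpa using (hasDerivAt_id (z k)).const_sub (y i))
        (fun k => sub_ne_zero.2 (hz.ne k i).symm)
      have h1 : ∀ z : Fin (n + 2) → ℝ, -(c i) / (nodeDen y i) *
          ∏ k, (y i - z k) = f z i.succ := by
        intro z
        simp [hf, outerWeight]
        ring
      simp only [h1] at h
      refine h.congr_fderiv (congrArg rowForm ?_)
      ext k
      simp [M, Matrix.diagonal_mul, borderedCauchy, hf, div_eq_mul_inv]
      rw [← neg_sub (z k), inv_neg, mul_neg, neg_neg]
  rw [← himage, lintegral_image_eq_lintegral_abs_det_matrix_mul hS hderiv hinj]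
  refine setLIntegral_congr_fun hS fun z hz => ?_
  congr 2
  have hB := abs_det_borderedCauchy z y hy.injective hz.ne
  have hP := prod_outerWeight hz
  have hV := absVand_pos hy.injective
  have hW := hz.absRes_pos
  change |(borderedCauchy z y).det| * absRes z y = _ at hB
  rw [← eq_div_iff hW.ne'] at hB
  have hC : 0 < ∏ i, c i := Finset.prod_pos fun i _ => hc i
  simp only [M, Matrix.det_mul, Matrix.det_diagonal, abs_mul, hB, Matrix.det_transpose,
    Fin.prod_univ_succ (n := n + 1), Fin.cons_zero, Fin.cons_succ, Finset.prod_mul_distrib, hP]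
  simp [abs_of_pos hC, abs_div, abs_of_pos hW]
  field_simp

theorem prod_sub_eq_sum_innerWeight {n : ℕ} {A : Type*} [Field A] [Algebra ℝ A]
    {y : Fin (n + 1) → ℝ} (hy : Function.Injective y) (x : Fin n → ℝ) {u : A}
    (hu : ∀ i, u ≠ algebraMap ℝ A (y i)) :
    ∏ j, (u - algebraMap ℝ A (x j)) = (∏ i, (u - algebraMap ℝ A (y i))) *
      ∑ i, algebraMap ℝ A (innerWeight y x i) / (u - algebraMap ℝ A (y i)) := by
  have h := congrArg (Polynomial.aeval u) (rootPoly_eq_sum_innerWeight hy x)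
  simp only [rootPoly, map_prod, map_sum, map_sub, map_mul, Polynomial.aeval_X,
    Polynomial.aeval_C] at h
  rw [h, Finset.mul_sum]
  refine Finset.sum_congr rfl fun i _ => ?_
  rw [Fin.prod_univ_succAbove _ i]
  have := sub_ne_zero.2 (hu i)
  field_simp

theorem prod_sub_eq_sum_outerWeight {n : ℕ} {A : Type*} [Field A] [Algebra ℝ A]
    {y : Fin (n + 1) → ℝ} (hy : Function.Injective y) (z : Fin (n + 2) → ℝ) {u : A}
    (hu : ∀ i, u ≠ algebraMap ℝ A (y i)) :
    ∏ k, (u - algebraMap ℝ A (z k)) = (∏ i, (u - algebraMap ℝ A (y i))) *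
      (u - algebraMap ℝ A (∑ k, z k - ∑ i, y i) -
        ∑ i, algebraMap ℝ A (outerWeight y z i) / (u - algebraMap ℝ A (y i))) := by
  have h := congrArg (Polynomial.aeval u) (rootPoly_eq_outerWeight hy z)
  simp only [rootPoly, map_prod, map_sum, map_sub, map_mul, Polynomial.aeval_X,
    Polynomial.aeval_C] at h
  rw [h, mul_sub, Finset.mul_sum]
  congr 1
  · simp only [map_sub, map_sum]; ring
  refine Finset.sum_congr rfl fun i _ => ?_
  rw [Fin.prod_univ_succAbove _ i]
  have := sub_ne_zero.2 (hu i)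
  field_simp

/-- The compatibility between three consecutive levels: `r i = R * innerWeight y x i` are the
spectral masses, and `τ` is the translation parameter. -/
structure LevelStep {n : ℕ} (z : Fin (n + 2) → ℝ) (y : Fin (n + 1) → ℝ) (x : Fin n → ℝ)
    (R τ : ℝ) : Prop where
  outer : Interlaces z y
  inner : Interlaces y x
  pos : 0 < R
  sum_eq : ∑ k, z k - ∑ i, y i = -τ + R * (∑ i, y i - ∑ j, x j)
  weight_eq : ∀ i, outerWeight y z i = (1 + y i ^ 2) * (R * innerWeight y x i)

theorem prod_one_add_sq_eq_normSq {n : ℕ} (y : Fin n → ℝ) :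
    ∏ i, (1 + y i ^ 2) = Complex.normSq (∏ i, (Complex.I - y i)) := by
  rw [map_prod]
  refine Finset.prod_congr rfl fun i _ => ?_
  simp [Complex.normSq_apply]; ring

theorem LevelStep.prod_one_add_sq {n : ℕ} {z : Fin (n + 2) → ℝ} {y : Fin (n + 1) → ℝ}
    {x : Fin n → ℝ} {R τ : ℝ} (h : LevelStep z y x R τ) :
    ∏ k, (1 + z k ^ 2) = (∏ i, (1 + y i ^ 2)) * ((1 + R) ^ 2 + τ ^ 2) := by
  have hinj := h.inner.strictMono_outer.injective
  have hne : ∀ t : ℝ, Complex.I ≠ (t : ℂ) := fun t ht => by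
    simpa using congrArg Complex.im ht
  have h1 := prod_sub_eq_sum_outerWeight (A := ℂ) hinj z (fun i => hne (y i))
  simp only [Complex.coe_algebraMap] at h1
  rw [prod_one_add_sq_eq_normSq, prod_one_add_sq_eq_normSq, h1, map_mul]
  congr 1
  have h2 : ∀ i, ((outerWeight y z i : ℝ) : ℂ) / (Complex.I - y i) =
      -((R * (innerWeight y x i * y i) : ℝ) : ℂ) - ((R * innerWeight y x i : ℝ) : ℂ) *
        Complex.I := by
    intro i
    rw [div_eq_iff (sub_ne_zero.2 (hne _)), h.weight_eq]
    push_cast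
    linear_combination (R * innerWeight y x i : ℂ) * Complex.I_sq
  rw [Finset.sum_congr rfl fun i _ => h2 i, Finset.sum_sub_distrib, Finset.sum_neg_distrib,
    ← Finset.sum_mul, ← Complex.ofReal_sum, ← Complex.ofReal_sum, ← Finset.mul_sum,
    ← Finset.mul_sum, sum_innerWeight hinj, sum_innerWeight_mul hinj, h.sum_eq]
  simp [Complex.normSq_apply]
  ring

theorem LevelStep.eval_div {n : ℕ} {z : Fin (n + 2) → ℝ} {y : Fin (n + 1) → ℝ}
    {x : Fin n → ℝ} {R τ : ℝ} (h : LevelStep z y x R τ) {u : ℝ} (hu : ∀ i, u ≠ y i) :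
    (∏ k, (u - z k)) / ∏ i, (u - y i) =
      u + τ + R * (u - (1 + u ^ 2) * ((∏ j, (u - x j)) / ∏ i, (u - y i))) := by
  have hinj := h.inner.strictMono_outer.injective
  have hY : ∏ i, (u - y i) ≠ 0 := Finset.prod_ne_zero_iff.2 fun i _ => sub_ne_zero.2 (hu i)
  have h1 := prod_sub_eq_sum_outerWeight (A := ℝ) hinj z hu
  have h2 := prod_sub_eq_sum_innerWeight (A := ℝ) hinj x hu
  simp only [Algebra.algebraMap_self, RingHom.id_apply] at h1 h2
  rw [h1, h2, mul_div_cancel_left₀ _ hY, mul_div_cancel_left₀ _ hY]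
  have h3 : ∀ i, outerWeight y z i / (u - y i) = -R * u * innerWeight y x i -
      R * (innerWeight y x i * y i) + R * (1 + u ^ 2) * (innerWeight y x i / (u - y i)) := by
    intro i
    have := sub_ne_zero.2 (hu i)
    rw [h.weight_eq]
    field_simp
    ring
  rw [Finset.sum_congr rfl fun i _ => h3 i, Finset.sum_add_distrib, Finset.sum_sub_distrib,
    ← Finset.mul_sum, ← Finset.mul_sum, ← Finset.mul_sum,
    sum_innerWeight hinj, sum_innerWeight_mul hinj, h.sum_eq]
  ring

theorem lintegral_fin_cons {n : ℕ} {K : (Fin (n + 1) → ℝ) → ENNReal} (hK : Measurable K) :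
    ∫⁻ Q, K Q = ∫⁻ r : Fin n → ℝ, ∫⁻ T : ℝ, K (Fin.cons T r) := by
  have h := (volume_preserving_piFinSuccAbove (fun _ : Fin (n + 1) => ℝ) 0).symm
  rw [← h.lintegral_comp_emb (MeasurableEquiv.measurableEmbedding _)]
  rw [Measure.volume_eq_prod, lintegral_prod_symm']
  · simp [MeasurableEquiv.piFinSuccAbove, Fin.insertNthEquiv]
  · exact hK.comp (MeasurableEquiv.measurable _)

/-- The joint density of two consecutive levels. -/
def pairDensity (a : ℝ) {n : ℕ} (y : Fin (n + 1) → ℝ) (x : Fin n → ℝ) : ℝ :=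
  absVand y * absVand x * absRes y x ^ (a - 1) * (∏ i, (1 + y i ^ 2)) ^ (-(a * n + 1))

/-- The density of the step variables `(R, τ)`. -/
def stepDensity (b R τ : ℝ) : ℝ := R ^ (b - 1) * ((1 + R) ^ 2 + τ ^ 2) ^ (-(b + 1))

theorem measurable_absVand {n : ℕ} : Measurable (absVand (n := n)) := by
  have : Continuous fun y : Fin n → ℝ => |(Matrix.vandermonde y).det| := by
    simp only [Matrix.det_vandermonde]
    fun_prop
  exact this.measurable

theorem measurable_absRes {n m : ℕ} :
    Measurable fun p : (Fin n → ℝ) × (Fin m → ℝ) => absRes p.1 p.2 := by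
  unfold absRes
  fun_prop

theorem measurable_pairDensity (a : ℝ) {n : ℕ} :
    Measurable fun p : (Fin (n + 1) → ℝ) × (Fin n → ℝ) => pairDensity a p.1 p.2 := by
  unfold pairDensity
  refine Measurable.mul (Measurable.mul ((measurable_absVand.comp measurable_fst).mul
    (measurable_absVand.comp measurable_snd)) (measurable_absRes.pow_const _)) ?_
  exact Measurable.pow_const (by fun_prop) _

theorem measurable_pairDensity_right (a : ℝ) {n : ℕ} (y : Fin (n + 1) → ℝ) :
    Measurable fun x : Fin n → ℝ => pairDensity a y x :=
  (measurable_pairDensity a).of_uncurry_left (f := fun y x => pairDensity a y x)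

theorem measurable_pairDensity_left (a : ℝ) {n : ℕ} (x : Fin n → ℝ) :
    Measurable fun y : Fin (n + 1) → ℝ => pairDensity a y x :=
  (measurable_pairDensity a).of_uncurry_right (f := fun y x => pairDensity a y x)

theorem measurable_stepDensity (b : ℝ) :
    Measurable fun p : ℝ × ℝ => stepDensity b p.1 p.2 := by
  unfold stepDensity
  exact (Measurable.pow_const (by fun_prop) _).mul (Measurable.pow_const (by fun_prop) _)

theorem measurableSet_interlaces {n : ℕ} :
    MeasurableSet {p : (Fin (n + 1) → ℝ) × (Fin n → ℝ) | Interlaces p.1 p.2} :=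
  isOpen_interlaces.measurableSet

theorem measurableSet_interlaces_right {n : ℕ} (y : Fin (n + 1) → ℝ) :
    MeasurableSet {x : Fin n → ℝ | Interlaces y x} :=
  (isOpen_interlaces.preimage (f := fun x : Fin n → ℝ => (y, x)) (by fun_prop)).measurableSet

theorem measurableSet_interlaces_left {n : ℕ} (x : Fin n → ℝ) :
    MeasurableSet {y : Fin (n + 1) → ℝ | Interlaces y x} :=
  (isOpen_interlaces.preimage (f := fun y : Fin (n + 1) → ℝ => (y, x)) (by fun_prop)).measurableSet

theorem measurableSet_pos_interlaces {n : ℕ} (y : Fin (n + 1) → ℝ) :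
    MeasurableSet {X : Fin (n + 1) → ℝ | 0 < X 0 ∧ Interlaces y (Fin.tail X)} := by
  refine IsOpen.measurableSet (IsOpen.inter (s := {X : Fin (n + 1) → ℝ | 0 < X 0})
      (isOpen_lt (by fun_prop) (by fun_prop)) ?_)
  exact isOpen_interlaces.preimage (f := fun X : Fin (n + 1) → ℝ => (y, Fin.tail X))
      (continuous_const.prodMk (continuous_pi fun i => continuous_apply _))

theorem exists_measurable_comp_eq {m : ℕ} {S : Set (Fin m → ℝ)}
    (hS : MeasurableSet S) {f : (Fin m → ℝ) → Fin m → ℝ}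
    (hd : ∀ X ∈ S, DifferentiableAt ℝ f X)
    (hf : Set.InjOn f S) {k : (Fin m → ℝ) → ENNReal} (hk : Measurable k) :
    ∃ K : (Fin m → ℝ) → ENNReal, Measurable K ∧ ∀ X ∈ S, K (f X) = k X := by
  have hemb := measurableEmbedding_of_fderivWithin (s := S) (f := f) (f' := fderiv ℝ f) hS
    (fun X hX => (hd X hX).hasFDerivAt.hasFDerivWithinAt) hf
  refine ⟨_, hemb.measurable_extend (hk.comp measurable_subtype_coe)
    (measurable_const (a := (0 : ENNReal))), fun X hX => ?_⟩
  exact hemb.injective.extend_apply _ _ ⟨X, hX⟩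

theorem exists_measurable_outer_coordinates {n : ℕ} (y : Fin (n + 1) → ℝ)
    {c : Fin (n + 1) → ℝ} (hc : ∀ i, 0 < c i) {k : (Fin (n + 2) → ℝ) → ENNReal}
    (hk : Measurable k) :
    ∃ K : (Fin (n + 2) → ℝ) → ENNReal, Measurable K ∧ ∀ z, Interlaces z y →
      K (Fin.cons (∑ k, z k - ∑ i, y i) fun i => c i * outerWeight y z i) = k z := by
  refine exists_measurable_comp_eq (S := {z | Interlaces z y})
    (f := fun z => Fin.cons (∑ k, z k - ∑ i, y i) fun i => c i * outerWeight y z i)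
    ?_ ?_ ?_ hk
  · exact measurableSet_interlaces_left y
  · intro z _
    refine differentiableAt_pi.2 fun i => ?_
    induction i using Fin.cases with
    | zero => simp only [Fin.cons_zero]; fun_prop
    | succ i =>
      simp only [Fin.cons_succ, outerWeight, div_eq_mul_inv]
      fun_prop
  · intro z hz z' hz' h
    refine outerWeight_injOn hz hz' ?_ fun i => ?_
    · simpa using congrFun h 0
    · simpa [(hc i).ne'] using congrFun h i.succ

theorem LevelStep.density_eq {a : ℝ} {n : ℕ} {z : Fin (n + 2) → ℝ} {y : Fin (n + 1) → ℝ}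
    {x : Fin n → ℝ} {R τ : ℝ} (h : LevelStep z y x R τ) :
    R ^ n * absVand x / absVand y *
      (pairDensity a z y / ((∏ i, (1 + y i ^ 2)⁻¹) * absVand z / absVand y)) =
    pairDensity a y x * stepDensity (a * (n + 1)) R τ := by
  have hR := h.pos
  have hVy := absVand_pos h.inner.strictMono_outer.injective
  have hVz := absVand_pos h.outer.strictMono_outer.injective
  have hVx := absVand_pos h.inner.strictMono_inner.injective
  have hWx := h.inner.absRes_pos
  have hWz := h.outer.absRes_pos
  have hρ : 0 < (1 + R) ^ 2 + τ ^ 2 := by positivity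
  have hC : 0 < ∏ i, (1 + y i ^ 2) := Finset.prod_pos fun i _ => by positivity
  have hs : absRes z y / absVand y ^ 2 =
      (∏ i, (1 + y i ^ 2)) * (R ^ (n + 1) * (absRes y x / absVand y ^ 2)) := by
    rw [← prod_outerWeight h.outer, Finset.prod_congr rfl fun i _ => h.weight_eq i,
      Finset.prod_mul_distrib, Finset.prod_mul_distrib, prod_innerWeight h.inner]
    simp
  have hs' : absRes z y = (∏ i, (1 + y i ^ 2)) * R ^ (n + 1) * absRes y x := by
    field_simp at hs
    linarith
  have hRa : R ^ n * (R ^ (n + 1)) ^ (a - 1) = R ^ (a * (n + 1) - 1) := by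
    rw [← Real.rpow_natCast, ← Real.rpow_natCast, ← Real.rpow_mul hR.le, ← Real.rpow_add hR]
    congr 1; push_cast; ring
  have hCa : (∏ i, (1 + y i ^ 2)) * ((∏ i, (1 + y i ^ 2)) ^ (a - 1) *
      (∏ i, (1 + y i ^ 2)) ^ (-(a * (n + 1 : ℕ) + 1))) =
      (∏ i, (1 + y i ^ 2)) ^ (-(a * n + 1)) := by
    rw [← Real.rpow_add hC, mul_comm, ← Real.rpow_add_one hC.ne']
    congr 1; push_cast; ring
  have hρa : a * ((n + 1 : ℕ) : ℝ) = a * (n + 1) := by push_cast; ring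
  simp only [pairDensity, stepDensity, Finset.prod_inv_distrib]
  rw [hs', h.prod_one_add_sq, Real.mul_rpow (by positivity) (by positivity),
    Real.mul_rpow (by positivity) (by positivity), Real.mul_rpow (by positivity) (by positivity),
    ← hRa, ← hCa, hρa]
  field_simp

theorem lintegral_comp_step {n : ℕ} {y : Fin (n + 1) → ℝ} (hy : StrictMono y)
    {K : (Fin (n + 2) → ℝ) → ENNReal} (hK : Measurable K) :
    ∫⁻ Q in {Q : Fin (n + 2) → ℝ | ∀ i : Fin (n + 1), 0 < Q i.succ}, K Q =
      ∫⁻ τ : ℝ, ∫⁻ X in {X : Fin (n + 1) → ℝ | 0 < X 0 ∧ Interlaces y (Fin.tail X)},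
        ENNReal.ofReal (X 0 ^ n * absVand (Fin.tail X) / absVand y) *
          K (Fin.cons (-τ + X 0 * (∑ i, y i - ∑ j, Fin.tail X j))
            fun i => X 0 * innerWeight y (Fin.tail X) i) := by
  have hS : MeasurableSet {r : Fin (n + 1) → ℝ | ∀ i, 0 < r i} := by
    simp only [measurableSet_setOfPred]
    exact Measurable.forall fun i =>
      measurableSet_setOfPred.1 (measurableSet_lt (by fun_prop) (by fun_prop))
  have hS' : MeasurableSet {Q : Fin (n + 2) → ℝ | ∀ i : Fin (n + 1), 0 < Q i.succ} := by
    simp only [measurableSet_setOfPred]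
    exact Measurable.forall fun i =>
      measurableSet_setOfPred.1 (measurableSet_lt (by fun_prop) (by fun_prop))
  have hcons : Measurable fun p : (Fin (n + 1) → ℝ) × ℝ =>
      (Fin.cons p.2 p.1 : Fin (n + 2) → ℝ) :=
    measurable_pi_iff.2 (Fin.cases (by simpa using measurable_snd) fun i => by
      simp only [Fin.cons_succ]; fun_prop)
  rw [← lintegral_indicator hS', lintegral_fin_cons (hK.indicator hS')]
  have h1 : ∀ r : Fin (n + 1) → ℝ,
      ∫⁻ T : ℝ, Set.indicator {Q : Fin (n + 2) → ℝ | ∀ i : Fin (n + 1), 0 < Q i.succ} K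
        (Fin.cons T r) =
      Set.indicator {r : Fin (n + 1) → ℝ | ∀ i, 0 < r i}
        (fun r => ∫⁻ τ : ℝ, K (Fin.cons (-τ + ∑ i, r i * y i) r)) r := by
    intro r
    by_cases hr : ∀ i, 0 < r i
    · rw [Set.indicator_of_mem (by exact hr)]
      have h2 := lintegral_sub_left_eq_self (μ := (volume : Measure ℝ))
        (fun T => K (Fin.cons T r)) (∑ i, r i * y i)
      simp only [Set.indicator_apply, Set.mem_ofPred_eq, Fin.cons_succ, hr, implies_true, if_true]
      rw [← h2]
      simp only [sub_eq_neg_add]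
    · rw [Set.indicator_of_notMem (by exact hr)]
      simp [hr]
  simp only [h1]
  rw [lintegral_indicator hS, lintegral_lintegral_swap]
  · refine lintegral_congr fun τ => ?_
    rw [lintegral_interlaces_inner hy]
    refine setLIntegral_congr_fun ?_ fun X hX => ?_
    · exact measurableSet_pos_interlaces y
    · simp only [mul_assoc, ← Finset.mul_sum]
      rw [sum_innerWeight_mul hy.injective]
  · have : Measurable fun p : (Fin (n + 1) → ℝ) × ℝ =>
        (Fin.cons (-p.2 + ∑ i, p.1 i * y i) p.1 : Fin (n + 2) → ℝ) :=
      hcons.comp (measurable_fst.prodMk (by fun_prop))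
    exact (hK.comp this).aemeasurable

theorem setLIntegral_cons_interlaces {n : ℕ} (y : Fin (n + 1) → ℝ)
    {G : (Fin n → ℝ) → ℝ → ENNReal} (hG : Measurable fun p : (Fin n → ℝ) × ℝ => G p.1 p.2) :
    ∫⁻ X in {X : Fin (n + 1) → ℝ | 0 < X 0 ∧ Interlaces y (Fin.tail X)}, G (Fin.tail X) (X 0) =
      ∫⁻ x in {x : Fin n → ℝ | Interlaces y x}, ∫⁻ R in Set.Ioi (0 : ℝ), G x R := by
  have hS : MeasurableSet {X : Fin (n + 1) → ℝ | 0 < X 0 ∧ Interlaces y (Fin.tail X)} :=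
    measurableSet_pos_interlaces y
  have hS' : MeasurableSet {x : Fin n → ℝ | Interlaces y x} :=
    measurableSet_interlaces_right y
  have hm : Measurable fun X : Fin (n + 1) → ℝ => G (Fin.tail X) (X 0) :=
    hG.comp (Measurable.prodMk (measurable_pi_iff.2 fun i => measurable_pi_apply _)
      (measurable_pi_apply 0))
  rw [← lintegral_indicator hS, lintegral_fin_cons (hm.indicator hS), ← lintegral_indicator hS']
  refine lintegral_congr fun x => ?_
  by_cases hx : Interlaces y x
  · rw [Set.indicator_of_mem (by exact hx), ← lintegral_indicator measurableSet_Ioi]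
    refine lintegral_congr fun R => ?_
    by_cases hR : 0 < R
    · rw [Set.indicator_of_mem (by exact ⟨hR, hx⟩), Set.indicator_of_mem (by exact hR)]
      simp
    · rw [Set.indicator_of_notMem (by exact fun h => hR h.1),
        Set.indicator_of_notMem (by exact hR)]
  · rw [Set.indicator_of_notMem (by exact hx)]
    simp [hx]

theorem lintegral_setLIntegral_cons_interlaces {n : ℕ} (y : Fin (n + 1) → ℝ)
    {H : (Fin n → ℝ) × ℝ × ℝ → ENNReal} (hH : Measurable H) :
    ∫⁻ τ : ℝ, ∫⁻ X in {X : Fin (n + 1) → ℝ | 0 < X 0 ∧ Interlaces y (Fin.tail X)},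
        H (Fin.tail X, X 0, τ) =
      ∫⁻ x in {x : Fin n → ℝ | Interlaces y x}, ∫⁻ R in Set.Ioi (0 : ℝ), ∫⁻ τ : ℝ,
        H (x, R, τ) := by
  rw [lintegral_lintegral_swap]
  · exact setLIntegral_cons_interlaces y (G := fun x R => ∫⁻ τ : ℝ, H (x, R, τ))
      (Measurable.lintegral_prod_right' (hH.comp MeasurableEquiv.prodAssoc.measurable))
  · exact (hH.comp (f := fun q : ℝ × (Fin (n + 1) → ℝ) => (Fin.tail q.2, q.2 0, q.1))
      ((measurable_pi_iff.2 fun i => (measurable_pi_apply _).comp measurable_snd).prodMk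
        (((measurable_pi_apply 0).comp measurable_snd).prodMk measurable_fst))).aemeasurable

theorem lintegral_levelStep (a : ℝ) {n : ℕ} {y : Fin (n + 1) → ℝ} (hy : StrictMono y)
    {F : (Fin (n + 2) → ℝ) → ENNReal} (hF : Measurable F)
    {G : (Fin n → ℝ) → ℝ → ℝ → ENNReal}
    (hG : Measurable fun p : (Fin n → ℝ) × ℝ × ℝ => G p.1 p.2.1 p.2.2)
    (hFG : ∀ z x R τ, LevelStep z y x R τ → F z = G x R τ) :
    ∫⁻ z in {z | Interlaces z y}, ENNReal.ofReal (pairDensity a z y) * F z =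
      ∫⁻ x in {x | Interlaces y x}, ENNReal.ofReal (pairDensity a y x) *
        ∫⁻ R in Set.Ioi (0 : ℝ), ∫⁻ τ : ℝ,
          ENNReal.ofReal (stepDensity (a * (n + 1)) R τ) * G x R τ := by
  have hc : ∀ i, 0 < (1 + y i ^ 2)⁻¹ := fun i => by positivity
  have hVy := absVand_pos hy.injective
  have hSz : MeasurableSet {z : Fin (n + 2) → ℝ | Interlaces z y} :=
    measurableSet_interlaces_left y
  have hSx : MeasurableSet {x : Fin n → ℝ | Interlaces y x} :=
    measurableSet_interlaces_right y
  have hSX : MeasurableSet {X : Fin (n + 1) → ℝ | 0 < X 0 ∧ Interlaces y (Fin.tail X)} :=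
    measurableSet_pos_interlaces y
  set k : (Fin (n + 2) → ℝ) → ENNReal := fun z => ENNReal.ofReal
    (pairDensity a z y / ((∏ i, (1 + y i ^ 2)⁻¹) * absVand z / absVand y)) * F z with hk
  have hkm : Measurable k := by
    refine Measurable.mul (Measurable.ennreal_ofReal ?_) hF
    refine (measurable_pairDensity_left a (n := n + 1) y).div ?_
    exact (measurable_absVand.const_mul _).div_const _
  obtain ⟨K, hKm, hK⟩ := exists_measurable_outer_coordinates y hc hkm
  have h1 : ∫⁻ z in {z | Interlaces z y}, ENNReal.ofReal (pairDensity a z y) * F z =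
      ∫⁻ z in {z | Interlaces z y},
        ENNReal.ofReal ((∏ i, (1 + y i ^ 2)⁻¹) * absVand z / absVand y) *
          K (Fin.cons (∑ k, z k - ∑ i, y i) fun i => (1 + y i ^ 2)⁻¹ * outerWeight y z i) := by
    refine setLIntegral_congr_fun hSz fun z hz => ?_
    have hVz := absVand_pos (Interlaces.strictMono_outer hz).injective
    have hC : 0 < ∏ i, (1 + y i ^ 2)⁻¹ := Finset.prod_pos fun i _ => hc i
    rw [hK z hz, hk, ← mul_assoc, ← ENNReal.ofReal_mul (by positivity), mul_div_cancel₀]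
    positivity
  have h2 : ∀ X ∈ {X : Fin (n + 1) → ℝ | 0 < X 0 ∧ Interlaces y (Fin.tail X)}, ∀ τ : ℝ,
      ENNReal.ofReal (X 0 ^ n * absVand (Fin.tail X) / absVand y) *
          K (Fin.cons (-τ + X 0 * (∑ i, y i - ∑ j, Fin.tail X j))
            fun i => X 0 * innerWeight y (Fin.tail X) i) =
      ENNReal.ofReal (pairDensity a y (Fin.tail X)) *
        (ENNReal.ofReal (stepDensity (a * (n + 1)) (X 0) τ) * G (Fin.tail X) (X 0) τ) := by
    intro X hX τ
    obtain ⟨z, hz, hz1, hz2⟩ := exists_outerWeight_eq hy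
      (s := fun i => (1 + y i ^ 2) * (X 0 * innerWeight y (Fin.tail X) i))
      (fun i => mul_pos (by positivity) (mul_pos hX.1 (innerWeight_pos hX.2 i)))
      (-τ + X 0 * (∑ i, y i - ∑ j, Fin.tail X j))
    have hst : LevelStep z y (Fin.tail X) (X 0) τ := ⟨hz, hX.2, hX.1, hz1, hz2⟩
    have hVx := absVand_pos hX.2.strictMono_inner.injective
    have hX0 := hX.1
    have h3 := hK z hz
    rw [hz1] at h3
    simp only [hz2, inv_mul_cancel_left₀ (show (1 + y _ ^ 2) ≠ 0 by positivity)] at h3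
    have hp : 0 ≤ pairDensity a y (Fin.tail X) := by
      have := hX.2.absRes_pos
      unfold pairDensity; positivity
    simp only [h3, hk, hFG _ _ _ _ hst]
    rw [← mul_assoc, ← mul_assoc, ← ENNReal.ofReal_mul (by positivity),
      ← ENNReal.ofReal_mul hp, hst.density_eq]
  have hm : Measurable fun p : (Fin n → ℝ) × ℝ × ℝ =>
      ENNReal.ofReal (pairDensity a y p.1) *
        (ENNReal.ofReal (stepDensity (a * (n + 1)) p.2.1 p.2.2) * G p.1 p.2.1 p.2.2) := by
    refine Measurable.mul (Measurable.ennreal_ofReal ?_) (Measurable.mul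
      (Measurable.ennreal_ofReal ?_) hG)
    · exact (measurable_pairDensity_right a y).comp measurable_fst
    · exact (measurable_stepDensity _).comp measurable_snd
  rw [h1, ← lintegral_interlaces_outer hy hc, lintegral_comp_step hy hKm]
  rw [lintegral_congr fun τ => setLIntegral_congr_fun hSX fun X hX => h2 X hX τ]
  rw [lintegral_setLIntegral_cons_interlaces y hm]
  refine setLIntegral_congr_fun hSx fun x _ => ?_
  dsimp only
  rw [← lintegral_const_mul' _ _ ENNReal.ofReal_ne_top]
  refine lintegral_congr fun R => ?_
  rw [← lintegral_const_mul' _ _ ENNReal.ofReal_ne_top]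

/-- The angle in `(0, 2π)` with half-angle cotangent `v`. -/
def phase (v : ℝ) : ℝ := Real.pi - 2 * Real.arctan v

theorem phase_pos (v : ℝ) : 0 < phase v := by
  have := Real.arctan_lt_pi_div_two v
  unfold phase; linarith

theorem phase_lt (v : ℝ) : phase v < 2 * Real.pi := by
  have := Real.neg_pi_div_two_lt_arctan v
  unfold phase; linarith

theorem phase_strictAnti : StrictAnti phase := fun u v h => by
  have := Real.arctan_strictMono h
  unfold phase; linarith

theorem measurable_phase : Measurable phase := by
  unfold phase; fun_prop

theorem ofReal_sub_I_ne_zero (v : ℝ) : (v : ℂ) - Complex.I ≠ 0 := fun h => by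
  simpa using congrArg Complex.im h

theorem sub_I_eq (v : ℝ) : (v : ℂ) - Complex.I =
    (Real.sqrt (1 + v ^ 2) : ℂ) * Complex.exp ((-(phase v / 2) : ℝ) * Complex.I) := by
  have h1 : 0 < Real.sqrt (1 + v ^ 2) := Real.sqrt_pos.2 (by positivity)
  have h2 : -(phase v / 2) = Real.arctan v - Real.pi / 2 := by unfold phase; ring
  rw [Complex.exp_mul_I, ← Complex.ofReal_cos, ← Complex.ofReal_sin, h2, Real.cos_sub_pi_div_two,
    Real.sin_sub_pi_div_two, Real.sin_arctan, Real.cos_arctan]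
  have : (Real.sqrt (1 + v ^ 2) : ℂ) ≠ 0 := by exact_mod_cast h1.ne'
  push_cast
  field_simp
  ring

theorem arg_sub_I (v : ℝ) : Complex.arg ((v : ℂ) - Complex.I) = -(phase v / 2) := by
  have h1 : 0 < Real.sqrt (1 + v ^ 2) := Real.sqrt_pos.2 (by positivity)
  have := phase_pos v
  have := phase_lt v
  have := Real.pi_pos
  rw [sub_I_eq, Complex.arg_real_mul _ h1, Complex.arg_exp_mul_I, toIocMod_eq_self]
  constructor <;> linarith

theorem exp_phase (v : ℝ) : Complex.exp (phase v * Complex.I) =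
    ((v : ℂ) + Complex.I) / ((v : ℂ) - Complex.I) := by
  have h := sub_I_eq v
  have h' := congrArg (starRingEnd ℂ) h
  simp only [map_sub, map_mul, Complex.conj_ofReal, Complex.conj_I, ← Complex.exp_conj,
    sub_neg_eq_add] at h'
  have h1 : (Real.sqrt (1 + v ^ 2) : ℂ) ≠ 0 := by
    exact_mod_cast (Real.sqrt_pos.2 (by positivity)).ne'
  rw [h, h', mul_div_mul_left _ _ h1, ← Complex.exp_sub]
  congr 1
  push_cast
  ring

theorem phase_add_phase {u w : ℝ} (h : u + w ≠ 0) :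
    phase u + phase w = phase ((u * w - 1) / (u + w)) + if u + w < 0 then 2 * Real.pi else 0 := by
  set v := (u * w - 1) / (u + w) with hv
  have hc : (u : ℂ) + w ≠ 0 := by exact_mod_cast h
  have hexp : Complex.exp ((phase u + phase w : ℝ) * Complex.I) =
      Complex.exp ((phase v : ℝ) * Complex.I) := by
    have h1 := ofReal_sub_I_ne_zero u
    have h2 := ofReal_sub_I_ne_zero w
    have h3 := ofReal_sub_I_ne_zero v
    have h4 : (v : ℂ) * (u + w) = u * w - 1 := by
      rw [hv]; push_cast; field_simp
    rw [Complex.ofReal_add, add_mul, Complex.exp_add, exp_phase, exp_phase, exp_phase,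
      div_mul_div_comm, div_eq_div_iff (mul_ne_zero h1 h2) h3]
    apply mul_left_cancel₀ hc
    linear_combination (2 * Complex.I * (u + w)) * h4 -
      2 * Complex.I * (u + w) * Complex.I_sq
  rw [Complex.exp_eq_exp_iff_exists_int] at hexp
  obtain ⟨k, hk⟩ := hexp
  have hk' : phase u + phase w = phase v + k * (2 * Real.pi) := by
    have h5 : (((phase u + phase w : ℝ) : ℂ)) = ((phase v + k * (2 * Real.pi) : ℝ) : ℂ) := by
      apply mul_right_cancel₀ Complex.I_ne_zero
      rw [hk]; push_cast; ring
    exact_mod_cast h5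
  have hpi := Real.pi_pos
  have a1 := phase_pos v
  have a2 := phase_lt v
  have b1 := phase_pos u
  have b2 := phase_lt u
  have c1 := phase_pos w
  have c2 := phase_lt w
  have hneg : phase (-w) = 2 * Real.pi - phase w := by unfold phase; rw [Real.arctan_neg]; ring
  have hk1 : (-1 : ℝ) < k := by by_contra! hh; nlinarith
  have hk2 : (k : ℝ) < 2 := by by_contra! hh; nlinarith
  have hk1' : (-1 : ℤ) < k := by exact_mod_cast hk1
  have hk2' : k < 2 := by exact_mod_cast hk2
  split_ifs with hs
  · have := phase_strictAnti (show u < -w by linarith)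
    have h0 : (0 : ℝ) < k := by by_contra! hh; nlinarith
    have h0' : (0 : ℤ) < k := by exact_mod_cast h0
    have : k = 1 := by omega
    rw [hk', this]; simp
  · have := phase_strictAnti (show -w < u by
      have := lt_of_le_of_ne (not_lt.1 hs) (Ne.symm h); linarith)
    have h0 : (k : ℝ) < 1 := by by_contra! hh; nlinarith
    have h0' : k < 1 := by exact_mod_cast h0
    have : k = 0 := by omega
    rw [hk', this]; simp

/-- The increment of the relative Prüfer phase. -/
def phaseIncr (ψ : ℝ) (γ : ℂ) : ℝ :=
  2 * Complex.arg (1 - starRingEnd ℂ γ) -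
    2 * Complex.arg (1 - starRingEnd ℂ γ * Complex.exp (ψ * Complex.I))

theorem abs_arg_one_sub_lt {w : ℂ} (hw : ‖w‖ < 1) : |Complex.arg (1 - w)| < Real.pi / 2 := by
  rw [Complex.abs_arg_lt_pi_div_two_iff]
  left
  have := (Complex.re_le_norm w).trans_lt hw
  simpa using this

/-- The disc parameter of the affine map `v ↦ τ + R * v`. -/
def discParam (R τ : ℝ) : ℂ := (τ + (1 - R) * Complex.I) / (τ - (1 + R) * Complex.I)

theorem stepDenom_ne_zero {R : ℝ} (hR : 0 < R) (τ : ℝ) :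
    (τ : ℂ) + (1 + R) * Complex.I ≠ 0 := fun h => by
  have := congrArg Complex.im h
  simp at this
  linarith

theorem stepDenom_conj_ne_zero {R : ℝ} (hR : 0 < R) (τ : ℝ) :
    (τ : ℂ) - (1 + R) * Complex.I ≠ 0 := fun h => by
  have := congrArg Complex.im h
  simp at this
  linarith

/-- The unimodular factor attached to a disc parameter. -/
def twist (g : ℂ) : ℂ := (1 - g) / (1 - starRingEnd ℂ g)

theorem twist_discParam {R : ℝ} (hR : 0 < R) (τ : ℝ) : twist (discParam R τ) =
    -((τ + (1 + R) * Complex.I) / (τ - (1 + R) * Complex.I)) := by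
  have h1 := stepDenom_ne_zero hR τ
  have h2 := stepDenom_conj_ne_zero hR τ
  have h3 : 1 - discParam R τ = -2 * Complex.I / (τ - (1 + R) * Complex.I) := by
    rw [discParam, eq_div_iff h2, sub_mul, div_mul_cancel₀ _ h2]; ring
  have h4 : 1 - starRingEnd ℂ (discParam R τ) = 2 * Complex.I / (τ + (1 + R) * Complex.I) := by
    simp only [discParam, map_div₀, map_add, map_sub, map_mul, map_one, Complex.conj_ofReal,
      Complex.conj_I, mul_neg, sub_neg_eq_add]
    rw [eq_div_iff h1, sub_mul, div_mul_cancel₀ _ h1]; ring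
  rw [twist, h3, h4]
  have := Complex.I_ne_zero
  field_simp

/-- The rotated disc parameter entering the phase recursion. -/
def rotParam (g ζ : ℂ) : ℂ := -(starRingEnd ℂ (twist g * ζ) * g)

theorem conj_rotParam_discParam {R : ℝ} (hR : 0 < R) (τ : ℝ) (ζ : ℂ) :
    starRingEnd ℂ (rotParam (discParam R τ) ζ) =
      ζ * ((τ - (1 - R) * Complex.I) / (τ - (1 + R) * Complex.I)) := by
  have h1 := stepDenom_ne_zero hR τ
  have h2 := stepDenom_conj_ne_zero hR τ
  rw [rotParam, twist_discParam hR, discParam]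
  simp only [map_div₀, map_add, map_sub, map_mul, map_neg, map_one, Complex.conj_ofReal,
    Complex.conj_I, Complex.conj_conj, mul_neg, sub_neg_eq_add]
  simp only [← sub_eq_add_neg]
  field_simp
  ring

theorem one_sub_mul_exp_phase {R : ℝ} (hR : 0 < R) (τ v : ℝ) :
    (1 - (τ - (1 - R) * Complex.I) / (τ - (1 + R) * Complex.I) *
        Complex.exp (phase v * Complex.I)) * ((R : ℂ) * ((v : ℂ) - Complex.I)) =
      (1 - (τ - (1 - R) * Complex.I) / (τ - (1 + R) * Complex.I)) *
        (((τ + R * v : ℝ) : ℂ) - Complex.I) := by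
  have h2 := stepDenom_conj_ne_zero hR τ
  have hv := ofReal_sub_I_ne_zero v
  apply mul_left_cancel₀ h2
  have hbD := div_mul_cancel₀ ((τ : ℂ) - (1 - R) * Complex.I) h2
  have hE : Complex.exp (phase v * Complex.I) * ((v : ℂ) - Complex.I) = v + Complex.I := by
    rw [exp_phase, div_mul_cancel₀ _ hv]
  push_cast
  linear_combination (-(R : ℂ) * Complex.exp (phase v * Complex.I) * (v - Complex.I) +
    (τ + R * v - Complex.I)) * hbD - (R : ℂ) * (τ - (1 - R) * Complex.I) * hE

theorem phase_affine_sub {R : ℝ} (hR : 0 < R) (τ v : ℝ) :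
    phase (τ + R * v) - phase v =
      2 * Complex.arg (1 - (τ - (1 - R) * Complex.I) / (τ - (1 + R) * Complex.I)) -
      2 * Complex.arg (1 - (τ - (1 - R) * Complex.I) / (τ - (1 + R) * Complex.I) *
        Complex.exp (phase v * Complex.I)) := by
  have h2 := stepDenom_conj_ne_zero hR τ
  set b : ℂ := (τ - (1 - R) * Complex.I) / (τ - (1 + R) * Complex.I) with hb
  have hbn : ‖b‖ < 1 := by
    rw [hb, norm_div, div_lt_one (norm_pos_iff.2 h2),
      ← sq_lt_sq₀ (norm_nonneg _) (norm_nonneg _), ← Complex.normSq_eq_norm_sq,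
      ← Complex.normSq_eq_norm_sq]
    simp [Complex.normSq_apply]
    nlinarith
  have hbE : ‖b * Complex.exp (phase v * Complex.I)‖ < 1 := by
    rwa [norm_mul, Complex.norm_exp_ofReal_mul_I, mul_one]
  have e1 := abs_lt.1 (abs_arg_one_sub_lt hbn)
  have e2 := abs_lt.1 (abs_arg_one_sub_lt hbE)
  have hne : ∀ {w : ℂ}, ‖w‖ < 1 → 1 - w ≠ 0 := fun {w} hw h => by
    rw [← sub_eq_zero.1 h] at hw; simp at hw
  have hv := ofReal_sub_I_ne_zero v
  have hw := ofReal_sub_I_ne_zero (τ + R * v)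
  have hkey := one_sub_mul_exp_phase hR τ v
  rw [← hb] at hkey
  have hang := congrArg (fun x : ℂ => (Complex.arg x : Real.Angle)) hkey
  rw [Complex.arg_mul_coe_angle (hne hbE) (mul_ne_zero (by exact_mod_cast hR.ne') hv),
    Complex.arg_mul_coe_angle (hne hbn) hw, Complex.arg_real_mul _ hR, arg_sub_I, arg_sub_I,
    ← Real.Angle.coe_add, ← Real.Angle.coe_add, Real.Angle.angle_eq_iff_two_pi_dvd_sub] at hang
  obtain ⟨k, hk⟩ := hang
  have hpi := Real.pi_pos
  have a1 := phase_pos v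
  have a2 := phase_lt v
  have c1 := phase_pos (τ + R * v)
  have c2 := phase_lt (τ + R * v)
  have hk1 : (-1 : ℝ) < k := by by_contra! hh; nlinarith
  have hk2 : (k : ℝ) < 1 := by by_contra! hh; nlinarith
  have hk1' : (-1 : ℤ) < k := by exact_mod_cast hk1
  have hk2' : k < 1 := by exact_mod_cast hk2
  have : k = 0 := by omega
  rw [this] at hk
  simp only [Int.cast_zero, mul_zero] at hk
  linarith

/-- The number of coordinates exceeding `u`. -/
def countAbove {n : ℕ} (u : ℝ) (y : Fin n → ℝ) : ℕ := ∑ i, if u < y i then 1 else 0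

theorem Interlaces.countAbove_le {n : ℕ} {z : Fin (n + 1) → ℝ} {y : Fin n → ℝ}
    (h : Interlaces z y) (u : ℝ) : countAbove u y ≤ countAbove u z := by
  unfold countAbove
  rw [Fin.sum_univ_succ]
  refine le_add_left (Finset.sum_le_sum fun i _ => ?_)
  have := (h i).2
  split_ifs <;> first | omega | linarith

theorem Interlaces.countAbove_le_add_one {n : ℕ} {z : Fin (n + 1) → ℝ} {y : Fin n → ℝ}
    (h : Interlaces z y) (u : ℝ) : countAbove u z ≤ countAbove u y + 1 := by
  unfold countAbove
  rw [Fin.sum_univ_castSucc]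
  refine add_le_add (Finset.sum_le_sum fun i _ => ?_) ?_
  · have := (h i).1
    split_ifs <;> first | omega | linarith
  · split_ifs <;> omega

theorem prod_sub_mul_neg_one_pow_countAbove_pos {n : ℕ} {y : Fin n → ℝ} {u : ℝ}
    (hu : ∀ i, u ≠ y i) : 0 < (∏ i, (u - y i)) * (-1) ^ countAbove u y := by
  unfold countAbove
  rw [← Finset.prod_pow_eq_pow_sum, ← Finset.prod_mul_distrib]
  refine Finset.prod_pos fun i _ => ?_
  split_ifs with h
  · linarith
  · have := lt_of_le_of_ne (not_lt.1 h) (hu i).symm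
    linarith

theorem Interlaces.countAbove_eq {n : ℕ} {z : Fin (n + 1) → ℝ} {y : Fin n → ℝ}
    (h : Interlaces z y) {u : ℝ} (hy : ∀ i, u ≠ y i) (hz : ∀ k, u ≠ z k) :
    countAbove u z = countAbove u y +
      if (∏ k, (u - z k)) / (∏ i, (u - y i)) < 0 then 1 else 0 := by
  have h1 := h.countAbove_le u
  have h2 := h.countAbove_le_add_one u
  have h3 := prod_sub_mul_neg_one_pow_countAbove_pos hy
  have h4 := prod_sub_mul_neg_one_pow_countAbove_pos hz
  have hY : ∏ i, (u - y i) ≠ 0 := Finset.prod_ne_zero_iff.2 fun i _ => sub_ne_zero.2 (hy i)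
  have h5 := div_pos h4 h3
  rw [mul_div_mul_comm] at h5
  have h6 : ((-1 : ℝ) ^ countAbove u y) ≠ 0 := pow_ne_zero _ (by norm_num)
  rcases (by omega : countAbove u z = countAbove u y ∨
    countAbove u z = countAbove u y + 1) with h7 | h7
  · rw [h7, div_self h6, mul_one] at h5
    rw [if_neg (not_lt.2 h5.le), h7, add_zero]
  · rw [h7, pow_succ, mul_div_right_comm, div_self h6] at h5
    rw [if_pos (by linarith), h7]

/-- The value at `u` of the rational function with poles `y` and zeros `x`, in the coordinate
of the half-line action. -/
def startDrift {n : ℕ} (u : ℝ) (y : Fin (n + 1) → ℝ) (x : Fin n → ℝ) : ℝ :=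
  u - (1 + u ^ 2) * ((∏ j, (u - x j)) / ∏ i, (u - y i))

/-- The value at infinity, see `startDrift`. -/
def endDrift {n : ℕ} (y : Fin (n + 1) → ℝ) (x : Fin n → ℝ) : ℝ := ∑ j, x j - ∑ i, y i

/-- The relative Prüfer phase at `u`. -/
def relPhase {n : ℕ} (u : ℝ) (y : Fin (n + 1) → ℝ) (x : Fin n → ℝ) : ℝ :=
  2 * Real.pi * countAbove u y + phase (startDrift u y x) - phase (endDrift y x)

/-- The unimodular number with argument the Prüfer phase at infinity. -/
def endPhase {n : ℕ} (y : Fin (n + 1) → ℝ) (x : Fin n → ℝ) : ℂ :=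
  Complex.exp (phase (endDrift y x) * Complex.I)

theorem exp_phase_startDrift {n : ℕ} (u : ℝ) (y : Fin (n + 1) → ℝ) (x : Fin n → ℝ) :
    Complex.exp (phase (startDrift u y x) * Complex.I) =
      endPhase y x * Complex.exp (relPhase u y x * Complex.I) := by
  rw [endPhase, ← Complex.exp_add, Complex.exp_eq_exp_iff_exists_int]
  refine ⟨-countAbove u y, ?_⟩
  rw [relPhase]
  push_cast
  ring

theorem LevelStep.endDrift_eq {n : ℕ} {z : Fin (n + 2) → ℝ} {y : Fin (n + 1) → ℝ}
    {x : Fin n → ℝ} {R τ : ℝ} (h : LevelStep z y x R τ) :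
    endDrift z y = τ + R * endDrift y x := by
  unfold endDrift
  linear_combination -h.sum_eq

theorem LevelStep.relPhase_eq {n : ℕ} {z : Fin (n + 2) → ℝ} {y : Fin (n + 1) → ℝ}
    {x : Fin n → ℝ} {R τ : ℝ} (h : LevelStep z y x R τ) {u : ℝ} (hy : ∀ i, u ≠ y i)
    (hz : ∀ k, u ≠ z k) :
    relPhase u z y = phase u + relPhase u y x +
      phaseIncr (relPhase u y x) (rotParam (discParam R τ) (endPhase y x)) := by
  have hdiv := h.eval_div hy
  have hY : ∏ i, (u - y i) ≠ 0 := Finset.prod_ne_zero_iff.2 fun i _ => sub_ne_zero.2 (hy i)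
  have hZ : ∏ k, (u - z k) ≠ 0 := Finset.prod_ne_zero_iff.2 fun i _ => sub_ne_zero.2 (hz i)
  have hdiv' : (∏ k, (u - z k)) / ∏ i, (u - y i) = u + (τ + R * startDrift u y x) := by
    rw [hdiv, startDrift]; ring
  have hne : u + (τ + R * startDrift u y x) ≠ 0 := hdiv' ▸ div_ne_zero hZ hY
  have hstart : startDrift u z y =
      (u * (τ + R * startDrift u y x) - 1) / (u + (τ + R * startDrift u y x)) := by
    rw [startDrift, ← inv_div, hdiv']
    field_simp
    ring
  have hcount := h.outer.countAbove_eq hy hz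
  rw [hdiv'] at hcount
  have hadd := phase_add_phase hne
  have e1 := phase_affine_sub h.pos τ (startDrift u y x)
  have e2 := phase_affine_sub h.pos τ (endDrift y x)
  rw [relPhase, phaseIncr, conj_rotParam_discParam h.pos, hstart, hcount, h.endDrift_eq]
  rw [exp_phase_startDrift] at e1
  change _ = _ - 2 * Complex.arg (1 - _ * endPhase y x) at e2
  have e3 : (2 * Real.pi * ((countAbove u y +
      if u + (τ + R * startDrift u y x) < 0 then 1 else 0 : ℕ) : ℝ)) =
      2 * Real.pi * countAbove u y +
        if u + (τ + R * startDrift u y x) < 0 then 2 * Real.pi else 0 := by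
    split_ifs <;> push_cast <;> ring
  have hr : relPhase u y x = 2 * Real.pi * countAbove u y + phase (startDrift u y x) -
    phase (endDrift y x) := rfl
  rw [e3, mul_comm (endPhase y x), mul_assoc _ (endPhase y x)]
  linarith

theorem LevelStep.endPhase_eq {n : ℕ} {z : Fin (n + 2) → ℝ} {y : Fin (n + 1) → ℝ}
    {x : Fin n → ℝ} {R τ : ℝ} (h : LevelStep z y x R τ) :
    endPhase z y = twist (rotParam (discParam R τ) (endPhase y x)) *
      (twist (discParam R τ) * endPhase y x) := by
  have hR := h.pos
  set v := endDrift y x with hv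
  have k1 := one_sub_mul_exp_phase hR τ v
  have k2 := congrArg (starRingEnd ℂ) k1
  have hb := conj_rotParam_discParam hR τ (endPhase y x)
  have hγ : (τ - (1 - R) * Complex.I) / (τ - (1 + R) * Complex.I) *
        Complex.exp (phase v * Complex.I) =
      starRingEnd ℂ (rotParam (discParam R τ) (endPhase y x)) := by
    rw [hb, mul_comm]; rfl
  rw [hγ] at k1 k2
  set γ := rotParam (discParam R τ) (endPhase y x) with hγ'
  have h1 := stepDenom_ne_zero hR τ
  have h2 := stepDenom_conj_ne_zero hR τ
  have hv0 := ofReal_sub_I_ne_zero v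
  have hw0 := ofReal_sub_I_ne_zero (τ + R * v)
  have hRc : (R : ℂ) ≠ 0 := by exact_mod_cast hR.ne'
  have g1 : 1 - ((τ : ℂ) - (1 - R) * Complex.I) / (τ - (1 + R) * Complex.I) =
      -2 * R * Complex.I / (τ - (1 + R) * Complex.I) := by
    rw [eq_div_iff h2, sub_mul, div_mul_cancel₀ _ h2]; ring
  have g2 : starRingEnd ℂ
      (1 - ((τ : ℂ) - (1 - R) * Complex.I) / (τ - (1 + R) * Complex.I)) =
      2 * R * Complex.I / (τ + (1 + R) * Complex.I) := by
    rw [g1]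
    simp only [map_div₀, map_mul, map_neg, map_add, map_sub, map_one, map_ofNat,
      Complex.conj_ofReal, Complex.conj_I]
    ring
  rw [map_mul, map_mul _ (1 - (_ : ℂ) / _), g2] at k2
  rw [g1] at k1
  simp only [map_sub, map_mul, map_one, Complex.conj_ofReal, Complex.conj_I, Complex.conj_conj,
    sub_neg_eq_add] at k2
  have hd : 1 - starRingEnd ℂ γ ≠ 0 := by
    intro h0
    rw [h0, zero_mul] at k1
    exact mul_ne_zero (div_ne_zero (mul_ne_zero (mul_ne_zero (by norm_num) hRc)
      Complex.I_ne_zero) h2) hw0 k1.symm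
  rw [endPhase, h.endDrift_eq, exp_phase, twist_discParam hR, endPhase, exp_phase, twist, ← hv,
    eq_comm, div_mul_eq_mul_div, div_eq_div_iff hd hw0]
  have hI := Complex.I_ne_zero
  rw [eq_comm] at k1 k2
  rw [div_mul_eq_mul_div, div_eq_iff h2] at k1
  rw [div_mul_eq_mul_div, div_eq_iff h1] at k2
  field_simp
  apply mul_left_cancel₀ hRc
  linear_combination (((τ + R * v : ℝ) : ℂ) - Complex.I) * k2 +
    (((τ + R * v : ℝ) : ℂ) + Complex.I) * k1

/-- The point of the unit circle of `ℂ` at a given angle, measured in turns. -/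
def circlePoint (t : UnitAddCircle) : ℂ := AddCircle.toCircle t

theorem measurable_circlePoint : Measurable circlePoint :=
  (continuous_subtype_val.comp AddCircle.continuous_toCircle).measurable

theorem circlePoint_coe (s : ℝ) :
    circlePoint s = Complex.exp ((2 * Real.pi * s : ℝ) * Complex.I) := by
  rw [circlePoint, AddCircle.toCircle_apply_mk, Circle.coe_exp, div_one]

theorem circlePoint_add (s t : UnitAddCircle) :
    circlePoint (s + t) = circlePoint s * circlePoint t := by
  rw [circlePoint, AddCircle.toCircle_add, Circle.coe_mul]; rfl

theorem norm_circlePoint (t : UnitAddCircle) : ‖circlePoint t‖ = 1 := Circle.norm_coe _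

theorem exists_circlePoint_eq {c : ℂ} (hc : ‖c‖ = 1) : ∃ s, circlePoint s = c := by
  refine ⟨((Complex.arg c / (2 * Real.pi) : ℝ) : UnitAddCircle), ?_⟩
  rw [circlePoint_coe, mul_div_cancel₀ _ Real.two_pi_pos.ne']
  simpa [hc] using Complex.norm_mul_exp_arg_mul_I c

/-- The uniform law on the unit circle of `ℂ`. -/
def circleLaw : Measure ℂ := (volume : Measure UnitAddCircle).map circlePoint

instance : IsProbabilityMeasure circleLaw :=
  have : IsProbabilityMeasure (volume : Measure UnitAddCircle) := ⟨UnitAddCircle.measure_univ⟩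
  Measure.isProbabilityMeasure_map measurable_circlePoint.aemeasurable

theorem lintegral_circleLaw {f : ℂ → ENNReal} (hf : Measurable f) :
    ∫⁻ ζ, f ζ ∂circleLaw =
      ∫⁻ s in Set.Ioc (0 : ℝ) 1, f (Complex.exp ((2 * Real.pi * s : ℝ) * Complex.I)) := by
  rw [circleLaw, lintegral_map hf measurable_circlePoint,
    ← UnitAddCircle.lintegral_preimage 0, zero_add]
  simp only [circlePoint_coe]

theorem lintegral_circleLaw_mul {f : ℂ → ENNReal} (hf : Measurable f) {c : ℂ} (hc : ‖c‖ = 1) :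
    ∫⁻ ζ, f (c * ζ) ∂circleLaw = ∫⁻ ζ, f ζ ∂circleLaw := by
  obtain ⟨s, rfl⟩ := exists_circlePoint_eq hc
  have hf' : Measurable fun ζ => f (circlePoint s * ζ) := hf.comp (measurable_const_mul _)
  rw [circleLaw, lintegral_map hf measurable_circlePoint,
    lintegral_map hf' measurable_circlePoint]
  simp only [← circlePoint_add]
  exact lintegral_add_left_eq_self (μ := (volume : Measure UnitAddCircle))
    (fun t => f (circlePoint t)) s

theorem ae_circleLaw_norm_eq_one : ∀ᵐ ζ ∂circleLaw, ‖ζ‖ = 1 := by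
  rw [circleLaw, ae_map_iff measurable_circlePoint.aemeasurable
    (measurableSet_eq_fun measurable_norm measurable_const)]
  exact ae_of_all _ norm_circlePoint

/-- The rotation invariant law on the unit disc with density proportional to
`(1 - ‖g‖ ^ 2) ^ (b - 1)`. -/
def discLaw (b : ℝ) : Measure ℂ :=
  (volume.restrict (Metric.ball (0 : ℂ) 1)).withDensity fun g =>
    ENNReal.ofReal (b / Real.pi * (1 - ‖g‖ ^ 2) ^ (b - 1))

theorem measurable_discDensity (b : ℝ) : Measurable fun g : ℂ =>
    ENNReal.ofReal (b / Real.pi * (1 - ‖g‖ ^ 2) ^ (b - 1)) := by fun_prop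

theorem lintegral_discLaw (b : ℝ) {f : ℂ → ENNReal} (hf : Measurable f) :
    ∫⁻ g, f g ∂discLaw b = ∫⁻ g in Metric.ball (0 : ℂ) 1,
      ENNReal.ofReal (b / Real.pi * (1 - ‖g‖ ^ 2) ^ (b - 1)) * f g := by
  rw [discLaw, lintegral_withDensity_eq_lintegral_mul _ (measurable_discDensity b) hf]
  rfl

theorem ae_discLaw_norm_lt_one (b : ℝ) : ∀ᵐ g ∂discLaw b, ‖g‖ < 1 := by
  refine (withDensity_absolutelyContinuous _ _).ae_le ?_
  filter_upwards [ae_restrict_mem (μ := (volume : Measure ℂ))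
    (measurableSet_ball (x := (0 : ℂ)) (ε := 1))] with g hg using by simpa using hg

theorem lintegral_discLaw_mul (b : ℝ) {f : ℂ → ENNReal} (hf : Measurable f) {c : ℂ}
    (hc : ‖c‖ = 1) : ∫⁻ g, f (c * g) ∂discLaw b = ∫⁻ g, f g ∂discLaw b := by
  have hcS : c ∈ Submonoid.unitSphere ℂ := by simpa [Submonoid.unitSphere] using hc
  have hmp : MeasurePreserving (fun g : ℂ => c * g) volume volume :=
    (rotation ⟨c, hcS⟩).measurePreserving
  have hf' : Measurable fun ζ => f (c * ζ) := hf.comp (measurable_const_mul _)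
  rw [lintegral_discLaw b hf, lintegral_discLaw b hf',
    ← lintegral_indicator Metric.isOpen_ball.measurableSet,
    ← lintegral_indicator Metric.isOpen_ball.measurableSet]
  refine Eq.trans ?_ (hmp.lintegral_comp
    (((measurable_discDensity b).mul hf).indicator measurableSet_ball))
  refine lintegral_congr fun g => ?_
  simp [Set.indicator, hc]

/-- Radial functions of a `discLaw` variable. -/
theorem lintegral_discLaw_norm_sq {b : ℝ} (hb : 0 < b) {f : ℝ → ENNReal} (hf : Measurable f) :
    ∫⁻ g, f (‖g‖ ^ 2) ∂discLaw b =
      ∫⁻ t in Set.Ioo (0 : ℝ) 1, ENNReal.ofReal (b * (1 - t) ^ (b - 1)) * f t := by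
  have hf' : Measurable fun g : ℂ => f (‖g‖ ^ 2) := by fun_prop
  rw [lintegral_discLaw b hf', ← lintegral_indicator Metric.isOpen_ball.measurableSet,
    ← Complex.lintegral_comp_polarCoord_symm]
  have hball : ∀ r : ℝ, 0 < r → ∀ φ : ℝ, ENNReal.ofReal r • (Metric.ball (0 : ℂ) 1).indicator
      (fun g => ENNReal.ofReal (b / Real.pi * (1 - ‖g‖ ^ 2) ^ (b - 1)) * f (‖g‖ ^ 2))
        (Complex.polarCoord.symm (r, φ)) =
      (Set.Ioo (0 : ℝ) 1).indicator (fun r => ENNReal.ofReal r *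
        (ENNReal.ofReal (b / Real.pi * (1 - r ^ 2) ^ (b - 1)) * f (r ^ 2))) r := by
    intro r hr φ
    have hn : ‖Complex.polarCoord.symm (r, φ)‖ = r := by
      rw [Complex.norm_polarCoord_symm, abs_of_pos hr]
    by_cases h1 : r < 1
    · rw [Set.indicator_of_mem (by simpa [abs_of_pos hr] using h1),
        Set.indicator_of_mem (show r ∈ Set.Ioo (0 : ℝ) 1 from ⟨hr, h1⟩), hn, smul_eq_mul]
    · rw [Set.indicator_of_notMem (by simpa [abs_of_pos hr] using h1),
        Set.indicator_of_notMem (show r ∉ Set.Ioo (0 : ℝ) 1 from fun h => h1 h.2), smul_zero]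
  have hK : Measurable fun r : ℝ => (Set.Ioo (0 : ℝ) 1).indicator (fun r => ENNReal.ofReal r *
        (ENNReal.ofReal (b / Real.pi * (1 - r ^ 2) ^ (b - 1)) * f (r ^ 2))) r := by
    refine Measurable.indicator ?_ measurableSet_Ioo
    fun_prop
  have h1 : ∫⁻ p in polarCoord.target, ENNReal.ofReal p.1 • (Metric.ball (0 : ℂ) 1).indicator
      (fun g => ENNReal.ofReal (b / Real.pi * (1 - ‖g‖ ^ 2) ^ (b - 1)) * f (‖g‖ ^ 2))
        (Complex.polarCoord.symm p) = ∫⁻ p in Set.Ioi (0 : ℝ) ×ˢ Set.Ioo (-Real.pi) Real.pi,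
      (Set.Ioo (0 : ℝ) 1).indicator (fun r => ENNReal.ofReal r *
        (ENNReal.ofReal (b / Real.pi * (1 - r ^ 2) ^ (b - 1)) * f (r ^ 2))) p.1 := by
    rw [polarCoord_target]
    exact setLIntegral_congr_fun (measurableSet_Ioi.prod measurableSet_Ioo)
      fun p hp => hball p.1 hp.1 p.2
  have hKp : Measurable fun p : ℝ × ℝ => (Set.Ioo (0 : ℝ) 1).indicator
      (fun r => ENNReal.ofReal r *
        (ENNReal.ofReal (b / Real.pi * (1 - r ^ 2) ^ (b - 1)) * f (r ^ 2))) p.1 :=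
    hK.comp measurable_fst
  rw [h1, Measure.volume_eq_prod, setLIntegral_prod _ hKp.aemeasurable]
  simp only [setLIntegral_const, Real.volume_Ioo]
  have hpi := Real.pi_pos
  rw [lintegral_mul_const _ hK, lintegral_indicator measurableSet_Ioo,
    Measure.restrict_restrict measurableSet_Ioo,
    Set.inter_eq_left.2 Set.Ioo_subset_Ioi_self]
  have him : (fun r : ℝ => r ^ 2) '' Set.Ioo 0 1 = Set.Ioo 0 1 := by
    ext t
    constructor
    · rintro ⟨r, ⟨h0, h1⟩, rfl⟩
      exact ⟨by positivity, by nlinarith⟩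
    · rintro ⟨h0, h1⟩
      exact ⟨Real.sqrt t, ⟨Real.sqrt_pos.2 h0, (Real.sqrt_lt' one_pos).2 (by simpa using h1)⟩,
        Real.sq_sqrt h0.le⟩
  have hinj : Set.InjOn (fun r : ℝ => r ^ 2) (Set.Ioo 0 1) := fun r hr s hs h =>
    (pow_left_inj₀ hr.1.le hs.1.le two_ne_zero).1 h
  conv_rhs => rw [← him]
  rw [lintegral_image_eq_lintegral_abs_deriv_mul measurableSet_Ioo
    (fun r _ => (hasDerivAt_pow 2 r).hasDerivWithinAt) hinj,
    ← lintegral_mul_const _ (by fun_prop)]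
  refine setLIntegral_congr_fun measurableSet_Ioo fun r hr => ?_
  have hr0 := hr.1
  rw [← mul_assoc, ← mul_assoc, mul_right_comm, ← ENNReal.ofReal_mul hr0.le,
    ← ENNReal.ofReal_mul (by
      have : (0 : ℝ) ≤ 1 - r ^ 2 := by nlinarith [hr.2]
      positivity), ← ENNReal.ofReal_mul (by positivity)]
  congr 2
  rw [abs_of_pos (by simpa using hr0)]
  field_simp
  push_cast
  ring

theorem det_complex_smul_one (c : ℂ) : (c • (1 : ℂ →L[ℝ] ℂ)).det = Complex.normSq c := by
  rw [← Algebra.norm_complex_apply, Algebra.norm_apply, ContinuousLinearMap.det]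
  congr 1

/-- The Cayley transform from the lower half plane to the unit disc. -/
theorem lintegral_lowerHalfPlane_cayley (F : ℂ → ENNReal) :
    ∫⁻ g in Metric.ball (0 : ℂ) 1, F g = ∫⁻ h in {h : ℂ | h.im < 0},
      ENNReal.ofReal (4 / Complex.normSq (h - Complex.I) ^ 2) *
        F ((h + Complex.I) / (h - Complex.I)) := by
  have hS : MeasurableSet {h : ℂ | h.im < 0} :=
    measurableSet_lt Complex.measurable_im measurable_const
  have hne : ∀ h : ℂ, h.im < 0 → h - Complex.I ≠ 0 := fun h hh h0 => by
    have := congrArg Complex.im h0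
    simp at this
    linarith
  have hI := Complex.I_ne_zero
  have him : (fun h : ℂ => (h + Complex.I) / (h - Complex.I)) '' {h : ℂ | h.im < 0} =
      Metric.ball 0 1 := by
    ext g
    simp only [Set.mem_image, Set.mem_ofPred_eq, mem_ball_zero_iff]
    constructor
    · rintro ⟨h, hh, rfl⟩
      rw [norm_div, div_lt_one (norm_pos_iff.2 (hne h hh)),
        ← sq_lt_sq₀ (norm_nonneg _) (norm_nonneg _), ← Complex.normSq_eq_norm_sq,
        ← Complex.normSq_eq_norm_sq]
      simp [Complex.normSq_apply]
      nlinarith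
    · intro hg
      have hg1 : 1 - g ≠ 0 := fun h0 => by
        rw [← sub_eq_zero.1 h0] at hg; simp at hg
      have hg2 : 0 < Complex.normSq (1 - g) := Complex.normSq_pos.2 hg1
      refine ⟨-Complex.I * ((1 + g) / (1 - g)), ?_, ?_⟩
      · have h3 : Complex.normSq g < 1 := by
          rw [Complex.normSq_eq_norm_sq]; nlinarith [norm_nonneg g]
        rw [Complex.normSq_apply] at h3
        have h4 : (-Complex.I * ((1 + g) / (1 - g))).im =
            -((1 - (g.re * g.re + g.im * g.im)) / Complex.normSq (1 - g)) := by
          simp [Complex.div_re]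
          ring
        rw [h4]
        have := div_pos (sub_pos.2 h3) hg2
        linarith
      · have e1 : -Complex.I * ((1 + g) / (1 - g)) + Complex.I =
            -2 * Complex.I * g / (1 - g) := by field_simp; ring
        have e2 : -Complex.I * ((1 + g) / (1 - g)) - Complex.I =
            -2 * Complex.I / (1 - g) := by field_simp; ring
        rw [e1, e2]
        field_simp
  have hinj : Set.InjOn (fun h : ℂ => (h + Complex.I) / (h - Complex.I)) {h : ℂ | h.im < 0} := by
    intro h hh k hk hhk
    have h1 := hne h hh
    have h2 := hne k hk
    simp only at hhk
    rw [div_eq_div_iff h1 h2] at hhk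
    have : Complex.I * (h - k) = 0 := by linear_combination (-1 / 2 : ℂ) * hhk
    exact sub_eq_zero.1 ((mul_eq_zero.1 this).resolve_left hI)
  have hder : ∀ h ∈ {h : ℂ | h.im < 0},
      HasFDerivWithinAt (fun h : ℂ => (h + Complex.I) / (h - Complex.I))
        ((-2 * Complex.I / (h - Complex.I) ^ 2) • (1 : ℂ →L[ℝ] ℂ)) {h : ℂ | h.im < 0} h := by
    intro h hh
    have := ((hasDerivAt_id h).add_const Complex.I).div ((hasDerivAt_id h).sub_const Complex.I)
      (hne h hh)
    refine (HasDerivAt.complexToReal_fderiv ?_).hasFDerivWithinAt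
    refine this.congr_deriv ?_
    simp only [id]
    ring
  rw [← him, lintegral_image_eq_lintegral_abs_det_fderiv_mul volume hS hder hinj]
  refine lintegral_congr fun h => ?_
  rw [det_complex_smul_one]
  congr 2
  rw [abs_of_nonneg (Complex.normSq_nonneg _)]
  simp [Complex.normSq_apply (Complex.I)]
  norm_num

theorem lintegral_lowerHalfPlane {K : ℂ → ENNReal} (hK : Measurable K) :
    ∫⁻ h in {h : ℂ | h.im < 0}, K h =
      ∫⁻ R in Set.Ioi (0 : ℝ), ∫⁻ τ : ℝ, K (τ - R * Complex.I) := by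
  have hS : MeasurableSet {h : ℂ | h.im < 0} :=
    measurableSet_lt Complex.measurable_im measurable_const
  have hK' : Measurable fun p : ℝ × ℝ => {h : ℂ | h.im < 0}.indicator K (⟨p.1, p.2⟩ : ℂ) :=
    (hK.indicator hS).comp Complex.measurableEquivRealProd.symm.measurable
  rw [← lintegral_indicator hS,
    ← (Complex.volume_preserving_equiv_real_prod.symm).lintegral_comp_emb
      (MeasurableEquiv.measurableEmbedding _), Measure.volume_eq_prod]
  change ∫⁻ p : ℝ × ℝ, {h : ℂ | h.im < 0}.indicator K (⟨p.1, p.2⟩ : ℂ) ∂_ = _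
  rw [lintegral_prod_symm _ hK'.aemeasurable, ← lintegral_neg_eq_self,
    ← lintegral_indicator measurableSet_Ioi]
  refine lintegral_congr fun R => ?_
  by_cases hR : 0 < R
  · rw [Set.indicator_of_mem (show R ∈ Set.Ioi (0 : ℝ) from hR)]
    refine lintegral_congr fun τ => ?_
    rw [Set.indicator_of_mem (by simpa using hR)]
    congr 1
    apply Complex.ext <;> simp
  · rw [Set.indicator_of_notMem (show R ∉ Set.Ioi (0 : ℝ) from hR)]
    exact (lintegral_congr fun τ => Set.indicator_of_notMem (by simpa using hR) _).trans
      lintegral_zero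

theorem lintegral_stepDensity_mul {b : ℝ} (hb : 0 < b) {f : ℂ → ENNReal} (hf : Measurable f) :
    ∫⁻ R in Set.Ioi (0 : ℝ), ∫⁻ τ : ℝ, ENNReal.ofReal (stepDensity b R τ) * f (discParam R τ) =
      ENNReal.ofReal (Real.pi / (b * 4 ^ b)) * ∫⁻ g, f g ∂discLaw b := by
  have hF := (measurable_discDensity b).mul hf
  have hden : Measurable fun h : ℂ =>
      ENNReal.ofReal (4 / Complex.normSq (h - Complex.I) ^ 2) := by
    simp only [Complex.normSq_eq_norm_sq]
    fun_prop
  have hcay : Measurable fun h : ℂ => (h + Complex.I) / (h - Complex.I) := by fun_prop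
  have hK : Measurable fun h : ℂ => ENNReal.ofReal (4 / Complex.normSq (h - Complex.I) ^ 2) *
      (ENNReal.ofReal (b / Real.pi * (1 - ‖(h + Complex.I) / (h - Complex.I)‖ ^ 2) ^ (b - 1)) *
        f ((h + Complex.I) / (h - Complex.I))) := hden.mul (hF.comp hcay)
  rw [lintegral_discLaw b hf, lintegral_lowerHalfPlane_cayley, lintegral_lowerHalfPlane hK,
    ← lintegral_const_mul' _ _ ENNReal.ofReal_ne_top]
  refine setLIntegral_congr_fun measurableSet_Ioi fun R hR => ?_
  have hR : 0 < R := hR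
  rw [← lintegral_const_mul' _ _ ENNReal.ofReal_ne_top]
  refine lintegral_congr fun τ => ?_
  have hg : ((τ : ℂ) - R * Complex.I + Complex.I) / (τ - R * Complex.I - Complex.I) =
      discParam R τ := by
    rw [discParam]; congr 1 <;> ring
  have hρ : Complex.normSq ((τ : ℂ) - R * Complex.I - Complex.I) = (1 + R) ^ 2 + τ ^ 2 := by
    simp [Complex.normSq_apply]; ring
  have hρ0 : 0 < (1 + R) ^ 2 + τ ^ 2 := by positivity
  have hn : 1 - ‖discParam R τ‖ ^ 2 = 4 * R / ((1 + R) ^ 2 + τ ^ 2) := by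
    rw [← Complex.normSq_eq_norm_sq, ← hg, map_div₀, hρ, eq_div_iff hρ0.ne', sub_mul,
      div_mul_cancel₀ _ hρ0.ne']
    simp [Complex.normSq_apply]; ring
  rw [hg, hρ, hn, ← mul_assoc, ← mul_assoc, ← ENNReal.ofReal_mul (by positivity),
    ← ENNReal.ofReal_mul (by positivity)]
  congr 2
  have hpi := Real.pi_pos
  rw [stepDensity, Real.div_rpow (by positivity) hρ0.le, Real.mul_rpow (by norm_num) hR.le,
    neg_add, Real.rpow_add hρ0, Real.rpow_neg hρ0.le, Real.rpow_neg_one, Real.rpow_sub_one hρ0.ne',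
    Real.rpow_sub_one (by norm_num : (4 : ℝ) ≠ 0)]
  have h4 : (0 : ℝ) < 4 ^ b := by positivity
  have h5 : (0 : ℝ) < ((1 + R) ^ 2 + τ ^ 2) ^ b := by positivity
  field_simp

@[fun_prop]
theorem measurable_countAbove {n : ℕ} (u : ℝ) :
    Measurable (countAbove u : (Fin n → ℝ) → ℕ) := by
  unfold countAbove
  refine Finset.measurable_sum _ fun i _ => Measurable.ite ?_ measurable_const measurable_const
  exact measurableSet_lt measurable_const (measurable_pi_apply i)

@[fun_prop]
theorem measurable_startDrift {n : ℕ} (u : ℝ) :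
    Measurable fun p : (Fin (n + 1) → ℝ) × (Fin n → ℝ) => startDrift u p.1 p.2 := by
  unfold startDrift
  fun_prop

@[fun_prop]
theorem measurable_endDrift {n : ℕ} :
    Measurable fun p : (Fin (n + 1) → ℝ) × (Fin n → ℝ) => endDrift p.1 p.2 := by
  unfold endDrift
  fun_prop

@[fun_prop]
theorem measurable_relPhase {n : ℕ} (u : ℝ) :
    Measurable fun p : (Fin (n + 1) → ℝ) × (Fin n → ℝ) => relPhase u p.1 p.2 := by
  have h1 := measurable_phase.comp (measurable_startDrift (n := n) u)
  have h2 := measurable_phase.comp (measurable_endDrift (n := n))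
  have h3 : Measurable fun p : (Fin (n + 1) → ℝ) × (Fin n → ℝ) => (countAbove u p.1 : ℝ) :=
    measurable_from_top.comp ((measurable_countAbove u).comp measurable_fst)
  exact ((h3.const_mul _).add h1).sub h2

@[fun_prop]
theorem measurable_endPhase {n : ℕ} :
    Measurable fun p : (Fin (n + 1) → ℝ) × (Fin n → ℝ) => endPhase p.1 p.2 := by
  have h2 := measurable_phase.comp (measurable_endDrift (n := n))
  exact Complex.measurable_exp.comp ((Complex.measurable_ofReal.comp h2).mul_const _)

theorem measurable_twist : Measurable twist := by
  have := Complex.continuous_conj.measurable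
  unfold twist
  fun_prop

theorem measurable_rotParam : Measurable fun p : ℂ × ℂ => rotParam p.1 p.2 := by
  have := Complex.continuous_conj.measurable
  have := measurable_twist
  unfold rotParam
  fun_prop

theorem measurable_phaseIncr : Measurable fun p : ℝ × ℂ => phaseIncr p.1 p.2 := by
  have := Complex.continuous_conj.measurable
  unfold phaseIncr
  fun_prop

theorem measurable_discParam : Measurable fun p : ℝ × ℝ => discParam p.1 p.2 := by
  unfold discParam
  fun_prop

/-- The new pair of relative phase and endpoint phase after a step with disc parameter `g`. -/
def phaseStep (θ : ℝ) (p : ℝ × ℂ) (g : ℂ) : ℝ × ℂ :=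
  (θ + p.1 + phaseIncr p.1 (rotParam g p.2), twist (rotParam g p.2) * (twist g * p.2))

theorem measurable_phaseStep (θ : ℝ) :
    Measurable fun q : (ℝ × ℂ) × ℂ => phaseStep θ q.1 q.2 := by
  have h1 := measurable_twist
  have h2 := measurable_rotParam.comp
    (by fun_prop : Measurable fun q : (ℝ × ℂ) × ℂ => (q.2, q.1.2))
  have h3 := measurable_phaseIncr.comp
    ((by fun_prop : Measurable fun q : (ℝ × ℂ) × ℂ => q.1.1).prodMk h2)
  have h4 : Measurable fun q : (ℝ × ℂ) × ℂ => θ + q.1.1 := by fun_prop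
  have h5 : Measurable fun q : (ℝ × ℂ) × ℂ => twist q.2 * q.1.2 := by fun_prop
  exact (h4.add h3).prodMk ((h1.comp h2).mul h5)

theorem ae_forall_ne {n : ℕ} (u : ℝ) : ∀ᵐ y : Fin n → ℝ, ∀ i, u ≠ y i := by
  rw [eventually_all]
  intro i
  have h : volume {y : Fin n → ℝ | y i = u} = 0 := by
    rw [volume_pi]; exact Measure.pi_hyperplane (fun _ : Fin n => (volume : Measure ℝ)) i u
  filter_upwards [compl_mem_ae_iff.2 h] with y hy hu using hy hu.symm

theorem lintegral_setLIntegral_interlaces_swap {n : ℕ}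
    {f : (Fin (n + 1) → ℝ) → (Fin n → ℝ) → ENNReal} (hf : Measurable (Function.uncurry f)) :
    ∫⁻ z, ∫⁻ y in {y | Interlaces z y}, f z y =
      ∫⁻ y, ∫⁻ z in {z | Interlaces z y}, f z y := by
  have h1 : ∀ z : Fin (n + 1) → ℝ, ∫⁻ y in {y | Interlaces z y}, f z y =
      ∫⁻ y, {p : (Fin (n + 1) → ℝ) × (Fin n → ℝ) | Interlaces p.1 p.2}.indicator
        (Function.uncurry f) (z, y) := fun z => by
    rw [← lintegral_indicator (measurableSet_interlaces_right z)]
    rfl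
  have h2 : ∀ y : Fin n → ℝ, ∫⁻ z in {z | Interlaces z y}, f z y =
      ∫⁻ z, {p : (Fin (n + 1) → ℝ) × (Fin n → ℝ) | Interlaces p.1 p.2}.indicator
        (Function.uncurry f) (z, y) := fun y => by
    rw [← lintegral_indicator (measurableSet_interlaces_left y)]
    rfl
  simp_rw [h1, h2]
  exact lintegral_lintegral_swap (hf.indicator measurableSet_interlaces).aemeasurable

theorem lintegral_pair_step {a : ℝ} (ha : 0 < a) {n : ℕ} (u : ℝ) {H : ℝ × ℂ → ENNReal}
    (hH : Measurable H) :
    ∫⁻ z : Fin (n + 2) → ℝ, ∫⁻ y in {y | Interlaces z y},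
        ENNReal.ofReal (pairDensity a z y) * H (relPhase u z y, endPhase z y) =
      ENNReal.ofReal (Real.pi / (a * (n + 1) * 4 ^ (a * (n + 1)))) *
        ∫⁻ y : Fin (n + 1) → ℝ, ∫⁻ x in {x | Interlaces y x},
          ENNReal.ofReal (pairDensity a y x) *
            ∫⁻ g, H (phaseStep (phase u) (relPhase u y x, endPhase y x) g)
              ∂discLaw (a * (n + 1)) := by
  have hm : Measurable fun p : (Fin (n + 2) → ℝ) × (Fin (n + 1) → ℝ) =>
      H (relPhase u p.1 p.2, endPhase p.1 p.2) :=
    hH.comp ((measurable_relPhase u).prodMk measurable_endPhase)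
  have hb : 0 < a * (n + 1) := by positivity
  rw [lintegral_setLIntegral_interlaces_swap ((measurable_pairDensity a).ennreal_ofReal.mul hm),
    ← lintegral_const_mul' _ _ ENNReal.ofReal_ne_top]
  refine lintegral_congr_ae ?_
  filter_upwards [ae_forall_ne u] with y hu
  rw [← lintegral_const_mul' _ _ ENNReal.ofReal_ne_top]
  by_cases hy : StrictMono y
  swap
  · have e1 : {z | Interlaces z y} = ∅ := Set.eq_empty_of_forall_notMem
      fun z (hz : Interlaces z y) => hy hz.strictMono_inner
    have e2 : {x | Interlaces y x} = ∅ := Set.eq_empty_of_forall_notMem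
      fun x (hx : Interlaces y x) => hy hx.strictMono_outer
    rw [e1, e2]; simp
  set F : (Fin (n + 2) → ℝ) → ENNReal := fun z =>
    if ∏ k, (u - z k) = 0 then 0 else H (relPhase u z y, endPhase z y) with hF
  set G : (Fin n → ℝ) → ℝ → ℝ → ENNReal := fun x R τ =>
    if u + (τ + R * startDrift u y x) = 0 then 0 else
      H (phaseStep (phase u) (relPhase u y x, endPhase y x) (discParam R τ)) with hG
  have hFm : Measurable F := by
    refine Measurable.ite (measurableSet_eq_fun (by fun_prop) measurable_const)
      measurable_const ?_
    exact hm.of_uncurry_right (f := fun z y => H (relPhase u z y, endPhase z y))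
  have hpair : Measurable fun x : Fin n → ℝ => (relPhase u y x, endPhase y x) :=
    ((measurable_relPhase u).prodMk measurable_endPhase).of_uncurry_left
      (f := fun y x => (relPhase u y x, endPhase y x))
  have hdrift : Measurable fun x : Fin n → ℝ => startDrift u y x :=
    (measurable_startDrift u).of_uncurry_left (f := fun y x => startDrift u y x)
  have hstep : Measurable fun p : (Fin n → ℝ) × ℂ =>
      H (phaseStep (phase u) (relPhase u y p.1, endPhase y p.1) p.2) := by
    have h := hH.comp ((measurable_phaseStep (phase u)).comp
      ((hpair.comp measurable_fst).prodMk measurable_snd))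
    exact h
  have hGm : Measurable fun p : (Fin n → ℝ) × ℝ × ℝ => G p.1 p.2.1 p.2.2 := by
    refine Measurable.ite (measurableSet_eq_fun ?_ measurable_const) measurable_const ?_
    · have : Measurable fun p : (Fin n → ℝ) × ℝ × ℝ => startDrift u y p.1 :=
        hdrift.comp measurable_fst
      exact measurable_const.add ((measurable_snd.comp measurable_snd).add
        ((measurable_fst.comp measurable_snd).mul this))
    · have h := hstep.comp (measurable_fst.prodMk (measurable_discParam.comp
        (measurable_snd (α := Fin n → ℝ) (β := ℝ × ℝ))))
      exact h
  have hFG : ∀ z x R τ, LevelStep z y x R τ → F z = G x R τ := by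
    intro z x R τ h
    have hY : ∏ i, (u - y i) ≠ 0 := Finset.prod_ne_zero_iff.2 fun i _ => sub_ne_zero.2 (hu i)
    have hdiv : (∏ k, (u - z k)) / ∏ i, (u - y i) = u + (τ + R * startDrift u y x) := by
      rw [h.eval_div hu, startDrift]; ring
    by_cases hz : ∏ k, (u - z k) = 0
    · rw [hz, zero_div] at hdiv
      simp only [hF, hG, if_pos hz, if_pos hdiv.symm]
    · have hw := hdiv ▸ div_ne_zero hz hY
      simp only [hF, hG, if_neg hz, if_neg hw]
      rw [h.relPhase_eq hu fun k => sub_ne_zero.1 (Finset.prod_ne_zero_iff.1 hz k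
        (Finset.mem_univ k)), h.endPhase_eq]
      rfl
  have hkey := lintegral_levelStep a hy hFm hGm hFG
  have hleft : ∫⁻ z in {z | Interlaces z y},
      ENNReal.ofReal (pairDensity a z y) * H (relPhase u z y, endPhase z y) =
      ∫⁻ z in {z | Interlaces z y}, ENNReal.ofReal (pairDensity a z y) * F z := by
    refine lintegral_congr_ae (ae_restrict_of_ae ?_)
    filter_upwards [ae_forall_ne u] with z hz
    rw [hF]
    simp only [if_neg (Finset.prod_ne_zero_iff.2 fun i _ => sub_ne_zero.2 (hz i))]
  rw [hleft, hkey]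
  refine lintegral_congr fun x => ?_
  rw [mul_left_comm, ← lintegral_stepDensity_mul hb
    (hstep.of_uncurry_left (f := fun x g => H (phaseStep (phase u)
      (relPhase u y x, endPhase y x) g)))]
  congr 1
  refine lintegral_congr fun R => ?_
  refine lintegral_congr_ae ?_
  have h0 : volume {-(u + R * startDrift u y x)} = 0 := measure_singleton _
  filter_upwards [compl_mem_ae_iff.2 h0] with τ hτ
  have : u + (τ + R * startDrift u y x) ≠ 0 := fun h => hτ (by
    rw [Set.mem_singleton_iff]; linarith)
  simp only [hG, if_neg this]

theorem intervalIntegrable_one_sub_rpow {c : ℝ} (hc : 0 < c) :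
    IntervalIntegrable (fun t : ℝ => (1 - t) ^ (c - 1)) volume 0 1 := by
  have h := (intervalIntegral.intervalIntegrable_rpow' (a := 0) (b := 1)
    (show -1 < c - 1 by linarith)).comp_sub_left 1
  simpa using h.symm

theorem integral_one_sub_rpow {c : ℝ} (hc : 0 < c) :
    ∫ t in (0 : ℝ)..1, (1 - t) ^ (c - 1) = 1 / c := by
  rw [intervalIntegral.integral_comp_sub_left (fun t : ℝ => t ^ (c - 1)) 1, sub_self, sub_zero,
    integral_rpow (Or.inl (by linarith)), sub_add_cancel, Real.one_rpow, Real.zero_rpow hc.ne',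
    sub_zero]

theorem lintegral_one_sub_rpow_combination {b : ℝ} (hb : 0 < b) (A B C : ℝ)
    (h : ∀ t ∈ Set.Ioo (0 : ℝ) 1,
      0 ≤ A * (1 - t) ^ (b - 1) + B * (1 - t) ^ b + C * (1 - t) ^ (b + 1)) :
    ∫⁻ t in Set.Ioo (0 : ℝ) 1, ENNReal.ofReal
        (A * (1 - t) ^ (b - 1) + B * (1 - t) ^ b + C * (1 - t) ^ (b + 1)) =
      ENNReal.ofReal (A / b + B / (b + 1) + C / (b + 2)) := by
  have e1 := (intervalIntegrable_one_sub_rpow hb).const_mul A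
  have e2 := (intervalIntegrable_one_sub_rpow (show 0 < b + 1 by linarith)).const_mul B
  have e3 := (intervalIntegrable_one_sub_rpow (show 0 < b + 2 by linarith)).const_mul C
  have f1 := integral_one_sub_rpow hb
  have f2 := integral_one_sub_rpow (show 0 < b + 1 by linarith)
  have f3 := integral_one_sub_rpow (show 0 < b + 2 by linarith)
  rw [show b + 1 - 1 = b by ring] at e2 f2
  rw [show b + 2 - 1 = b + 1 by ring] at e3 f3
  have e := (e1.add e2).add e3
  rw [← ofReal_integral_eq_lintegral_ofReal]
  · rw [← integral_Ioc_eq_integral_Ioo, ← intervalIntegral.integral_of_le zero_le_one,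
      intervalIntegral.integral_add (e1.add e2) e3, intervalIntegral.integral_add e1 e2]
    simp only [intervalIntegral.integral_const_mul]
    rw [f1, f2, f3]
    congr 1
    ring
  · rw [intervalIntegrable_iff_integrableOn_Ioo_of_le zero_le_one] at e
    exact e
  · exact (ae_restrict_mem measurableSet_Ioo).mono h

theorem isProbabilityMeasure_discLaw {b : ℝ} (hb : 0 < b) :
    IsProbabilityMeasure (discLaw b) := by
  constructor
  have h := lintegral_discLaw_norm_sq hb (f := fun _ => 1) measurable_const
  have h2 := lintegral_one_sub_rpow_combination hb b 0 0 (fun t ht => by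
    have : (0 : ℝ) < 1 - t := by linarith [ht.2]
    positivity)
  simp only [mul_one, zero_mul, add_zero, zero_div, div_self hb.ne', ENNReal.ofReal_one] at h h2
  rw [← lintegral_one, h, h2]

theorem lintegral_discLaw_sq {b : ℝ} (hb : 0 < b) :
    ∫⁻ g, ENNReal.ofReal (‖g‖ ^ 2) ∂discLaw b = ENNReal.ofReal (1 / (b + 1)) := by
  rw [lintegral_discLaw_norm_sq hb (f := ENNReal.ofReal) ENNReal.measurable_ofReal]
  have hpt : ∀ t ∈ Set.Ioo (0 : ℝ) 1, b * (1 - t) ^ (b - 1) * t =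
      b * (1 - t) ^ (b - 1) + -b * (1 - t) ^ b + 0 * (1 - t) ^ (b + 1) := fun t ht => by
    have h1 : (0 : ℝ) < 1 - t := by linarith [ht.2]
    rw [Real.rpow_sub_one h1.ne']
    field_simp
    ring
  have hpos : ∀ t ∈ Set.Ioo (0 : ℝ) 1, 0 ≤ b * (1 - t) ^ (b - 1) := fun t ht => by
    have h1 : (0 : ℝ) < 1 - t := by linarith [ht.2]
    positivity
  have h := lintegral_one_sub_rpow_combination hb b (-b) 0 (fun t ht => by
    rw [← hpt t ht]; exact mul_nonneg (hpos t ht) ht.1.le)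
  rw [show 1 / (b + 1) = b / b + -b / (b + 1) + 0 / (b + 2) by field_simp; ring, ← h]
  refine setLIntegral_congr_fun measurableSet_Ioo fun t ht => ?_
  rw [← hpt t ht, ENNReal.ofReal_mul (hpos t ht)]

theorem lintegral_discLaw_pow_four {b : ℝ} (hb : 0 < b) :
    ∫⁻ g, ENNReal.ofReal (‖g‖ ^ 4) ∂discLaw b = ENNReal.ofReal (2 / ((b + 1) * (b + 2))) := by
  have h0 := lintegral_discLaw_norm_sq hb (f := fun t => ENNReal.ofReal (t ^ 2)) (by fun_prop)
  simp only [← pow_mul] at h0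
  rw [h0]
  have hpt : ∀ t ∈ Set.Ioo (0 : ℝ) 1, b * (1 - t) ^ (b - 1) * t ^ 2 =
      b * (1 - t) ^ (b - 1) + -(2 * b) * (1 - t) ^ b + b * (1 - t) ^ (b + 1) := fun t ht => by
    have h1 : (0 : ℝ) < 1 - t := by linarith [ht.2]
    rw [Real.rpow_sub_one h1.ne', Real.rpow_add_one h1.ne']
    field_simp
    ring
  have hpos : ∀ t ∈ Set.Ioo (0 : ℝ) 1, 0 ≤ b * (1 - t) ^ (b - 1) := fun t ht => by
    have h1 : (0 : ℝ) < 1 - t := by linarith [ht.2]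
    positivity
  have h := lintegral_one_sub_rpow_combination hb b (-(2 * b)) b (fun t ht => by
    rw [← hpt t ht]; exact mul_nonneg (hpos t ht) (by positivity))
  rw [show 2 / ((b + 1) * (b + 2)) = b / b + -(2 * b) / (b + 1) + b / (b + 2) by
    field_simp; ring, ← h]
  refine setLIntegral_congr_fun measurableSet_Ioo fun t ht => ?_
  rw [← hpt t ht, ENNReal.ofReal_mul (hpos t ht)]

theorem norm_twist {g : ℂ} (hg : ‖g‖ < 1) : ‖twist g‖ = 1 := by
  have h1 : 1 - g ≠ 0 := fun h => by rw [← sub_eq_zero.1 h] at hg; simp at hg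
  have h2 : 1 - starRingEnd ℂ g = starRingEnd ℂ (1 - g) := by simp
  rw [twist, h2, norm_div, RCLike.norm_conj, div_self (norm_ne_zero_iff.2 h1)]

/-- Under the uniform law of the endpoint phase, the disc parameter may be rotated freely. -/
theorem lintegral_phaseStep {b : ℝ} (hb : 0 < b) (θ ψ : ℝ) {H : ℝ × ℂ → ENNReal}
    (hH : Measurable H) :
    ∫⁻ ζ, ∫⁻ g, H (phaseStep θ (ψ, ζ) g) ∂discLaw b ∂circleLaw =
      ∫⁻ g, ∫⁻ ζ, H (θ + ψ + phaseIncr ψ g, ζ) ∂circleLaw ∂discLaw b := by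
  have := isProbabilityMeasure_discLaw hb
  have hconj := Complex.continuous_conj.measurable
  have htw := measurable_twist
  have hincr : Measurable fun γ : ℂ => phaseIncr ψ γ :=
    measurable_phaseIncr.of_uncurry_left (f := phaseIncr)
  have hL : Measurable fun p : ℂ × ℂ => H (θ + ψ + phaseIncr ψ p.1, twist p.1 * p.2) := by
    refine hH.comp (Measurable.prodMk ?_ ((htw.comp measurable_fst).mul measurable_snd))
    exact (hincr.comp measurable_fst).const_add _
  set L : ℂ → ℂ → ENNReal := fun γ W => H (θ + ψ + phaseIncr ψ γ, twist γ * W) with hLdef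
  have hK : Measurable fun p : ℂ × ℂ => L (-(starRingEnd ℂ p.2) * p.1) p.2 := by
    have h := hL.comp (((hconj.comp measurable_snd).neg.mul measurable_fst).prodMk
      measurable_snd : Measurable fun p : ℂ × ℂ => (-(starRingEnd ℂ p.2) * p.1, p.2))
    exact h
  have hstep : ∀ ζ g, H (phaseStep θ (ψ, ζ) g) =
      L (-(starRingEnd ℂ (twist g * ζ)) * g) (twist g * ζ) := fun ζ g => by
    simp only [hLdef, phaseStep, rotParam, neg_mul]
  have hm1 : Measurable fun p : ℂ × ℂ => H (phaseStep θ (ψ, p.1) p.2) := by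
    have h := hH.comp ((measurable_phaseStep θ).comp
      ((measurable_const.prodMk measurable_fst).prodMk measurable_snd :
        Measurable fun p : ℂ × ℂ => (((ψ : ℝ), p.1), p.2)))
    exact h
  calc ∫⁻ ζ, ∫⁻ g, H (phaseStep θ (ψ, ζ) g) ∂discLaw b ∂circleLaw
      = ∫⁻ g, ∫⁻ ζ, H (phaseStep θ (ψ, ζ) g) ∂circleLaw ∂discLaw b :=
        lintegral_lintegral_swap hm1.aemeasurable
    _ = ∫⁻ g, ∫⁻ W, L (-(starRingEnd ℂ W) * g) W ∂circleLaw ∂discLaw b := by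
        refine lintegral_congr_ae ?_
        filter_upwards [ae_discLaw_norm_lt_one b] with g hg
        simp only [hstep]
        exact lintegral_circleLaw_mul (f := fun W => L (-(starRingEnd ℂ W) * g) W)
          (hK.of_uncurry_left (f := fun g W => L (-(starRingEnd ℂ W) * g) W)) (norm_twist hg)
    _ = ∫⁻ W, ∫⁻ g, L (-(starRingEnd ℂ W) * g) W ∂discLaw b ∂circleLaw :=
        lintegral_lintegral_swap hK.aemeasurable
    _ = ∫⁻ W, ∫⁻ γ, L γ W ∂discLaw b ∂circleLaw := by
        refine lintegral_congr_ae ?_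
        filter_upwards [ae_circleLaw_norm_eq_one] with W hW
        exact lintegral_discLaw_mul b (f := fun γ => L γ W)
          (hL.of_uncurry_right (f := L)) (by simpa using hW)
    _ = ∫⁻ γ, ∫⁻ W, L γ W ∂circleLaw ∂discLaw b :=
        (lintegral_lintegral_swap hL.aemeasurable).symm
    _ = ∫⁻ g, ∫⁻ ζ, H (θ + ψ + phaseIncr ψ g, ζ) ∂circleLaw ∂discLaw b := by
        refine lintegral_congr_ae ?_
        filter_upwards [ae_discLaw_norm_lt_one b] with γ hγ
        exact lintegral_circleLaw_mul (f := fun W => H (θ + ψ + phaseIncr ψ γ, W))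
          (hH.comp (measurable_const.prodMk measurable_id)) (norm_twist hγ)

theorem hasDerivAt_phase (v : ℝ) : HasDerivAt phase (-(2 / (1 + v ^ 2))) v := by
  have h := ((Real.hasDerivAt_arctan v).const_mul 2).const_sub Real.pi
  have e : -(2 / (1 + v ^ 2)) = -(2 * (1 / (1 + v ^ 2))) := by ring
  rw [e]
  exact h

theorem range_phase : phase '' Set.univ = Set.Ioo 0 (2 * Real.pi) := by
  ext t
  constructor
  · rintro ⟨v, -, rfl⟩
    exact ⟨phase_pos v, phase_lt v⟩
  · rintro ⟨h0, h1⟩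
    refine ⟨Real.tan ((Real.pi - t) / 2), trivial, ?_⟩
    rw [phase, Real.arctan_tan (by linarith) (by linarith)]
    ring

theorem lintegral_comp_phase (f : ℝ → ENNReal) :
    ∫⁻ t in Set.Ioo 0 (2 * Real.pi), f t =
      ∫⁻ v, ENNReal.ofReal (2 / (1 + v ^ 2)) * f (phase v) := by
  rw [← range_phase, lintegral_image_eq_lintegral_abs_deriv_mul MeasurableSet.univ
    (fun v _ => (hasDerivAt_phase v).hasDerivWithinAt) phase_strictAnti.injective.injOn,
    Measure.restrict_univ]
  refine lintegral_congr fun v => ?_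
  rw [abs_neg, abs_of_pos (by positivity)]

/-- The law of the Prüfer phase at level `n`, started from the angle `θ`. -/
def phaseLaw (θ a : ℝ) : ℕ → Measure ℝ
  | 0 => Measure.dirac θ
  | n + 1 => ((phaseLaw θ a n).prod (discLaw (a * (n + 1)))).map
      fun p => θ + p.1 + phaseIncr p.1 p.2

theorem isProbabilityMeasure_phaseLaw (θ : ℝ) {a : ℝ} (ha : 0 < a) (n : ℕ) :
    IsProbabilityMeasure (phaseLaw θ a n) := by
  induction n with
  | zero => rw [phaseLaw]; infer_instance
  | succ n ih =>
    have := isProbabilityMeasure_discLaw (b := a * (n + 1)) (by positivity)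
    exact Measure.isProbabilityMeasure_map
      ((measurable_fst.const_add θ).add measurable_phaseIncr).aemeasurable

theorem lintegral_phaseLaw_succ (θ : ℝ) {a : ℝ} (ha : 0 < a) (n : ℕ) {f : ℝ → ENNReal}
    (hf : Measurable f) :
    ∫⁻ ψ, f ψ ∂phaseLaw θ a (n + 1) =
      ∫⁻ ψ, ∫⁻ g, f (θ + ψ + phaseIncr ψ g) ∂discLaw (a * (n + 1)) ∂phaseLaw θ a n := by
  have := isProbabilityMeasure_discLaw (b := a * (n + 1)) (by positivity)
  have := isProbabilityMeasure_phaseLaw θ ha n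
  have hm : Measurable fun p : ℝ × ℂ => θ + p.1 + phaseIncr p.1 p.2 :=
    (measurable_fst.const_add θ).add measurable_phaseIncr
  rw [phaseLaw, lintegral_map hf hm]
  have h := hf.comp hm
  exact lintegral_prod (fun p : ℝ × ℂ => f (θ + p.1 + phaseIncr p.1 p.2)) h.aemeasurable

/-- The total mass of the pair density. -/
def pairMass (a : ℝ) (n : ℕ) : ℝ :=
  Real.pi * ∏ k ∈ Finset.range n, Real.pi / (a * (k + 1) * 4 ^ (a * (k + 1)))

theorem pairMass_pos {a : ℝ} (ha : 0 < a) (n : ℕ) : 0 < pairMass a n :=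
  mul_pos Real.pi_pos (Finset.prod_pos fun k _ => div_pos Real.pi_pos (by positivity))

theorem relPhase_fin_one {u : ℝ} {y : Fin 1 → ℝ} (x : Fin 0 → ℝ) (h : u ≠ y 0) :
    relPhase u y x = phase u := by
  have h' : u - y 0 ≠ 0 := sub_ne_zero.2 h
  have h1 := phase_add_phase (u := u) (w := -y 0) (by simpa [← sub_eq_add_neg] using h')
  have h2 : startDrift u y x = (u * -y 0 - 1) / (u + -y 0) := by
    have e : ∏ i : Fin (0 + 1), (u - y i) = u - y 0 := Fin.prod_univ_one _
    rw [startDrift, e, Fin.prod_univ_zero, ← sub_eq_add_neg]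
    field_simp
    ring
  have h3 : endDrift y x = -y 0 := by simp [endDrift]
  have h4 : ((countAbove u y : ℕ) : ℝ) * (2 * Real.pi) =
      if u + -y 0 < 0 then 2 * Real.pi else 0 := by
    simp only [countAbove, Finset.univ_unique, Finset.sum_singleton, Fin.default_eq_zero]
    by_cases hlt : u < y 0
    · rw [if_pos hlt, if_pos (by linarith)]; simp
    · rw [if_neg hlt, if_neg (by linarith)]; simp
  rw [relPhase, h2, h3]
  linarith

theorem lintegral_pair_zero (a u : ℝ) {H : ℝ × ℂ → ENNReal} (hH : Measurable H) :
    ∫⁻ y : Fin 1 → ℝ, ∫⁻ x in {x | Interlaces y x},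
        ENNReal.ofReal (pairDensity a y x) * H (relPhase u y x, endPhase y x) =
      ENNReal.ofReal Real.pi * ∫⁻ ζ, H (phase u, ζ) ∂circleLaw := by
  have hf : Measurable fun ζ => H (phase u, ζ) := hH.comp (measurable_const.prodMk measurable_id)
  set f : ℝ → ENNReal := fun t => H (phase u, Complex.exp (t * Complex.I)) with hfdef
  have hfm : Measurable f := hf.comp (by fun_prop)
  have h1 : ∀ y : Fin 1 → ℝ, u ≠ y 0 → ∫⁻ x in {x | Interlaces y x},
        ENNReal.ofReal (pairDensity a y x) * H (relPhase u y x, endPhase y x) =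
      ENNReal.ofReal (1 / (1 + y 0 ^ 2)) * f (phase (-y 0)) := by
    intro y hy
    have hset : {x : Fin 0 → ℝ | Interlaces y x} = Set.univ :=
      Set.eq_univ_of_forall fun x i => i.elim0
    rw [hset, Measure.restrict_univ, lintegral_unique]
    rw [Measure.volume_pi_eq_dirac 0, measure_univ, mul_one, relPhase_fin_one _ hy]
    have : pairDensity a (n := 0) y default = 1 / (1 + y 0 ^ 2) := by
      simp [pairDensity, absVand, absRes, Real.rpow_neg_one]
    erw [this]
    simp [hfdef, endPhase, endDrift]
  have h2 : ∀ᵐ y : Fin 1 → ℝ, u ≠ y 0 := by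
    filter_upwards [ae_forall_ne u] with y hy using hy 0
  have h2' : ∫⁻ y : Fin 1 → ℝ, ENNReal.ofReal (1 / (1 + y 0 ^ 2)) * f (phase (-y 0)) =
      ∫⁻ v : ℝ, ENNReal.ofReal (1 / (1 + v ^ 2)) * f (phase (-v)) := by
    exact (volume_preserving_funUnique (Fin 1) ℝ).lintegral_comp_emb
      (MeasurableEquiv.measurableEmbedding _)
      (fun v : ℝ => ENNReal.ofReal (1 / (1 + v ^ 2)) * f (phase (-v)))
  rw [lintegral_congr_ae (h2.mono h1), h2']
  have h3 : ∫⁻ v : ℝ, ENNReal.ofReal (1 / (1 + v ^ 2)) * f (phase (-v)) =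
      ∫⁻ v : ℝ, ENNReal.ofReal (1 / (1 + v ^ 2)) * f (phase v) := by
    have := lintegral_sub_left_eq_self (μ := (volume : Measure ℝ))
      (fun v : ℝ => ENNReal.ofReal (1 / (1 + v ^ 2)) * f (phase v)) 0
    simpa using this
  have h4 : ∫⁻ v : ℝ, ENNReal.ofReal (1 / (1 + v ^ 2)) * f (phase v) =
      ENNReal.ofReal (1 / 2) * ∫⁻ t in Set.Ioo 0 (2 * Real.pi), f t := by
    rw [lintegral_comp_phase, ← lintegral_const_mul' _ _ ENNReal.ofReal_ne_top]
    refine lintegral_congr fun v => ?_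
    rw [← mul_assoc, ← ENNReal.ofReal_mul (by norm_num)]
    congr 2
    ring
  have h5 : ∫⁻ t in Set.Ioo 0 (2 * Real.pi), f t =
      ENNReal.ofReal (2 * Real.pi) * ∫⁻ s in Set.Ioo (0 : ℝ) 1, f (2 * Real.pi * s) := by
    have himg : (fun s : ℝ => 2 * Real.pi * s) '' Set.Ioo 0 1 = Set.Ioo 0 (2 * Real.pi) := by
      rw [Set.image_mul_left_Ioo Real.two_pi_pos]; simp
    rw [← himg, lintegral_image_eq_lintegral_abs_deriv_mul (f' := fun _ => 2 * Real.pi)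
      measurableSet_Ioo (fun s _ => by
        simpa using ((hasDerivAt_id s).const_mul (2 * Real.pi)).hasDerivWithinAt)
      (mul_right_injective₀ Real.two_pi_pos.ne').injOn,
      abs_of_pos Real.two_pi_pos, lintegral_const_mul' _ _ ENNReal.ofReal_ne_top]
  rw [h3, h4, h5, ← mul_assoc, ← ENNReal.ofReal_mul (by norm_num), lintegral_circleLaw hf,
    restrict_Ioo_eq_restrict_Ioc]
  congr 2
  ring

theorem lintegral_pair {a : ℝ} (ha : 0 < a) (u : ℝ) (n : ℕ) {H : ℝ × ℂ → ENNReal}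
    (hH : Measurable H) :
    ∫⁻ y : Fin (n + 1) → ℝ, ∫⁻ x in {x | Interlaces y x},
        ENNReal.ofReal (pairDensity a y x) * H (relPhase u y x, endPhase y x) =
      ENNReal.ofReal (pairMass a n) *
        ∫⁻ ψ, ∫⁻ ζ, H (ψ, ζ) ∂circleLaw ∂phaseLaw (phase u) a n := by
  induction n generalizing H with
  | zero =>
    have hm : Measurable fun ψ => ∫⁻ ζ, H (ψ, ζ) ∂circleLaw := hH.lintegral_prod_right'
    rw [lintegral_pair_zero a u hH, phaseLaw, lintegral_dirac' _ hm]
    simp [pairMass]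
  | succ n ih =>
    have hb : 0 < a * ((n : ℝ) + 1) := by positivity
    have := isProbabilityMeasure_discLaw hb
    have hm : Measurable fun p => ∫⁻ g, H (phaseStep (phase u) p g) ∂discLaw (a * (n + 1)) := by
      have h := hH.comp (measurable_phaseStep (phase u))
      exact h.lintegral_prod_right'
    have hm' : Measurable fun ψ => ∫⁻ ζ, H (ψ, ζ) ∂circleLaw := hH.lintegral_prod_right'
    rw [lintegral_pair_step ha u hH, ih hm, ← mul_assoc,
      ← ENNReal.ofReal_mul (by positivity)]
    have hmass : Real.pi / (a * (n + 1) * 4 ^ (a * ((n : ℝ) + 1))) * pairMass a n =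
        pairMass a (n + 1) := by
      rw [pairMass, pairMass, Finset.prod_range_succ]; ring
    rw [hmass, lintegral_phaseLaw_succ (phase u) ha n hm']
    congr 1
    refine lintegral_congr fun ψ => ?_
    rw [lintegral_phaseStep hb (phase u) ψ hH]

/-- The argument of a complex number in turns, in `[0, 1)`. -/
def turn (ζ : ℂ) : ℝ := Int.fract (Complex.arg ζ / (2 * Real.pi))

theorem measurable_turn : Measurable turn :=
  (Complex.measurable_arg.div_const _).fract

theorem turn_exp {s : ℝ} (h0 : 0 ≤ s) (h1 : s < 1) :
    turn (Complex.exp ((2 * Real.pi * s : ℝ) * Complex.I)) = s := by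
  rw [turn, Complex.arg_exp_mul_I, toIocMod]
  have : (2 * Real.pi * s - toIocDiv Real.two_pi_pos (-Real.pi) (2 * Real.pi * s) •
      (2 * Real.pi)) / (2 * Real.pi) =
      s - (toIocDiv Real.two_pi_pos (-Real.pi) (2 * Real.pi * s) : ℤ) := by
    rw [zsmul_eq_mul]
    field_simp
  rw [this, Int.fract_sub_intCast, Int.fract_eq_self.2 ⟨h0, h1⟩]

theorem countAbove_eq_floor {n : ℕ} (u : ℝ) (y : Fin (n + 1) → ℝ) (x : Fin n → ℝ) :
    (countAbove u y : ℤ) = ⌊relPhase u y x / (2 * Real.pi) + turn (endPhase y x)⌋ := by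
  have hp := Real.two_pi_pos
  have h1 := phase_pos (endDrift y x)
  have h2 := phase_lt (endDrift y x)
  have h3 := phase_pos (startDrift u y x)
  have h4 := phase_lt (startDrift u y x)
  have ht : turn (endPhase y x) = phase (endDrift y x) / (2 * Real.pi) := by
    rw [← turn_exp (s := phase (endDrift y x) / (2 * Real.pi)) (by positivity)
      ((div_lt_one hp).2 h2), mul_div_cancel₀ _ hp.ne', endPhase]
  rw [eq_comm, Int.floor_eq_iff, ht, ← add_div, relPhase, sub_add_cancel, add_div,
    mul_div_cancel_left₀ _ hp.ne']
  have h5 : 0 < phase (startDrift u y x) / (2 * Real.pi) := by positivity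
  have h6 : phase (startDrift u y x) / (2 * Real.pi) < 1 := (div_lt_one hp).2 h4
  push_cast
  constructor <;> linarith

theorem lintegral_floor_add_turn (p m : ℝ) :
    ∫⁻ ζ, ENNReal.ofReal ((⌊p + turn ζ⌋ - m) ^ 2) ∂circleLaw =
      ENNReal.ofReal ((p - m) ^ 2 + Int.fract p * (1 - Int.fract p)) := by
  have hmeas : Measurable fun ζ => ENNReal.ofReal (((⌊p + turn ζ⌋ : ℤ) - m : ℝ) ^ 2) := by
    have h : Measurable fun ζ => ((⌊p + turn ζ⌋ : ℤ) : ℝ) :=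
      measurable_from_top.comp (measurable_turn.const_add p).floor
    exact ((h.sub_const m).pow_const 2).ennreal_ofReal
  rw [lintegral_circleLaw hmeas, ← restrict_Ioo_eq_restrict_Ioc]
  set f := Int.fract p with hf
  have hf0 : 0 ≤ f := Int.fract_nonneg p
  have hf1 : f < 1 := Int.fract_lt_one p
  have hp : p = ⌊p⌋ + f := (Int.floor_add_fract p).symm
  have hA : ∀ s ∈ Set.Ioo 0 (1 - f),
      ENNReal.ofReal (((⌊p + turn (Complex.exp ((2 * Real.pi * s : ℝ) * Complex.I))⌋ : ℤ)
        - m : ℝ) ^ 2) = ENNReal.ofReal ((⌊p⌋ - m) ^ 2) := by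
    intro s hs
    rw [turn_exp hs.1.le (by linarith [hs.2])]
    have : ⌊p + s⌋ = ⌊p⌋ := Int.floor_eq_iff.2 ⟨by linarith [hs.1], by linarith [hs.2]⟩
    rw [this]
  have hB : ∀ s ∈ Set.Ico (1 - f) 1,
      ENNReal.ofReal (((⌊p + turn (Complex.exp ((2 * Real.pi * s : ℝ) * Complex.I))⌋ : ℤ)
        - m : ℝ) ^ 2) = ENNReal.ofReal ((⌊p⌋ + 1 - m) ^ 2) := by
    intro s hs
    rw [turn_exp (by linarith [hs.1]) hs.2]
    have : ⌊p + s⌋ = ⌊p⌋ + 1 := Int.floor_eq_iff.2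
      ⟨by push_cast; linarith [hs.1], by push_cast; linarith [hs.2]⟩
    rw [this]
    push_cast
    ring_nf
  have hU : Set.Ioo 0 (1 - f) ∪ Set.Ico (1 - f) 1 = Set.Ioo (0 : ℝ) 1 :=
    Set.Ioo_union_Ico_eq_Ioo (by linarith) (by linarith)
  rw [← hU, lintegral_union measurableSet_Ico
    (Set.disjoint_left.2 fun s hs hs' => absurd hs.2 (not_lt.2 hs'.1)),
    setLIntegral_congr_fun measurableSet_Ioo hA, setLIntegral_congr_fun measurableSet_Ico hB,
    setLIntegral_const, setLIntegral_const, Real.volume_Ioo, Real.volume_Ico,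
    ← ENNReal.ofReal_mul (by positivity), ← ENNReal.ofReal_mul (by positivity),
    ← ENNReal.ofReal_add (mul_nonneg (by positivity) (by linarith))
      (mul_nonneg (by positivity) (by linarith))]
  congr 1
  rw [hp, Int.floor_intCast_add, Int.floor_eq_zero_iff.2 ⟨hf0, hf1⟩]
  push_cast
  ring

theorem lintegral_pair_countAbove {a : ℝ} (ha : 0 < a) (u m : ℝ) (n : ℕ) :
    ∫⁻ y : Fin (n + 1) → ℝ, ∫⁻ x in {x | Interlaces y x},
        ENNReal.ofReal (pairDensity a y x) * ENNReal.ofReal ((countAbove u y - m) ^ 2) =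
      ENNReal.ofReal (pairMass a n) *
        ∫⁻ ψ, ENNReal.ofReal ((ψ / (2 * Real.pi) - m) ^ 2 + Int.fract (ψ / (2 * Real.pi)) *
          (1 - Int.fract (ψ / (2 * Real.pi)))) ∂phaseLaw (phase u) a n := by
  have hH : Measurable fun p : ℝ × ℂ =>
      ENNReal.ofReal (((⌊p.1 / (2 * Real.pi) + turn p.2⌋ : ℤ) - m : ℝ) ^ 2) := by
    have h : Measurable fun p : ℝ × ℂ => ((⌊p.1 / (2 * Real.pi) + turn p.2⌋ : ℤ) : ℝ) :=
      measurable_from_top.comp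
        ((measurable_fst.div_const _).add (measurable_turn.comp measurable_snd)).floor
    exact ((h.sub_const m).pow_const 2).ennreal_ofReal
  have h := lintegral_pair ha u n hH
  simp only [lintegral_floor_add_turn] at h
  rw [← h]
  refine lintegral_congr fun y => lintegral_congr fun x => ?_
  rw [← countAbove_eq_floor, Int.cast_natCast]

theorem integral_discLaw_mul (b : ℝ) {f : ℂ → ℝ} (hf : Measurable f) {c : ℂ} (hc : ‖c‖ = 1) :
    ∫ g, f (c * g) ∂discLaw b = ∫ g, f g ∂discLaw b := by
  have hmap : (discLaw b).map (fun g => c * g) = discLaw b := by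
    refine Measure.ext_of_lintegral _ fun F hF => ?_
    rw [lintegral_map hF (measurable_const_mul c), lintegral_discLaw_mul b hF hc]
  conv_rhs => rw [← hmap]
  rw [integral_map (measurable_const_mul c).aemeasurable hf.aestronglyMeasurable]

theorem integrable_discLaw_of_bound {b : ℝ} (hb : 0 < b) {f : ℂ → ℝ} (hf : Measurable f) (C : ℝ)
    (h : ∀ g : ℂ, ‖g‖ < 1 → |f g| ≤ C) : Integrable f (discLaw b) := by
  have := isProbabilityMeasure_discLaw hb
  refine Integrable.of_bound hf.aestronglyMeasurable C ?_
  filter_upwards [ae_discLaw_norm_lt_one b] with g hg using h g hg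

theorem integral_discLaw_sq {b : ℝ} (hb : 0 < b) :
    ∫ g, ‖g‖ ^ 2 ∂discLaw b = 1 / (b + 1) := by
  rw [integral_eq_lintegral_of_nonneg_ae (ae_of_all _ fun g => by positivity)
    (by fun_prop), lintegral_discLaw_sq hb, ENNReal.toReal_ofReal (by positivity)]

theorem integral_discLaw_pow_four {b : ℝ} (hb : 0 < b) :
    ∫ g, ‖g‖ ^ 4 ∂discLaw b = 2 / ((b + 1) * (b + 2)) := by
  rw [integral_eq_lintegral_of_nonneg_ae (ae_of_all _ fun g => by positivity)
    (by fun_prop), lintegral_discLaw_pow_four hb, ENNReal.toReal_ofReal (by positivity)]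

theorem integrable_discLaw_norm_pow {b : ℝ} (hb : 0 < b) (k : ℕ) :
    Integrable (fun g : ℂ => ‖g‖ ^ k) (discLaw b) :=
  integrable_discLaw_of_bound hb (by fun_prop) 1 fun g hg => by
    rw [abs_of_nonneg (by positivity)]
    exact pow_le_one₀ (norm_nonneg _) hg.le

theorem integral_discLaw_pow_three_le {b : ℝ} (hb : 0 < b) :
    ∫ g, ‖g‖ ^ 3 ∂discLaw b ≤ 2 / ((b + 1) * √(b + 1)) := by
  set s := √(b + 1) with hs
  have hs0 : 0 < s := Real.sqrt_pos.2 (by linarith)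
  have hss : s ^ 2 = b + 1 := Real.sq_sqrt (by linarith)
  have h1 : ∫ g, ‖g‖ ^ 3 ∂discLaw b ≤ ∫ g, (1 / s / 2 * ‖g‖ ^ 2 + s / 2 * ‖g‖ ^ 4) ∂discLaw b := by
    refine integral_mono (integrable_discLaw_norm_pow hb 3)
      (((integrable_discLaw_norm_pow hb 2).const_mul _).add
        ((integrable_discLaw_norm_pow hb 4).const_mul _)) fun g => ?_
    have : 0 ≤ ‖g‖ ^ 2 * (1 - s * ‖g‖) ^ 2 / (2 * s) := by positivity
    have e : 1 / s / 2 * ‖g‖ ^ 2 + s / 2 * ‖g‖ ^ 4 =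
        ‖g‖ ^ 3 + ‖g‖ ^ 2 * (1 - s * ‖g‖) ^ 2 / (2 * s) := by
      field_simp
      ring
    simp only [e]
    linarith
  rw [integral_add ((integrable_discLaw_norm_pow hb 2).const_mul _)
    ((integrable_discLaw_norm_pow hb 4).const_mul _), integral_const_mul, integral_const_mul,
    integral_discLaw_sq hb, integral_discLaw_pow_four hb] at h1
  refine h1.trans ?_
  have h2 : 2 / ((b + 1) * (b + 2)) ≤ 2 / ((b + 1) * (b + 1)) := by gcongr; linarith
  have h3 : s / 2 * (2 / ((b + 1) * (b + 2))) ≤ s / 2 * (2 / ((b + 1) * (b + 1))) := by gcongr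
  have e : 1 / s / 2 * (1 / (b + 1)) + s / 2 * (2 / ((b + 1) * (b + 1))) =
      3 / 2 / ((b + 1) * s) := by
    rw [← hss]
    field_simp
    ring
  have h4 : 3 / 2 / ((b + 1) * s) ≤ 2 / ((b + 1) * s) := by gcongr; norm_num
  linarith

theorem abs_arg_one_sub_add_im_le {w : ℂ} (hw : ‖w‖ < 1) :
    |Complex.arg (1 - w) + w.im| ≤ 12 * ‖w‖ ^ 2 := by
  by_cases h : ‖w‖ ≤ 1 / 2
  · have h1 := Complex.norm_log_one_add_sub_self_le (z := -w) (by simpa using hw)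
    rw [norm_neg, ← sub_eq_add_neg] at h1
    have h2 := (Complex.abs_im_le_norm (Complex.log (1 - w) - -w)).trans h1
    rw [sub_neg_eq_add, Complex.add_im, Complex.log_im] at h2
    refine h2.trans ?_
    have h3 : (1 - ‖w‖)⁻¹ ≤ 2 := by
      rw [inv_le_comm₀ (by linarith) (by norm_num)]; linarith
    have h4 : ‖w‖ ^ 2 * (1 - ‖w‖)⁻¹ ≤ ‖w‖ ^ 2 * 2 := by gcongr
    nlinarith [sq_nonneg ‖w‖]
  · have h1 := abs_arg_one_sub_lt hw
    have h2 := Complex.abs_im_le_norm w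
    have h3 := abs_add_le (Complex.arg (1 - w)) w.im
    have h4 := Real.pi_lt_four
    nlinarith

/-- The part of `phaseIncr` linear in the second variable. -/
def phaseIncrLin (ψ : ℝ) (γ : ℂ) : ℝ :=
  2 * (starRingEnd ℂ γ * (Complex.exp (ψ * Complex.I) - 1)).im

theorem measurable_phaseIncrLin (ψ : ℝ) : Measurable (phaseIncrLin ψ) := by
  have := Complex.continuous_conj.measurable
  unfold phaseIncrLin
  fun_prop

theorem measurable_phaseIncr_right (ψ : ℝ) : Measurable (phaseIncr ψ) :=
  measurable_phaseIncr.of_uncurry_left (f := phaseIncr)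

theorem abs_phaseIncr_sub_lin_le (ψ : ℝ) {γ : ℂ} (hγ : ‖γ‖ < 1) :
    |phaseIncr ψ γ - phaseIncrLin ψ γ| ≤ 48 * ‖γ‖ ^ 2 := by
  have n1 : ‖starRingEnd ℂ γ‖ = ‖γ‖ := RCLike.norm_conj _
  have n2 : ‖starRingEnd ℂ γ * Complex.exp (ψ * Complex.I)‖ = ‖γ‖ := by
    rw [norm_mul, n1, Complex.norm_exp_ofReal_mul_I, mul_one]
  have h1 := abs_arg_one_sub_add_im_le (w := starRingEnd ℂ γ) (by rwa [n1])
  have h2 := abs_arg_one_sub_add_im_le (w := starRingEnd ℂ γ * Complex.exp (ψ * Complex.I))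
    (by rwa [n2])
  rw [n1] at h1
  rw [n2] at h2
  rw [phaseIncr, phaseIncrLin, mul_sub, mul_one, Complex.sub_im]
  rw [abs_le] at *
  constructor <;> linarith [h1.1, h1.2, h2.1, h2.2]

theorem abs_phaseIncrLin_le (ψ : ℝ) (γ : ℂ) : |phaseIncrLin ψ γ| ≤ 4 * ‖γ‖ := by
  rw [phaseIncrLin, abs_mul, abs_two]
  have h1 := Complex.abs_im_le_norm (starRingEnd ℂ γ * (Complex.exp (ψ * Complex.I) - 1))
  rw [norm_mul, RCLike.norm_conj] at h1
  have h2 : ‖Complex.exp (ψ * Complex.I) - 1‖ ≤ 2 := by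
    refine (norm_sub_le _ _).trans ?_
    rw [Complex.norm_exp_ofReal_mul_I, norm_one]; norm_num
  nlinarith [norm_nonneg γ]

theorem abs_phaseIncr_le (ψ : ℝ) {γ : ℂ} (hγ : ‖γ‖ < 1) : |phaseIncr ψ γ| ≤ 52 * ‖γ‖ := by
  have h1 := abs_phaseIncr_sub_lin_le ψ hγ
  have h2 := abs_phaseIncrLin_le ψ γ
  have h3 : ‖γ‖ ^ 2 ≤ ‖γ‖ := by nlinarith [norm_nonneg γ]
  have h4 := abs_add_le (phaseIncr ψ γ - phaseIncrLin ψ γ) (phaseIncrLin ψ γ)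
  rw [sub_add_cancel] at h4
  linarith

theorem abs_phaseIncr_sq_sub_le (ψ : ℝ) {γ : ℂ} (hγ : ‖γ‖ < 1) :
    |phaseIncr ψ γ ^ 2 - phaseIncrLin ψ γ ^ 2| ≤ 2688 * ‖γ‖ ^ 3 := by
  have h1 := abs_phaseIncr_sub_lin_le ψ hγ
  have h2 := abs_phaseIncrLin_le ψ γ
  have h3 := abs_phaseIncr_le ψ hγ
  have h4 := abs_add_le (phaseIncr ψ γ) (phaseIncrLin ψ γ)
  have h5 : |phaseIncr ψ γ + phaseIncrLin ψ γ| ≤ 56 * ‖γ‖ := by linarith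
  rw [sq_sub_sq, abs_mul]
  calc _ ≤ 56 * ‖γ‖ * (48 * ‖γ‖ ^ 2) := by gcongr
    _ = 2688 * ‖γ‖ ^ 3 := by ring

theorem integrable_phaseIncr {b : ℝ} (hb : 0 < b) (ψ : ℝ) :
    Integrable (phaseIncr ψ) (discLaw b) :=
  integrable_discLaw_of_bound hb (measurable_phaseIncr_right ψ) 52 fun g hg =>
    (abs_phaseIncr_le ψ hg).trans (by linarith)

theorem integrable_phaseIncr_sq {b : ℝ} (hb : 0 < b) (ψ : ℝ) :
    Integrable (fun g => phaseIncr ψ g ^ 2) (discLaw b) :=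
  integrable_discLaw_of_bound hb ((measurable_phaseIncr_right ψ).pow_const 2) (52 ^ 2)
    fun g hg => by
      rw [abs_pow]
      exact pow_le_pow_left₀ (abs_nonneg _) ((abs_phaseIncr_le ψ hg).trans (by linarith)) 2

theorem integral_phaseIncr {b : ℝ} (hb : 0 < b) (ψ : ℝ) :
    ∫ g, phaseIncr ψ g ∂discLaw b = 0 := by
  have hconj := Complex.continuous_conj.measurable
  set f : ℂ → ℝ := fun g => 2 * Complex.arg (1 - starRingEnd ℂ g) with hf
  have hfm : Measurable f :=
    (Complex.measurable_arg.comp (hconj.const_sub 1)).const_mul 2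
  have hbd : ∀ g : ℂ, ‖g‖ < 1 → |f g| ≤ Real.pi := fun g hg => by
    have := abs_arg_one_sub_lt (w := starRingEnd ℂ g) (by rwa [RCLike.norm_conj])
    rw [hf, abs_mul, abs_two]
    linarith
  set c := starRingEnd ℂ (Complex.exp (ψ * Complex.I)) with hc
  have hc1 : ‖c‖ = 1 := by rw [hc, RCLike.norm_conj, Complex.norm_exp_ofReal_mul_I]
  have e : ∀ g, phaseIncr ψ g = f g - f (c * g) := fun g => by
    simp only [phaseIncr, hf, map_mul, hc, Complex.conj_conj]
    rw [mul_comm (starRingEnd ℂ g)]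
  simp only [e]
  have hi : Integrable (fun g => f (c * g)) (discLaw b) :=
    integrable_discLaw_of_bound hb (hfm.comp (measurable_const_mul c)) _
      fun g hg => hbd _ (by rwa [norm_mul, hc1, one_mul])
  rw [integral_sub (integrable_discLaw_of_bound hb hfm _ hbd) hi, integral_discLaw_mul b hfm hc1,
    sub_self]

theorem integral_phaseIncrLin_sq {b : ℝ} (hb : 0 < b) (ψ : ℝ) :
    ∫ g, phaseIncrLin ψ g ^ 2 ∂discLaw b = 4 * (1 - Real.cos ψ) / (b + 1) := by
  have hm := (measurable_phaseIncrLin ψ).pow_const 2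
  have hbd : ∀ g : ℂ, ‖g‖ < 1 → |phaseIncrLin ψ g ^ 2| ≤ 4 ^ 2 := fun g hg => by
    rw [abs_pow]
    exact pow_le_pow_left₀ (abs_nonneg _) ((abs_phaseIncrLin_le ψ g).trans (by linarith)) 2
  have h1 := integral_discLaw_mul b hm Complex.norm_I
  have hi := integrable_discLaw_of_bound hb hm _ hbd
  have hi' := integrable_discLaw_of_bound hb (hm.comp (measurable_const_mul Complex.I)) (4 ^ 2)
    fun g hg => hbd _ (by rwa [norm_mul, Complex.norm_I, one_mul])
  have h2 : ∀ g : ℂ, phaseIncrLin ψ g ^ 2 + phaseIncrLin ψ (Complex.I * g) ^ 2 =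
      8 * (1 - Real.cos ψ) * ‖g‖ ^ 2 := fun g => by
    simp only [phaseIncrLin, Complex.sq_norm, Complex.normSq_apply, Complex.exp_mul_I,
      Complex.mul_im, Complex.mul_re, Complex.sub_im, Complex.sub_re, Complex.add_im,
      Complex.add_re, Complex.conj_re, Complex.conj_im, Complex.I_re, Complex.I_im,
      Complex.one_re, Complex.one_im, Complex.cos_ofReal_re, Complex.cos_ofReal_im,
      Complex.sin_ofReal_re, Complex.sin_ofReal_im]
    have := Real.sin_sq_add_cos_sq ψ
    linear_combination (4 * (g.re * g.re + g.im * g.im)) * this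
  have h3 := integral_add hi hi'
  simp only [Function.comp_apply, h2] at h3
  rw [integral_const_mul, integral_discLaw_sq hb, h1] at h3
  have : 8 * (1 - Real.cos ψ) * (1 / (b + 1)) = 2 * (4 * (1 - Real.cos ψ) / (b + 1)) := by ring
  linarith

theorem abs_integral_phaseIncr_sq_sub_le {b : ℝ} (hb : 0 < b) (ψ : ℝ) :
    |∫ g, phaseIncr ψ g ^ 2 ∂discLaw b - 4 * (1 - Real.cos ψ) / (b + 1)| ≤
      5376 / ((b + 1) * √(b + 1)) := by
  have hi := integrable_discLaw_of_bound hb ((measurable_phaseIncrLin ψ).pow_const 2) (4 ^ 2)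
    fun g hg => by
      rw [abs_pow]
      exact pow_le_pow_left₀ (abs_nonneg _) ((abs_phaseIncrLin_le ψ g).trans (by linarith)) 2
  rw [← integral_phaseIncrLin_sq hb, ← integral_sub (integrable_phaseIncr_sq hb ψ) hi]
  have h := norm_integral_le_of_norm_le (μ := discLaw b)
    (f := fun g => phaseIncr ψ g ^ 2 - phaseIncrLin ψ g ^ 2)
    ((integrable_discLaw_norm_pow hb 3).const_mul 2688)
    (by filter_upwards [ae_discLaw_norm_lt_one b] with g hg using abs_phaseIncr_sq_sub_le ψ hg)
  rw [Real.norm_eq_abs, integral_const_mul] at h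
  have h3 := integral_discLaw_pow_three_le hb
  calc _ ≤ _ := h
    _ ≤ 2688 * (2 / ((b + 1) * √(b + 1))) := by gcongr
    _ = _ := by ring

theorem norm_integral_exp_phaseIncr_sub_one_le {b : ℝ} (hb : 0 < b) (ψ : ℝ) :
    ‖∫ g, Complex.exp (phaseIncr ψ g * Complex.I) ∂discLaw b - 1‖ ≤ 5408 / (b + 1) := by
  have := isProbabilityMeasure_discLaw hb
  have hm : Measurable fun g => Complex.exp (phaseIncr ψ g * Complex.I) := by
    have := measurable_phaseIncr_right ψ
    fun_prop
  have hi : Integrable (fun g => Complex.exp (phaseIncr ψ g * Complex.I)) (discLaw b) :=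
    Integrable.of_bound hm.aestronglyMeasurable 1
      (ae_of_all _ fun g => (Complex.norm_exp_ofReal_mul_I _).le)
  have hi2 : Integrable (fun g => (phaseIncr ψ g : ℂ) * Complex.I) (discLaw b) :=
    (integrable_phaseIncr hb ψ).ofReal.mul_const _
  have e : ∫ g, Complex.exp (phaseIncr ψ g * Complex.I) ∂discLaw b - 1 =
      ∫ g, (Complex.exp (phaseIncr ψ g * Complex.I) - 1 - phaseIncr ψ g * Complex.I)
        ∂discLaw b := by
    have hi1 : Integrable (fun g => Complex.exp (phaseIncr ψ g * Complex.I) - 1) (discLaw b) :=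
      hi.sub (integrable_const 1)
    have hz : ∫ g, (phaseIncr ψ g : ℂ) ∂discLaw b = 0 := by
      have h := integral_ofReal (𝕜 := ℂ) (μ := discLaw b) (f := phaseIncr ψ)
      rwa [integral_phaseIncr hb] at h
    rw [integral_sub hi1 hi2, integral_sub hi (integrable_const _),
      integral_mul_const, hz]
    simp
  rw [e]
  have h := norm_integral_le_of_norm_le (μ := discLaw b)
    (f := fun g => Complex.exp (phaseIncr ψ g * Complex.I) - 1 - phaseIncr ψ g * Complex.I)
    ((integrable_discLaw_norm_pow hb 2).const_mul 5408) (by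
      filter_upwards [ae_discLaw_norm_lt_one b] with g hg
      have h1 := abs_phaseIncr_le ψ hg
      have h2 : ‖Complex.exp (phaseIncr ψ g * Complex.I) - 1 - phaseIncr ψ g * Complex.I‖ ≤
          2 * |phaseIncr ψ g| ^ 2 := by
        have h3 : ‖(phaseIncr ψ g * Complex.I : ℂ)‖ = |phaseIncr ψ g| := by simp
        by_cases h4 : |phaseIncr ψ g| ≤ 1
        · have h5 := Complex.norm_exp_sub_one_sub_id_le (h3.trans_le h4)
          rw [h3] at h5
          nlinarith [sq_nonneg |phaseIncr ψ g|]
        · have h5 := norm_sub_le (Complex.exp (phaseIncr ψ g * Complex.I) - 1)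
            (phaseIncr ψ g * Complex.I)
          have h6 := Real.norm_exp_I_mul_ofReal_sub_one_le (x := phaseIncr ψ g)
          rw [mul_comm Complex.I, Real.norm_eq_abs] at h6
          nlinarith
      refine h2.trans ?_
      calc _ ≤ 2 * (52 * ‖g‖) ^ 2 := by gcongr
        _ = _ := by ring)
  rw [integral_const_mul, integral_discLaw_sq hb] at h
  exact h.trans (by rw [mul_one_div])

theorem neg_le_phaseIncr {ψ : ℝ} (hψ : 0 ≤ ψ) {γ : ℂ} (hγ : ‖γ‖ < 1) :
    -ψ ≤ phaseIncr ψ γ := by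
  set w := starRingEnd ℂ γ with hw
  have hn : ‖w‖ < 1 := by rwa [hw, RCLike.norm_conj]
  set z : ℝ → ℂ := fun t => w * Complex.exp (t * Complex.I) with hz
  have hzn : ∀ t, ‖z t‖ < 1 := fun t => by
    rw [hz, norm_mul, Complex.norm_exp_ofReal_mul_I, mul_one]; exact hn
  have hre : ∀ t, 0 < (1 - z t).re := fun t => by
    have := (Complex.re_le_norm (z t)).trans_lt (hzn t)
    rw [Complex.sub_re, Complex.one_re]; linarith
  set F : ℝ → ℝ := fun t => t - 2 * (Complex.log (1 - z t)).im with hF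
  have hd : ∀ t, HasDerivAt F (1 - 2 * (-(z t * Complex.I) / (1 - z t)).im) t := fun t => by
    have h1 : HasDerivAt (fun t : ℝ => (t : ℂ) * Complex.I) (1 * Complex.I) t :=
      (HasDerivAt.ofReal_comp (hasDerivAt_id t)).mul_const _
    have h2 : HasDerivAt (fun t => 1 - z t) (-(z t * Complex.I)) t := by
      have := (h1.cexp.const_mul w).const_sub 1
      simpa [hz, mul_assoc] using this
    have h3 := h2.clog_real (Or.inl (hre t))
    have h4 : HasDerivAt (fun t => (Complex.log (1 - z t)).im)
        (-(z t * Complex.I) / (1 - z t)).im t :=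
      Complex.imCLM.hasFDerivAt.comp_hasDerivAt t h3
    exact (hasDerivAt_id t).sub (h4.const_mul 2)
  have hmono : Monotone F := by
    refine monotone_of_deriv_nonneg (fun t => (hd t).differentiableAt) fun t => ?_
    rw [(hd t).deriv]
    have hne : Complex.normSq (1 - z t) ≠ 0 := by
      rw [Ne, Complex.normSq_eq_zero]
      intro h
      have := hre t
      rw [h] at this
      exact lt_irrefl _ this
    have hpos : 0 < Complex.normSq (1 - z t) := lt_of_le_of_ne (Complex.normSq_nonneg _) hne.symm
    have hlt : (z t).re ^ 2 + (z t).im ^ 2 < 1 := by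
      have := hzn t
      have h2 : ‖z t‖ ^ 2 < 1 := by nlinarith [norm_nonneg (z t)]
      rw [Complex.sq_norm, Complex.normSq_apply] at h2
      linarith
    have e : 1 - 2 * (-(z t * Complex.I) / (1 - z t)).im =
        (1 - ((z t).re ^ 2 + (z t).im ^ 2)) / Complex.normSq (1 - z t) := by
      rw [Complex.div_im, eq_div_iff hne, sub_mul, mul_assoc, sub_mul, div_mul_cancel₀ _ hne,
        div_mul_cancel₀ _ hne, Complex.normSq_apply]
      simp only [Complex.neg_im, Complex.neg_re, Complex.mul_im, Complex.mul_re, Complex.I_re,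
        Complex.I_im, Complex.sub_re, Complex.sub_im, Complex.one_re, Complex.one_im]
      ring
    rw [e]
    exact div_nonneg (by linarith) hpos.le
  have h := hmono hψ
  simp only [hF, hz, Complex.log_im, Complex.ofReal_zero, zero_mul, Complex.exp_zero,
    mul_one] at h
  rw [phaseIncr]
  linarith

theorem ae_phaseLaw_mem_Icc {θ a : ℝ} (hθ : 0 ≤ θ) (ha : 0 < a) (n : ℕ) :
    ∀ᵐ ψ ∂phaseLaw θ a n, ψ ∈ Set.Icc 0 ((n + 1) * θ + 52 * n) := by
  induction n with
  | zero =>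
    have h : ∀ᵐ ψ ∂Measure.dirac θ, ψ ∈ Set.Icc 0 (((0 : ℕ) + 1) * θ + 52 * (0 : ℕ)) := by
      rw [ae_dirac_eq]
      simpa using hθ
    exact h
  | succ n ih =>
    have hb : 0 < a * ((n : ℝ) + 1) := by positivity
    have := isProbabilityMeasure_discLaw hb
    have := isProbabilityMeasure_phaseLaw θ ha n
    have hm : Measurable fun p : ℝ × ℂ => θ + p.1 + phaseIncr p.1 p.2 :=
      (measurable_fst.const_add θ).add measurable_phaseIncr
    refine (ae_map_iff hm.aemeasurable measurableSet_Icc).2 ?_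
    have h1 : ∀ᵐ p ∂(phaseLaw θ a n).prod (discLaw (a * ((n : ℝ) + 1))),
        p.1 ∈ Set.Icc 0 ((n + 1) * θ + 52 * n) :=
      Measure.quasiMeasurePreserving_fst.ae ih
    have h2 : ∀ᵐ p ∂(phaseLaw θ a n).prod (discLaw (a * ((n : ℝ) + 1))), ‖p.2‖ < 1 :=
      Measure.quasiMeasurePreserving_snd.ae (ae_discLaw_norm_lt_one _)
    filter_upwards [h1, h2] with p hp hg
    have h3 := neg_le_phaseIncr hp.1 hg
    have h4 := (le_abs_self _).trans (abs_phaseIncr_le p.1 hg)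
    push_cast
    constructor <;> nlinarith [hp.1, hp.2]

theorem integrable_phaseLaw {E : Type*} [NormedAddCommGroup E] [SecondCountableTopology E]
    {θ a : ℝ} (hθ : 0 ≤ θ) (ha : 0 < a) (n : ℕ) {f : ℝ → E} (hf : Continuous f) :
    Integrable f (phaseLaw θ a n) := by
  have := isProbabilityMeasure_phaseLaw θ ha n
  obtain ⟨C, hC⟩ := isCompact_Icc.exists_bound_of_continuousOn
    (hf.continuousOn (s := Set.Icc 0 ((n + 1) * θ + 52 * n)))
  refine Integrable.of_bound hf.aestronglyMeasurable C ?_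
  filter_upwards [ae_phaseLaw_mem_Icc hθ ha n] with ψ hψ using hC ψ hψ

theorem norm_integral_phaseLaw_succ_sub_le {E : Type*} [NormedAddCommGroup E]
    [NormedSpace ℝ E] [CompleteSpace E] [SecondCountableTopology E] {θ a : ℝ} (hθ : 0 ≤ θ)
    (ha : 0 < a) (n : ℕ) {f h : ℝ → E} (hf : Continuous f) (hh : Continuous h) {ε : ℝ}
    (H : ∀ ψ, ‖∫ g, f (θ + ψ + phaseIncr ψ g) ∂discLaw (a * (n + 1)) - h ψ‖ ≤ ε) :
    ‖∫ ψ, f ψ ∂phaseLaw θ a (n + 1) - ∫ ψ, h ψ ∂phaseLaw θ a n‖ ≤ ε := by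
  have hb : 0 < a * ((n : ℝ) + 1) := by positivity
  have := isProbabilityMeasure_discLaw hb
  have := isProbabilityMeasure_phaseLaw θ ha n
  have hm : Measurable fun p : ℝ × ℂ => θ + p.1 + phaseIncr p.1 p.2 :=
    (measurable_fst.const_add θ).add measurable_phaseIncr
  have hi := integrable_phaseLaw hθ ha (n + 1) hf
  rw [phaseLaw] at hi ⊢
  have hi' := (integrable_map_measure hf.aestronglyMeasurable hm.aemeasurable).1 hi
  rw [integral_map hm.aemeasurable hf.aestronglyMeasurable]
  have e := integral_prod _ hi'
  have hi2 := hi'.integral_prod_left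
  simp only [Function.comp_apply] at e hi2
  rw [e, ← integral_sub hi2 (integrable_phaseLaw hθ ha n hh)]
  have := norm_integral_le_of_norm_le_const (μ := phaseLaw θ a n) (ae_of_all _ H)
  simpa using this

theorem integral_phaseLaw_id {θ a : ℝ} (hθ : 0 ≤ θ) (ha : 0 < a) (n : ℕ) :
    ∫ ψ, ψ ∂phaseLaw θ a n = (n + 1) * θ := by
  induction n with
  | zero => simp [phaseLaw]
  | succ n ih =>
    have hb : 0 < a * ((n : ℝ) + 1) := by positivity
    have := isProbabilityMeasure_discLaw hb
    have := isProbabilityMeasure_phaseLaw θ ha n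
    have h := norm_integral_phaseLaw_succ_sub_le hθ ha n (f := fun ψ => ψ)
      (h := fun ψ => θ + ψ) continuous_id (by fun_prop) (ε := 0) (fun ψ => by
        rw [integral_add (integrable_const _) (integrable_phaseIncr hb ψ), integral_phaseIncr hb]
        simp)
    rw [norm_le_zero_iff, sub_eq_zero] at h
    rw [h, integral_add (integrable_const _)
      (integrable_phaseLaw hθ ha n (f := fun ψ => ψ) continuous_id), ih]
    simp
    ring

/-- The variance of the phase. -/
def phaseVar (θ a : ℝ) (n : ℕ) : ℝ := ∫ ψ, (ψ - (n + 1) * θ) ^ 2 ∂phaseLaw θ a n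

/-- The first Fourier coefficient of the phase. -/
def phaseChar (θ a : ℝ) (n : ℕ) : ℂ := ∫ ψ, Complex.exp (ψ * Complex.I) ∂phaseLaw θ a n

theorem phaseVar_zero (θ a : ℝ) : phaseVar θ a 0 = 0 := by simp [phaseVar, phaseLaw]

theorem norm_phaseChar_le (θ : ℝ) {a : ℝ} (ha : 0 < a) (n : ℕ) : ‖phaseChar θ a n‖ ≤ 1 := by
  have := isProbabilityMeasure_phaseLaw θ ha n
  have := norm_integral_le_of_norm_le_const (μ := phaseLaw θ a n) (C := 1)
    (ae_of_all _ fun ψ => (Complex.norm_exp_ofReal_mul_I ψ).le)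
  simpa [phaseChar] using this

theorem re_phaseChar {θ a : ℝ} (hθ : 0 ≤ θ) (ha : 0 < a) (n : ℕ) :
    (phaseChar θ a n).re = ∫ ψ, Real.cos ψ ∂phaseLaw θ a n := by
  have h := integral_re (𝕜 := ℂ) (integrable_phaseLaw hθ ha n
    (f := fun ψ : ℝ => Complex.exp (ψ * Complex.I)) (by fun_prop))
  simp only [RCLike.re_to_complex, Complex.exp_ofReal_mul_I_re] at h
  exact h.symm

theorem one_sub_re_phaseChar_le {θ a : ℝ} (hθ : 0 ≤ θ) (ha : 0 < a) (n : ℕ) :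
    1 - (phaseChar θ a n).re ≤ (n + 1) * θ := by
  have := isProbabilityMeasure_phaseLaw θ ha n
  rw [re_phaseChar hθ ha, ← integral_phaseLaw_id hθ ha]
  have h : ∫ ψ, (1 - Real.cos ψ) ∂phaseLaw θ a n ≤ ∫ ψ, ψ ∂phaseLaw θ a n := by
    refine integral_mono_ae (integrable_phaseLaw hθ ha n (by fun_prop))
      (integrable_phaseLaw hθ ha n continuous_id) ?_
    filter_upwards [ae_phaseLaw_mem_Icc hθ ha n] with ψ hψ
    have h1 := Real.one_sub_sq_div_two_le_cos (x := ψ)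
    have h2 := Real.neg_one_le_cos ψ
    by_cases h3 : ψ ≤ 2
    · nlinarith [hψ.1]
    · show 1 - Real.cos ψ ≤ ψ
      linarith
  rw [integral_sub (integrable_const _)
    (integrable_phaseLaw hθ ha n Real.continuous_cos)] at h
  simpa using h

theorem norm_phaseChar_succ_sub_le {θ a : ℝ} (hθ : 0 ≤ θ) (ha : 0 < a) (n : ℕ) :
    ‖phaseChar θ a (n + 1) - Complex.exp (θ * Complex.I) * phaseChar θ a n‖ ≤
      5408 / (a * (n + 1) + 1) := by
  have hb : 0 < a * ((n : ℝ) + 1) := by positivity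
  rw [phaseChar, phaseChar, ← integral_const_mul]
  refine norm_integral_phaseLaw_succ_sub_le hθ ha n (by fun_prop) (by fun_prop) fun ψ => ?_
  have e : ∀ g, Complex.exp (((θ + ψ + phaseIncr ψ g : ℝ) : ℂ) * Complex.I) =
      Complex.exp (θ * Complex.I) * Complex.exp (ψ * Complex.I) *
        Complex.exp (phaseIncr ψ g * Complex.I) := fun g => by
    rw [← Complex.exp_add, ← Complex.exp_add]
    push_cast
    ring_nf
  simp only [e]
  rw [integral_const_mul, ← mul_sub_one, norm_mul, norm_mul, Complex.norm_exp_ofReal_mul_I,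
    Complex.norm_exp_ofReal_mul_I, one_mul, one_mul]
  exact norm_integral_exp_phaseIncr_sub_one_le hb ψ

theorem abs_phaseVar_succ_sub_le {θ a : ℝ} (hθ : 0 ≤ θ) (ha : 0 < a) (n : ℕ) :
    |phaseVar θ a (n + 1) - (phaseVar θ a n +
        4 / (a * (n + 1) + 1) * (1 - (phaseChar θ a n).re))| ≤
      5376 / ((a * (n + 1) + 1) * √(a * (n + 1) + 1)) := by
  have hb : 0 < a * ((n : ℝ) + 1) := by positivity
  have := isProbabilityMeasure_discLaw hb
  have := isProbabilityMeasure_phaseLaw θ ha n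
  have e : phaseVar θ a n + 4 / (a * (n + 1) + 1) * (1 - (phaseChar θ a n).re) =
      ∫ ψ, ((ψ - (n + 1) * θ) ^ 2 + 4 / (a * (n + 1) + 1) * (1 - Real.cos ψ))
        ∂phaseLaw θ a n := by
    rw [integral_add (integrable_phaseLaw hθ ha n (by fun_prop))
      (integrable_phaseLaw hθ ha n (by fun_prop)), integral_const_mul,
      integral_sub (integrable_const _) (integrable_phaseLaw hθ ha n Real.continuous_cos),
      re_phaseChar hθ ha]
    simp [phaseVar]
  rw [e, phaseVar, ← Real.norm_eq_abs]
  refine norm_integral_phaseLaw_succ_sub_le hθ ha n (by fun_prop) (by fun_prop) fun ψ => ?_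
  have e2 : ∀ g, (θ + ψ + phaseIncr ψ g - (((n + 1 : ℕ) : ℝ) + 1) * θ) ^ 2 =
      (ψ - (n + 1) * θ) ^ 2 + 2 * (ψ - (n + 1) * θ) * phaseIncr ψ g + phaseIncr ψ g ^ 2 :=
    fun g => by push_cast; ring
  simp only [e2]
  have hi : Integrable (fun g => 2 * (ψ - (n + 1) * θ) * phaseIncr ψ g)
      (discLaw (a * ((n : ℝ) + 1))) := (integrable_phaseIncr hb ψ).const_mul _
  have hi2 : Integrable (fun g => (ψ - (n + 1) * θ) ^ 2 + 2 * (ψ - (n + 1) * θ) * phaseIncr ψ g)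
      (discLaw (a * ((n : ℝ) + 1))) := (integrable_const _).add hi
  rw [integral_add hi2 (integrable_phaseIncr_sq hb ψ), integral_add (integrable_const _) hi,
    integral_const_mul, integral_phaseIncr hb, Real.norm_eq_abs]
  convert abs_integral_phaseIncr_sq_sub_le hb ψ using 2
  simp
  ring

theorem summable_one_div_mul_sqrt {a : ℝ} (ha : 0 < a) :
    Summable fun n : ℕ => 1 / ((a * (n + 1) + 1) * √(a * (n + 1) + 1)) := by
  have h0 : Summable fun n : ℕ => 1 / ((n : ℝ) ^ (3 / 2 : ℝ)) :=
    Real.summable_one_div_nat_rpow.2 (by norm_num)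
  have h1 := ((summable_nat_add_iff 1).2 h0).mul_left (1 / (a * √a))
  refine Summable.of_nonneg_of_le (fun n => by positivity) (fun n => ?_) h1
  have hn : (0 : ℝ) < (n : ℝ) + 1 := by positivity
  have e : ((n + 1 : ℕ) : ℝ) ^ (3 / 2 : ℝ) = ((n : ℝ) + 1) * √((n : ℝ) + 1) := by
    push_cast
    rw [Real.sqrt_eq_rpow, show (3 / 2 : ℝ) = 1 + 1 / 2 by norm_num, Real.rpow_add hn,
      Real.rpow_one]
  rw [e, ← one_div_mul_one_div_rev, one_div_mul_one_div_rev, one_div_mul_one_div,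
    show a * √a * (((n : ℝ) + 1) * √((n : ℝ) + 1)) =
      (a * ((n : ℝ) + 1)) * (√a * √((n : ℝ) + 1)) by ring, ← Real.sqrt_mul ha.le]
  gcongr <;> linarith

theorem inv_sq_le_telescope (n : ℕ) :
    1 / ((n : ℝ) + 1) ^ 2 ≤ 2 * (1 / ((n : ℝ) + 1) - 1 / ((n : ℝ) + 2)) := by
  have h : 2 * (1 / ((n : ℝ) + 1) - 1 / ((n : ℝ) + 2)) =
      1 / (((n : ℝ) + 1) * (((n : ℝ) + 2) / 2)) := by
    field_simp
    ring
  rw [h, sq]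
  gcongr
  linarith [(Nat.cast_nonneg n : (0 : ℝ) ≤ n)]

theorem abs_sum_Ico_sub_log_le {a : ℝ} (ha : 0 < a) {K M : ℕ} (h : K ≤ M) :
    |∑ n ∈ Finset.Ico K M, 4 / (a * ((n : ℝ) + 1) + 1) -
        4 / a * (Real.log (M + 1) - Real.log (K + 1))| ≤
      (4 / a + 8 / a ^ 2) * (1 / ((K : ℝ) + 1) - 1 / ((M : ℝ) + 1)) := by
  induction M, h using Nat.le_induction with
  | base => simp
  | succ n hn ih =>
    rw [Finset.sum_Ico_succ_top hn]
    have hp : (0 : ℝ) < (n : ℝ) + 1 := by positivity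
    have hp2 : (0 : ℝ) < (n : ℝ) + 2 := by positivity
    have l1 : Real.log ((n : ℝ) + 2) - Real.log ((n : ℝ) + 1) ≤ 1 / ((n : ℝ) + 1) := by
      rw [← Real.log_div hp2.ne' hp.ne']
      refine (Real.log_le_sub_one_of_pos (by positivity)).trans (le_of_eq ?_)
      field_simp
      ring
    have l2 : 1 / ((n : ℝ) + 2) ≤ Real.log ((n : ℝ) + 2) - Real.log ((n : ℝ) + 1) := by
      have h1 : 1 - ((n : ℝ) + 1) / ((n : ℝ) + 2) = 1 / ((n : ℝ) + 2) := by
        field_simp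
        ring
      have h2 := Real.log_le_sub_one_of_pos (x := ((n : ℝ) + 1) / ((n : ℝ) + 2)) (by positivity)
      rw [Real.log_div hp.ne' hp2.ne'] at h2
      linarith
    have c1 : 4 / (a * ((n : ℝ) + 1) + 1) ≤ 4 / a * (1 / ((n : ℝ) + 1)) := by
      rw [div_mul_div_comm, mul_one]
      gcongr
      linarith
    have c2 : 4 / a * (1 / ((n : ℝ) + 1)) - 4 / a ^ 2 * (1 / ((n : ℝ) + 1) ^ 2) ≤
        4 / (a * ((n : ℝ) + 1) + 1) := by
      rw [← sub_nonneg]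
      have : 4 / (a * ((n : ℝ) + 1) + 1) -
          (4 / a * (1 / ((n : ℝ) + 1)) - 4 / a ^ 2 * (1 / ((n : ℝ) + 1) ^ 2)) =
          4 / (a ^ 2 * ((n : ℝ) + 1) ^ 2 * (a * ((n : ℝ) + 1) + 1)) := by
        field_simp
        ring
      rw [this]
      positivity
    have c3 := mul_le_mul_of_nonneg_left (inv_sq_le_telescope n)
      (show 0 ≤ 4 / a ^ 2 by positivity)
    have c4 := mul_le_mul_of_nonneg_left l1 (show 0 ≤ 4 / a by positivity)
    have c5 := mul_le_mul_of_nonneg_left l2 (show 0 ≤ 4 / a by positivity)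
    have ht : 0 ≤ 1 / ((n : ℝ) + 1) - 1 / ((n : ℝ) + 2) := by
      rw [sub_nonneg]; gcongr; norm_num
    have t1 : 0 ≤ 4 / a * (1 / ((n : ℝ) + 1) - 1 / ((n : ℝ) + 2)) := by positivity
    have t2 : 0 ≤ 8 / a ^ 2 * (1 / ((n : ℝ) + 1) - 1 / ((n : ℝ) + 2)) := by positivity
    have e2 : 4 / a ^ 2 * (2 * (1 / ((n : ℝ) + 1) - 1 / ((n : ℝ) + 2))) =
        8 / a ^ 2 * (1 / ((n : ℝ) + 1) - 1 / ((n : ℝ) + 2)) := by ring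
    rw [e2] at c3
    push_cast
    rw [show (n : ℝ) + 1 + 1 = n + 2 by ring]
    rw [abs_le] at ih ⊢
    constructor <;> nlinarith [ih.1, ih.2]

theorem norm_sum_Ico_mul_sub_le {a : ℝ} (ha : 0 < a) {A : ℕ → ℂ} {q : ℂ} {D : ℝ} (hD : 0 ≤ D)
    (hA : ∀ n, ‖A n‖ ≤ 1) (hstep : ∀ n : ℕ, ‖A (n + 1) - q * A n‖ ≤ D / (a * (n + 1) + 1))
    {K M : ℕ} (h : K ≤ M) :
    ‖(1 - q) * ∑ n ∈ Finset.Ico K M, ((4 / (a * ((n : ℝ) + 1) + 1) : ℝ) : ℂ) * A n -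
        (((4 / (a * ((K : ℝ) + 1) + 1) : ℝ) : ℂ) * A K -
          ((4 / (a * ((M : ℝ) + 1) + 1) : ℝ) : ℂ) * A M)‖ ≤
      4 / (a * ((K : ℝ) + 1) + 1) - 4 / (a * ((M : ℝ) + 1) + 1) +
        8 * D / a ^ 2 * (1 / ((K : ℝ) + 1) - 1 / ((M : ℝ) + 1)) := by
  induction M, h using Nat.le_induction with
  | base => simp
  | succ n hn ih =>
    rw [Finset.sum_Ico_succ_top hn]
    set S := ∑ n ∈ Finset.Ico K n, ((4 / (a * ((n : ℝ) + 1) + 1) : ℝ) : ℂ) * A n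
    set cK := 4 / (a * ((K : ℝ) + 1) + 1)
    set c := 4 / (a * ((n : ℝ) + 1) + 1) with hc
    set c' := 4 / (a * (((n + 1 : ℕ) : ℝ) + 1) + 1) with hc'
    have hcc : c' ≤ c := by
      rw [hc, hc']; push_cast
      gcongr
      linarith
    have hc0 : 0 ≤ c := by positivity
    have e : (1 - q) * (S + c * A n) - (cK * A K - c' * A (n + 1)) =
        ((1 - q) * S - (cK * A K - c * A n)) + (c * (A (n + 1) - q * A n) +
          ((c' - c : ℝ) : ℂ) * A (n + 1)) := by
      push_cast
      ring
    rw [e]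
    have h1 : ‖(c : ℂ) * (A (n + 1) - q * A n)‖ ≤
        8 * D / a ^ 2 * (1 / ((n : ℝ) + 1) - 1 / ((n : ℝ) + 2)) := by
      rw [norm_mul, Complex.norm_real, Real.norm_of_nonneg hc0]
      calc c * ‖A (n + 1) - q * A n‖ ≤ c * (D / (a * (n + 1) + 1)) := by gcongr; exact hstep n
        _ = 4 * D / ((a * (n + 1) + 1) * (a * (n + 1) + 1)) := by
          rw [hc, div_mul_div_comm]
        _ ≤ 4 * D / ((a * (n + 1)) * (a * (n + 1))) := by gcongr <;> linarith
        _ = 4 * D / a ^ 2 * (1 / ((n : ℝ) + 1) ^ 2) := by field_simp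
        _ ≤ 4 * D / a ^ 2 * (2 * (1 / ((n : ℝ) + 1) - 1 / ((n : ℝ) + 2))) := by
          gcongr; exact inv_sq_le_telescope n
        _ = _ := by ring
    have h2 : ‖((c' - c : ℝ) : ℂ) * A (n + 1)‖ ≤ c - c' := by
      rw [norm_mul, Complex.norm_real, Real.norm_eq_abs, abs_of_nonpos (by linarith), neg_sub]
      exact mul_le_of_le_one_right (by linarith) (hA _)
    refine (norm_add_le _ _).trans ((add_le_add ih (norm_add_le _ _)).trans ?_)
    rw [show (((n + 1 : ℕ) : ℝ) + 1) = n + 2 by push_cast; ring]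
    linarith

theorem two_mul_div_pi_le_norm_one_sub_exp {θ : ℝ} (h0 : 0 ≤ θ) (h1 : θ ≤ Real.pi) :
    2 * θ / Real.pi ≤ ‖1 - Complex.exp (θ * Complex.I)‖ := by
  rw [norm_sub_rev, mul_comm (θ : ℂ), Complex.norm_exp_I_mul_ofReal_sub_one, Real.norm_eq_abs]
  have h := Real.mul_le_sin (x := θ / 2) (by linarith) (by linarith)
  refine le_trans (le_of_eq ?_) ((mul_le_mul_of_nonneg_left h zero_le_two).trans (le_abs_self _))
  ring

theorem norm_sum_Ico_mul_le {a : ℝ} (ha : 0 < a) {A : ℕ → ℂ} {θ D : ℝ} (h0 : 0 < θ)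
    (h1 : θ ≤ Real.pi) (hD : 0 ≤ D) (hA : ∀ n, ‖A n‖ ≤ 1)
    (hstep : ∀ n : ℕ, ‖A (n + 1) - Complex.exp (θ * Complex.I) * A n‖ ≤ D / (a * (n + 1) + 1))
    {K M : ℕ} (h : K ≤ M) (hK : 1 ≤ ((K : ℝ) + 1) * θ) :
    ‖∑ n ∈ Finset.Ico K M, ((4 / (a * ((n : ℝ) + 1) + 1) : ℝ) : ℂ) * A n‖ ≤
      (8 / a + 8 * D / a ^ 2) * Real.pi / 2 := by
  have hpi := Real.pi_pos
  have key := norm_sum_Ico_mul_sub_le ha hD hA hstep h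
  set S := ∑ n ∈ Finset.Ico K M, ((4 / (a * ((n : ℝ) + 1) + 1) : ℝ) : ℂ) * A n
  set cK := 4 / (a * ((K : ℝ) + 1) + 1) with hcK
  set cM := 4 / (a * ((M : ℝ) + 1) + 1) with hcM
  have hcK0 : 0 ≤ cK := by positivity
  have hcM0 : 0 ≤ cM := by positivity
  have b1 : ‖(cK : ℂ) * A K - cM * A M‖ ≤ cK + cM := by
    refine (norm_sub_le _ _).trans ?_
    rw [norm_mul, norm_mul, Complex.norm_real, Complex.norm_real, Real.norm_of_nonneg hcK0,
      Real.norm_of_nonneg hcM0]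
    exact add_le_add (mul_le_of_le_one_right hcK0 (hA _)) (mul_le_of_le_one_right hcM0 (hA _))
  have b2 : ‖(1 - Complex.exp (θ * Complex.I)) * S‖ ≤ (8 / a + 8 * D / a ^ 2) / ((K : ℝ) + 1) := by
    have h2 := norm_add_le ((1 - Complex.exp (θ * Complex.I)) * S - (cK * A K - cM * A M))
      (cK * A K - cM * A M)
    rw [sub_add_cancel] at h2
    have h3 : cK ≤ 4 / (a * ((K : ℝ) + 1)) := by
      rw [hcK]; gcongr; linarith
    have h4 : 0 ≤ 8 * D / a ^ 2 * (1 / ((M : ℝ) + 1)) := by positivity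
    have e : (8 / a + 8 * D / a ^ 2) / ((K : ℝ) + 1) =
        2 * (4 / (a * ((K : ℝ) + 1))) + 8 * D / a ^ 2 * (1 / ((K : ℝ) + 1)) := by
      field_simp
      ring
    rw [e]
    linarith
  rw [norm_mul] at b2
  have b3 := two_mul_div_pi_le_norm_one_sub_exp h0.le h1
  have b4 : 2 * θ / Real.pi * ‖S‖ ≤ (8 / a + 8 * D / a ^ 2) / ((K : ℝ) + 1) :=
    (mul_le_mul_of_nonneg_right b3 (norm_nonneg _)).trans b2
  have hK0 : (0 : ℝ) < (K : ℝ) + 1 := by positivity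
  rw [le_div_iff₀ hK0] at b4
  have e : 2 * θ / Real.pi * ‖S‖ * ((K : ℝ) + 1) =
      (((K : ℝ) + 1) * θ) * (2 * ‖S‖ / Real.pi) := by ring
  rw [e] at b4
  have b5 : 2 * ‖S‖ / Real.pi ≤ 8 / a + 8 * D / a ^ 2 :=
    (le_mul_of_one_le_left (by positivity) hK).trans b4
  rw [div_le_iff₀ hpi] at b5
  linarith

theorem abs_log_sub_le {θ : ℝ} (h0 : 0 < θ) (h1 : θ ≤ Real.pi) {K M : ℕ} (h : K ≤ M)
    (hK : 1 ≤ ((K : ℝ) + 1) * θ) (hK' : (K : ℝ) * θ ≤ 1) :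
    |Real.log (M + 1) - Real.log (K + 1) - Real.log (2 + (M + 1) * θ)| ≤
      Real.log (3 + Real.pi) := by
  have hpi := Real.pi_pos
  have hk : (0 : ℝ) < (K : ℝ) + 1 := by positivity
  have hm : (0 : ℝ) < (M : ℝ) + 1 := by positivity
  have hkm : (K : ℝ) + 1 ≤ (M : ℝ) + 1 := by gcongr
  have hx : 0 < 2 + ((M : ℝ) + 1) * θ := by positivity
  have u1 : Real.log (M + 1) ≤ Real.log (K + 1) + Real.log (2 + (M + 1) * θ) := by
    rw [← Real.log_mul hk.ne' hx.ne']
    refine Real.log_le_log hm ?_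
    nlinarith
  have u2 : Real.log (K + 1) + Real.log (2 + (M + 1) * θ) ≤
      Real.log (3 + Real.pi) + Real.log (M + 1) := by
    rw [← Real.log_mul hk.ne' hx.ne', ← Real.log_mul (by positivity) hm.ne']
    refine Real.log_le_log (by positivity) ?_
    have : ((K : ℝ) + 1) * θ ≤ 1 + Real.pi := by linarith
    nlinarith
  have u3 : 0 ≤ Real.log (3 + Real.pi) := Real.log_nonneg (by linarith)
  rw [abs_le]
  constructor <;> linarith

theorem abs_phaseVar_sub_sum_le {θ a : ℝ} (hθ : 0 ≤ θ) (ha : 0 < a) (M : ℕ) :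
    |phaseVar θ a M - ∑ n ∈ Finset.range M,
        4 / (a * ((n : ℝ) + 1) + 1) * (1 - (phaseChar θ a n).re)| ≤
      ∑ n ∈ Finset.range M, 5376 / ((a * ((n : ℝ) + 1) + 1) * √(a * (n + 1) + 1)) := by
  induction M with
  | zero => simp [phaseVar_zero]
  | succ n ih =>
    rw [Finset.sum_range_succ, Finset.sum_range_succ]
    refine le_trans (le_of_eq_of_le ?_ (abs_add_le _ _))
      (add_le_add ih (abs_phaseVar_succ_sub_le hθ ha n))
    congr 1
    ring

theorem exists_abs_phaseVar_sub_log_le {a : ℝ} (ha : 0 < a) :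
    ∃ C, ∀ (M : ℕ) (θ : ℝ), 0 < θ → θ ≤ Real.pi →
      |phaseVar θ a M - 4 / a * Real.log (2 + (M + 1) * θ)| ≤ C := by
  have hpi := Real.pi_pos
  set S : ℝ := ∑' n : ℕ, 5376 * (1 / ((a * ((n : ℝ) + 1) + 1) * √(a * (n + 1) + 1)))
  set E := (8 / a + 8 * 5408 / a ^ 2) * Real.pi / 2
  have hE : 0 ≤ E := by positivity
  have hL : 0 ≤ 4 / a * Real.log (3 + Real.pi) :=
    mul_nonneg (by positivity) (Real.log_nonneg (by linarith))
  refine ⟨S + 4 / a + (4 / a + 8 / a ^ 2) + E + 4 / a * Real.log (3 + Real.pi),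
    fun M θ h0 h1 => ?_⟩
  have hS : ∑ n ∈ Finset.range M, 5376 / ((a * ((n : ℝ) + 1) + 1) * √(a * (n + 1) + 1)) ≤ S := by
    have h := ((summable_one_div_mul_sqrt ha).mul_left 5376).sum_le_tsum (Finset.range M)
      (fun n _ => by positivity)
    refine le_of_eq_of_le ?_ h
    simp only [mul_one_div]
  have hV := (abs_phaseVar_sub_sum_le h0.le ha M).trans hS
  set c : ℕ → ℝ := fun n => 4 / (a * ((n : ℝ) + 1) + 1) with hc
  have hc0 : ∀ n, 0 ≤ c n := fun n => by positivity
  have hre : ∀ n, (phaseChar θ a n).re ≤ 1 := fun n =>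
    (Complex.re_le_norm _).trans (norm_phaseChar_le θ ha n)
  set K := ⌊1 / θ⌋₊ with hKdef
  have hK' : (K : ℝ) * θ ≤ 1 := by
    have := Nat.floor_le (show 0 ≤ 1 / θ by positivity)
    rwa [← hKdef, le_div_iff₀ h0] at this
  have hK : 1 ≤ ((K : ℝ) + 1) * θ := by
    have := (Nat.lt_floor_add_one (1 / θ)).le
    rwa [← hKdef, div_le_iff₀ h0] at this
  have hinit : ∀ m ≤ K, |∑ n ∈ Finset.range m, c n * (1 - (phaseChar θ a n).re)| ≤ 4 / a := by
    intro m hm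
    rw [abs_of_nonneg (Finset.sum_nonneg fun n _ => mul_nonneg (hc0 n) (by linarith [hre n]))]
    calc _ ≤ ∑ n ∈ Finset.range m, 4 / a * θ := by
          refine Finset.sum_le_sum fun n _ => ?_
          have h2 := one_sub_re_phaseChar_le h0.le ha n
          calc c n * (1 - (phaseChar θ a n).re) ≤ 4 / (a * ((n : ℝ) + 1)) * ((n + 1) * θ) := by
                refine mul_le_mul ?_ h2 (by linarith [hre n]) (by positivity)
                simp only [hc]
                gcongr
                linarith
            _ = 4 / a * θ := by field_simp
      _ = m * θ * (4 / a) := by rw [Finset.sum_const, Finset.card_range, nsmul_eq_mul]; ring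
      _ ≤ 1 * (4 / a) := by
          gcongr
          refine le_trans ?_ hK'
          gcongr
      _ = 4 / a := one_mul _
  rcases le_total M K with hMK | hKM
  · have h2 := hinit M hMK
    have h3 : |4 / a * Real.log (2 + (M + 1) * θ)| ≤ 4 / a * Real.log (3 + Real.pi) := by
      rw [abs_of_nonneg (mul_nonneg (by positivity) (Real.log_nonneg (by nlinarith [
        (Nat.cast_nonneg M : (0 : ℝ) ≤ M)])))]
      gcongr ?_ * Real.log ?_
      have : (M : ℝ) * θ ≤ K * θ := by gcongr
      linarith
    have h5 : 0 ≤ 4 / a + 8 / a ^ 2 := by positivity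
    rw [abs_le] at *
    constructor <;> linarith [hV.1, hV.2, h2.1, h2.2, h3.1, h3.2]
  · have h2 := hinit K le_rfl
    have h3 := norm_sum_Ico_mul_le ha h0 h1 (by norm_num) (norm_phaseChar_le θ ha)
      (norm_phaseChar_succ_sub_le h0.le ha) hKM hK
    have h4 : |∑ n ∈ Finset.Ico K M, c n * (phaseChar θ a n).re| ≤ E := by
      have h := (Complex.abs_re_le_norm _).trans h3
      rw [Complex.re_sum] at h
      simpa only [Complex.re_ofReal_mul] using h
    have h5 : |∑ n ∈ Finset.Ico K M, c n - 4 / a * (Real.log (M + 1) - Real.log (K + 1))| ≤ _ :=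
      abs_sum_Ico_sub_log_le ha hKM
    have h6 := abs_log_sub_le h0 h1 hKM hK hK'
    have h7 : (4 / a + 8 / a ^ 2) * (1 / ((K : ℝ) + 1) - 1 / ((M : ℝ) + 1)) ≤
        4 / a + 8 / a ^ 2 := by
      refine mul_le_of_le_one_right (by positivity) ?_
      have e1 : 1 / ((K : ℝ) + 1) ≤ 1 := by
        rw [div_le_one (by positivity)]; linarith [(Nat.cast_nonneg K : (0 : ℝ) ≤ K)]
      have e2 : 0 ≤ 1 / ((M : ℝ) + 1) := by positivity
      linarith
    have h8 := Finset.sum_range_add_sum_Ico (fun n => c n * (1 - (phaseChar θ a n).re)) hKM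
    have h10 : ∑ n ∈ Finset.Ico K M, c n * (1 - (phaseChar θ a n).re) =
        ∑ n ∈ Finset.Ico K M, c n - ∑ n ∈ Finset.Ico K M, c n * (phaseChar θ a n).re := by
      simp only [mul_sub, mul_one, Finset.sum_sub_distrib]
    replace hV : |phaseVar θ a M - ∑ n ∈ Finset.range M, c n * (1 - (phaseChar θ a n).re)| ≤ S := hV
    rw [← h8, h10] at hV
    have h9 : |4 / a * (Real.log (M + 1) - Real.log (K + 1) - Real.log (2 + (M + 1) * θ))| ≤
        4 / a * Real.log (3 + Real.pi) := by
      rw [abs_mul, abs_of_pos (show 0 < 4 / a by positivity)]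
      gcongr
    rw [abs_le] at *
    constructor <;> linarith [hV.1, hV.2, h2.1, h2.2, h4.1, h4.2, h5.1, h5.2, h9.1, h9.2]

theorem measurable_fin_cons {n : ℕ} :
    Measurable fun p : (Fin n → ℝ) × ℝ => (Fin.cons p.2 p.1 : Fin (n + 1) → ℝ) := by
  refine measurable_pi_iff.2 fun i => ?_
  cases i using Fin.cases with
  | zero => exact measurable_snd
  | succ i => exact (measurable_pi_apply i).comp measurable_fst

theorem measurable_prod_fin {g : ℝ → ENNReal} (hg : Measurable g) (n : ℕ) :
    Measurable fun r : Fin n → ℝ => ∏ i, g (r i) :=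
  Finset.measurable_fun_prod _ fun i _ => hg.comp (measurable_pi_apply i)

theorem lintegral_prod_fin {g : ℝ → ENNReal} (hg : Measurable g) (n : ℕ) :
    ∫⁻ r : Fin n → ℝ, ∏ i, g (r i) = (∫⁻ t, g t) ^ n := by
  induction n with
  | zero => simp [volume_pi]
  | succ n ih =>
    rw [lintegral_fin_cons (measurable_prod_fin hg (n + 1))]
    simp only [Fin.prod_univ_succ, Fin.cons_zero, Fin.cons_succ]
    simp_rw [lintegral_mul_const _ hg]
    rw [lintegral_const_mul _ (measurable_prod_fin hg n), ih, pow_succ']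

theorem lintegral_fin_substitution {φ : ℝ → ℝ} (hφ : Measurable φ) {p q : ℝ → ENNReal}
    (hp : Measurable p) (hq : Measurable q)
    (h : ∀ f : ℝ → ENNReal, Measurable f → ∫⁻ t, p t * f t = ∫⁻ v, q v * f (φ v)) (n : ℕ)
    {F : (Fin n → ℝ) → ENNReal} (hF : Measurable F) :
    ∫⁻ y : Fin n → ℝ, (∏ i, p (y i)) * F y =
      ∫⁻ v : Fin n → ℝ, (∏ i, q (v i)) * F (fun i => φ (v i)) := by
  induction n with
  | zero =>
    refine lintegral_congr fun y => ?_
    simp [Subsingleton.elim (fun i => φ (y i)) y]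
  | succ n ih =>
    have hφn : ∀ n : ℕ, Measurable fun (v : Fin n → ℝ) (i : Fin n) => φ (v i) := fun n =>
      measurable_pi_iff.2 fun i => hφ.comp (measurable_pi_apply i)
    have hFφ := hF.comp (hφn (n + 1))
    have hFc := hF.comp (measurable_fin_cons (n := n))
    have hG : Measurable fun r : Fin n → ℝ => ∫⁻ T, q T * F (Fin.cons (φ T) r) := by
      refine Measurable.lintegral_prod_right' (f := fun x : (Fin n → ℝ) × ℝ =>
        q x.2 * F (Fin.cons (φ x.2) x.1)) ((hq.comp measurable_snd).mul ?_)
      exact hFc.comp (measurable_fst.prodMk (hφ.comp measurable_snd))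
    have m1 : Measurable fun y : Fin (n + 1) → ℝ => (∏ i, p (y i)) * F y :=
      (measurable_prod_fin hp (n + 1)).mul hF
    have m2 : Measurable fun v : Fin (n + 1) → ℝ => (∏ i, q (v i)) * F fun i => φ (v i) :=
      (measurable_prod_fin hq (n + 1)).mul hFφ
    rw [lintegral_fin_cons m1, lintegral_fin_cons m2]
    have h1 : ∀ r : Fin n → ℝ, ∫⁻ T, (∏ i, p ((Fin.cons T r : Fin (n + 1) → ℝ) i)) *
        F (Fin.cons T r) = (∏ i, p (r i)) * ∫⁻ T, q T * F (Fin.cons (φ T) r) := by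
      intro r
      have hr : Measurable fun T => F (Fin.cons T r) :=
        hFc.comp (measurable_const.prodMk measurable_id : Measurable fun T : ℝ => (r, T))
      have hr' : Measurable fun T => p T * F (Fin.cons T r) := hp.mul hr
      rw [← h (fun T => F (Fin.cons T r)) hr, ← lintegral_const_mul _ hr']
      refine lintegral_congr fun T => ?_
      simp only [Fin.prod_univ_succ, Fin.cons_zero, Fin.cons_succ]
      ring
    have h2 : ∀ r : Fin n → ℝ, ∫⁻ T, (∏ i, q ((Fin.cons T r : Fin (n + 1) → ℝ) i)) *
        F (fun i => φ ((Fin.cons T r : Fin (n + 1) → ℝ) i)) =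
          (∏ i, q (r i)) * ∫⁻ T, q T * F (Fin.cons (φ T) fun i => φ (r i)) := by
      intro r
      have hr : Measurable fun T => F (Fin.cons (φ T) fun i => φ (r i)) :=
        hFc.comp (measurable_const.prodMk hφ :
          Measurable fun T : ℝ => ((fun i => φ (r i) : Fin n → ℝ), φ T))
      have hr' : Measurable fun T => q T * F (Fin.cons (φ T) fun i => φ (r i)) := hq.mul hr
      rw [← lintegral_const_mul _ hr']
      refine lintegral_congr fun T => ?_
      have e : (fun i => φ ((Fin.cons T r : Fin (n + 1) → ℝ) i)) =
          (Fin.cons (φ T) fun i => φ (r i)) := by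
        ext i
        cases i using Fin.cases <;> simp
      rw [e]
      simp only [Fin.prod_univ_succ, Fin.cons_zero, Fin.cons_succ]
      ring
    simp only [h1, h2]
    exact ih hG

theorem lintegral_rpow_mul_exp_neg {s : ℝ} (hs : 0 < s) :
    ∫⁻ t in Set.Ioi (0 : ℝ), ENNReal.ofReal (t ^ (s - 1) * Real.exp (-t)) =
      ENNReal.ofReal (Real.Gamma s) := by
  have h := Real.GammaIntegral_convergent hs
  rw [Real.Gamma_eq_integral hs, ofReal_integral_eq_lintegral_ofReal h
    ((ae_restrict_iff' measurableSet_Ioi).2 (ae_of_all _ fun t (ht : 0 < t) =>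
      mul_nonneg (Real.exp_nonneg _) (Real.rpow_nonneg ht.le _)))]
  simp only [mul_comm]

/-- The Dixon–Anderson integral. -/
theorem lintegral_interlaces {a : ℝ} (ha : 0 < a) {n : ℕ} {y : Fin (n + 1) → ℝ}
    (hy : StrictMono y) :
    ∫⁻ x in {x : Fin n → ℝ | Interlaces y x},
        ENNReal.ofReal (absVand x * absRes y x ^ (a - 1)) =
      ENNReal.ofReal (Real.Gamma a ^ (n + 1) / Real.Gamma (a * (n + 1)) *
        absVand y ^ (2 * a - 1)) := by
  have hb : 0 < a * ((n : ℝ) + 1) := by positivity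
  have hV := absVand_pos hy.injective
  have hΓ := Real.Gamma_pos_of_pos hb
  have hΓa := Real.Gamma_pos_of_pos ha
  set g : ℝ → ENNReal := (Set.Ioi (0 : ℝ)).indicator
    fun t => ENNReal.ofReal (t ^ (a - 1) * Real.exp (-t)) with hg
  have hgm : Measurable g := Measurable.indicator (by fun_prop) measurableSet_Ioi
  have hgi : ∫⁻ t, g t = ENNReal.ofReal (Real.Gamma a) := by
    rw [hg, lintegral_indicator measurableSet_Ioi, lintegral_rpow_mul_exp_neg ha]
  have hpos : MeasurableSet {r : Fin (n + 1) → ℝ | ∀ i, 0 < r i} := by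
    rw [Set.ofPred_forall]
    exact MeasurableSet.iInter fun i => measurableSet_lt measurable_const (measurable_pi_apply i)
  have h1 : ∫⁻ r in {r : Fin (n + 1) → ℝ | ∀ i, 0 < r i}, ∏ i, g (r i) =
      ENNReal.ofReal (Real.Gamma a) ^ (n + 1) := by
    rw [← hgi, ← lintegral_prod_fin hgm, ← lintegral_indicator hpos]
    refine lintegral_congr fun r => ?_
    by_cases hr : ∀ i, 0 < r i
    · rw [Set.indicator_of_mem (by exact hr)]
    · rw [Set.indicator_of_notMem (by exact hr)]
      push Not at hr
      obtain ⟨i, hi⟩ := hr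
      exact (Finset.prod_eq_zero (Finset.mem_univ i)
        (Set.indicator_of_notMem (fun h : 0 < r i => absurd h hi.not_gt) _)).symm
  rw [lintegral_interlaces_inner hy] at h1
  have hm : Measurable fun x : Fin n → ℝ =>
      ENNReal.ofReal (absVand x * absRes y x ^ (a - 1)) := by
    have h := measurable_absRes.comp
      (measurable_const.prodMk measurable_id : Measurable fun x : Fin n → ℝ => (y, x))
    have h' := (measurable_absVand.mul (h.pow_const (a - 1))).ennreal_ofReal
    exact h'
  have hm2 : Measurable fun R : ℝ =>
      ENNReal.ofReal (R ^ (a * (n + 1) - 1) * Real.exp (-R)) := by fun_prop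
  have h2 : ∀ X ∈ {X : Fin (n + 1) → ℝ | 0 < X 0 ∧ Interlaces y (Fin.tail X)},
      ENNReal.ofReal (X 0 ^ n * absVand (Fin.tail X) / absVand y) *
        ∏ i, g (X 0 * innerWeight y (Fin.tail X) i) =
      (fun x R => ENNReal.ofReal (absVand y ^ (1 - 2 * a)) *
        (ENNReal.ofReal (absVand x * absRes y x ^ (a - 1)) *
        ENNReal.ofReal (R ^ (a * (n + 1) - 1) * Real.exp (-R)))) (Fin.tail X) (X 0) := by
    rintro X ⟨hX0, hX⟩
    have hw := innerWeight_pos hX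
    have hVx := absVand_pos hX.strictMono_inner.injective
    have hR := hX.absRes_pos
    have e1 : ∀ i, g (X 0 * innerWeight y (Fin.tail X) i) =
        ENNReal.ofReal ((X 0 * innerWeight y (Fin.tail X) i) ^ (a - 1) *
          Real.exp (-(X 0 * innerWeight y (Fin.tail X) i))) := fun i =>
      Set.indicator_of_mem (Set.mem_Ioi.2 (mul_pos hX0 (hw i))) _
    simp only [e1]
    rw [← ENNReal.ofReal_prod_of_nonneg fun i _ => by have := hw i; positivity,
      ← ENNReal.ofReal_mul (by positivity), ← ENNReal.ofReal_mul (by positivity),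
      ← ENNReal.ofReal_mul (by positivity)]
    congr 1
    rw [Finset.prod_mul_distrib, ← Real.exp_sum, Finset.sum_neg_distrib, ← Finset.mul_sum,
      sum_innerWeight hy.injective, mul_one, Real.finsetProd_rpow _ _
        (fun i _ => by have := hw i; positivity), Finset.prod_mul_distrib, Finset.prod_const,
      Finset.card_univ, Fintype.card_fin, prod_innerWeight hX,
      Real.mul_rpow (by positivity) (by positivity), Real.div_rpow hR.le (by positivity),
      ← Real.rpow_natCast (X 0) (n + 1), ← Real.rpow_mul hX0.le,
      ← Real.rpow_natCast (absVand y) 2, ← Real.rpow_mul hV.le,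
      show a * ((n : ℝ) + 1) - 1 = n + ((n + 1 : ℕ) : ℝ) * (a - 1) by push_cast; ring,
      Real.rpow_add hX0, Real.rpow_natCast,
      show 1 - 2 * a = -1 - ((2 : ℕ) : ℝ) * (a - 1) by push_cast; ring,
      Real.rpow_sub hV, Real.rpow_neg_one]
    field_simp
  rw [setLIntegral_congr_fun (measurableSet_pos_interlaces y) h2,
    setLIntegral_cons_interlaces y (G := fun x R => ENNReal.ofReal (absVand y ^ (1 - 2 * a)) *
      (ENNReal.ofReal (absVand x * absRes y x ^ (a - 1)) *
        ENNReal.ofReal (R ^ (a * (n + 1) - 1) * Real.exp (-R)))) (by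
      have h := ((hm.comp measurable_fst).mul (hm2.comp measurable_snd)).const_mul
        (ENNReal.ofReal (absVand y ^ (1 - 2 * a)))
      exact h)] at h1
  simp_rw [lintegral_const_mul' _ _ ENNReal.ofReal_ne_top] at h1
  rw [lintegral_rpow_mul_exp_neg hb,
    lintegral_mul_const _ hm] at h1
  have e : ENNReal.ofReal (Real.Gamma a ^ (n + 1) / Real.Gamma (a * (n + 1)) *
        absVand y ^ (2 * a - 1)) = ENNReal.ofReal (absVand y ^ (2 * a - 1)) *
        (ENNReal.ofReal (Real.Gamma (a * (n + 1))))⁻¹ *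
          ENNReal.ofReal (Real.Gamma a) ^ (n + 1) := by
    rw [← ENNReal.ofReal_inv_of_pos hΓ, ← ENNReal.ofReal_pow hΓa.le, ← ENNReal.ofReal_mul
      (by positivity), ← ENNReal.ofReal_mul (by positivity)]
    congr 1
    ring
  rw [e, ← h1, ← neg_sub (2 * a) 1, Real.rpow_neg hV.le, ENNReal.ofReal_inv_of_pos (by positivity)]
  have c1 : ENNReal.ofReal (absVand y ^ (2 * a - 1)) ≠ 0 := by
    simpa using Real.rpow_pos_of_pos hV _
  have c2 : ENNReal.ofReal (Real.Gamma (a * (n + 1))) ≠ 0 := by simpa using hΓ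
  set I := ∫⁻ x in {x : Fin n → ℝ | Interlaces y x},
        ENNReal.ofReal (absVand x * absRes y x ^ (a - 1))
  set A := ENNReal.ofReal (absVand y ^ (2 * a - 1))
  set B := ENNReal.ofReal (Real.Gamma (a * (n + 1)))
  calc I = (A * A⁻¹) * (B⁻¹ * B) * I := by
        rw [ENNReal.mul_inv_cancel c1 ENNReal.ofReal_ne_top,
          ENNReal.inv_mul_cancel c2 ENNReal.ofReal_ne_top, one_mul, one_mul]
    _ = _ := by ring

theorem absVand_comp_perm {n : ℕ} (y : Fin n → ℝ) (σ : Equiv.Perm (Fin n)) :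
    absVand (fun i => y (σ i)) = absVand y := by
  have e : Matrix.vandermonde (fun i => y (σ i)) = (Matrix.vandermonde y).submatrix σ id := by
    ext i j; simp [Matrix.vandermonde_apply]
  rw [absVand, e, Matrix.det_permute, abs_mul, absVand]
  rcases Int.units_eq_one_or (Equiv.Perm.sign σ) with h | h <;> simp [h]

theorem absVand_eq_zero {n : ℕ} {y : Fin n → ℝ} (hy : ¬ Function.Injective y) :
    absVand y = 0 :=
  abs_eq_zero.2 (not_not.1 fun h => hy (Matrix.det_vandermonde_ne_zero_iff.1 h))

theorem measurableSet_strictMono {n : ℕ} : MeasurableSet {y : Fin n → ℝ | StrictMono y} := by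
  have e : {y : Fin n → ℝ | StrictMono y} = ⋂ i, ⋂ j, ⋂ (_ : i < j), {y | y i < y j} := by
    ext y; simp [StrictMono]
  rw [e]
  exact MeasurableSet.iInter fun i => MeasurableSet.iInter fun j => MeasurableSet.iInter fun _ =>
    measurableSet_lt (measurable_pi_apply i) (measurable_pi_apply j)

theorem lintegral_comp_perm {n : ℕ} (σ : Equiv.Perm (Fin n)) (F : (Fin n → ℝ) → ENNReal) :
    ∫⁻ y : Fin n → ℝ, F (fun i => y (σ i)) = ∫⁻ y, F y := by
  have h := volume_measurePreserving_piCongrLeft (fun _ : Fin n => ℝ) σ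
  rw [← h.lintegral_comp_emb (MeasurableEquiv.measurableEmbedding _)]
  refine lintegral_congr fun y => congrArg F ?_
  ext i
  exact Equiv.piCongrLeft_apply_apply (P := fun _ : Fin n => ℝ) σ y i

theorem sum_indicator_strictMono {n : ℕ} {y : Fin n → ℝ} (hy : Function.Injective y)
    (c : ENNReal) :
    ∑ σ : Equiv.Perm (Fin n), {z : Fin n → ℝ | StrictMono z}.indicator (fun _ => c)
      (fun i => y (σ i)) = c := by
  have hs : StrictMono fun i => y (Tuple.sort y i) :=
    (Tuple.monotone_sort y).strictMono_of_injective (hy.comp (Tuple.sort y).injective)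
  rw [Finset.sum_eq_single (Tuple.sort y)]
  · exact Set.indicator_of_mem (s := {z : Fin n → ℝ | StrictMono z}) hs _
  · intro σ _ hσ
    refine Set.indicator_of_notMem (fun h : StrictMono fun i => y (σ i) => hσ ?_) _
    ext i
    exact congrArg Fin.val (hy (congrFun (Tuple.unique_monotone (f := y) (σ := σ)
      (τ := Tuple.sort y) h.monotone hs.monotone) i))
  · exact fun h => absurd (Finset.mem_univ _) h

theorem lintegral_eq_factorial_mul {n : ℕ} {G : (Fin n → ℝ) → ENNReal} (hG : Measurable G)
    (hperm : ∀ (σ : Equiv.Perm (Fin n)) y, G (fun i => y (σ i)) = G y)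
    (h0 : ∀ y, ¬ Function.Injective y → G y = 0) :
    ∫⁻ y, G y = n.factorial * ∫⁻ y in {y : Fin n → ℝ | StrictMono y}, G y := by
  have h1 : ∀ y, G y = ∑ σ : Equiv.Perm (Fin n),
      {z : Fin n → ℝ | StrictMono z}.indicator G (fun i => y (σ i)) := by
    intro y
    by_cases hy : Function.Injective y
    · rw [← sum_indicator_strictMono hy (G y)]
      refine Finset.sum_congr rfl fun σ _ => ?_
      by_cases hs : StrictMono fun i => y (σ i)
      · rw [Set.indicator_of_mem (by exact hs), Set.indicator_of_mem (by exact hs), hperm]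
      · rw [Set.indicator_of_notMem (by exact hs), Set.indicator_of_notMem (by exact hs)]
    · rw [h0 y hy]
      refine (Finset.sum_eq_zero fun σ _ => ?_).symm
      refine Set.indicator_apply_eq_zero.2 fun _ => ?_
      rw [hperm, h0 y hy]
  have hm := hG.indicator (measurableSet_strictMono (n := n))
  rw [lintegral_congr h1, lintegral_finsetSum _ fun σ _ => ?_]
  · simp only [lintegral_comp_perm]
    rw [Finset.sum_const, Finset.card_univ, Fintype.card_perm, Fintype.card_fin, nsmul_eq_mul,
      lintegral_indicator measurableSet_strictMono]
  · exact hm.comp (measurable_pi_iff.2 fun i => measurable_pi_apply (σ i))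

/-- The density of the image of the circular ensemble on the real line, up to normalization. -/
def cauchyDensity (a : ℝ) {n : ℕ} (y : Fin (n + 1) → ℝ) : ℝ :=
  absVand y ^ (2 * a) * (∏ i, (1 + y i ^ 2)) ^ (-(a * n + 1))

theorem measurable_cauchyDensity (a : ℝ) {n : ℕ} :
    Measurable (cauchyDensity a (n := n)) := by
  have h1 : Measurable fun y : Fin (n + 1) → ℝ => (∏ i, (1 + y i ^ 2)) ^ (-(a * n + 1)) :=
    Measurable.pow_const (by fun_prop) _
  exact (measurable_absVand.pow_const _).mul h1

theorem lintegral_pairDensity_mul {a : ℝ} (ha : 0 < a) {n : ℕ}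
    (F : (Fin (n + 1) → ℝ) → ENNReal) :
    ∫⁻ y : Fin (n + 1) → ℝ, ∫⁻ x in {x | Interlaces y x},
        ENNReal.ofReal (pairDensity a y x) * F y =
      ENNReal.ofReal (Real.Gamma a ^ (n + 1) / Real.Gamma (a * (n + 1))) *
        ∫⁻ y in {y : Fin (n + 1) → ℝ | StrictMono y},
          ENNReal.ofReal (cauchyDensity a y) * F y := by
  have hΓ := Real.Gamma_pos_of_pos (show 0 < a * ((n : ℝ) + 1) by positivity)
  have hΓa := Real.Gamma_pos_of_pos ha
  rw [← lintegral_const_mul' _ _ ENNReal.ofReal_ne_top,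
    ← lintegral_indicator measurableSet_strictMono]
  refine lintegral_congr fun y => ?_
  by_cases hy : StrictMono y
  · rw [Set.indicator_of_mem (by exact hy),
      lintegral_mul_const _ (measurable_pairDensity_right a y).ennreal_ofReal, ← mul_assoc]
    congr 1
    have hV := absVand_pos hy.injective
    have hP : (0 : ℝ) < ∏ i, (1 + y i ^ 2) := Finset.prod_pos fun i _ => by positivity
    have e : ∀ x : Fin n → ℝ, ENNReal.ofReal (pairDensity a y x) =
        ENNReal.ofReal (absVand y * (∏ i, (1 + y i ^ 2)) ^ (-(a * n + 1))) *
          ENNReal.ofReal (absVand x * absRes y x ^ (a - 1)) := by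
      intro x
      rw [← ENNReal.ofReal_mul (by positivity), pairDensity]
      congr 1
      ring
    simp only [e]
    rw [lintegral_const_mul' _ _ ENNReal.ofReal_ne_top, lintegral_interlaces ha hy,
      ← ENNReal.ofReal_mul (by positivity), ← ENNReal.ofReal_mul (by positivity)]
    congr 1
    rw [cauchyDensity, show 2 * a = 1 + (2 * a - 1) by ring, Real.rpow_add hV, Real.rpow_one,
      add_sub_cancel_left]
    ring
  · have e : {x : Fin n → ℝ | Interlaces y x} = ∅ := Set.eq_empty_of_forall_notMem
      fun x (hx : Interlaces y x) => hy hx.strictMono_outer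
    rw [Set.indicator_of_notMem (by exact hy), e]
    simp

theorem pairMass_mul {a : ℝ} (ha : 0 < a) (n : ℕ) :
    pairMass a n * (a ^ n * n.factorial * 2 ^ (a * n * (n + 1))) = Real.pi ^ (n + 1) := by
  induction n with
  | zero => simp [pairMass]
  | succ n ih =>
    have e : (2 : ℝ) ^ (a * (n + 1 : ℕ) * ((n + 1 : ℕ) + 1)) =
        2 ^ (a * n * (n + 1)) * 4 ^ (a * (n + 1)) := by
      rw [show (4 : ℝ) = 2 ^ (2 : ℝ) by norm_num, ← Real.rpow_mul zero_le_two,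
        ← Real.rpow_add two_pos]
      congr 1
      push_cast
      ring
    rw [pow_succ Real.pi, ← ih, pairMass, pairMass, Finset.prod_range_succ, e, Nat.factorial_succ]
    push_cast
    field_simp
    ring

theorem norm_ofReal_sub_I (x : ℝ) : ‖(x : ℂ) - Complex.I‖ = √(1 + x ^ 2) := by
  rw [Complex.norm_def, Complex.normSq_apply]
  simp
  ring_nf

theorem norm_exp_phase_sub (x y : ℝ) :
    ‖Complex.exp (Complex.I * phase x) - Complex.exp (Complex.I * phase y)‖ =
      √(2 / (1 + x ^ 2)) * √(2 / (1 + y ^ 2)) * |x - y| := by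
  have hx := ofReal_sub_I_ne_zero x
  have hy := ofReal_sub_I_ne_zero y
  have e : ((x : ℂ) + Complex.I) / ((x : ℂ) - Complex.I) -
      ((y : ℂ) + Complex.I) / ((y : ℂ) - Complex.I) =
      -2 * Complex.I * ((x - y : ℝ) : ℂ) / (((x : ℂ) - Complex.I) * ((y : ℂ) - Complex.I)) := by
    rw [div_sub_div _ _ hx hy]
    congr 1
    push_cast
    ring
  rw [mul_comm Complex.I, mul_comm Complex.I, exp_phase, exp_phase, e, norm_div, norm_mul,
    norm_mul, norm_mul, norm_neg, Complex.norm_I, Complex.norm_real, Real.norm_eq_abs,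
    norm_ofReal_sub_I, norm_ofReal_sub_I, Real.sqrt_div zero_le_two, Real.sqrt_div zero_le_two]
  have h2 : √2 * √2 = (2 : ℝ) := Real.mul_self_sqrt zero_le_two
  have : ‖(2 : ℂ)‖ = 2 := by norm_num
  rw [this, div_mul_div_comm, h2]
  ring

theorem prod_lt_pairs {n : ℕ} (f : Fin n → Fin n → ℝ) :
    ∏ p ∈ Finset.univ.filter (fun p : Fin n × Fin n => p.1 < p.2), f p.1 p.2 =
      ∏ i, ∏ j ∈ Finset.Ioi i, f i j := by
  rw [Finset.prod_filter, Fintype.prod_prod_type]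
  refine Finset.prod_congr rfl fun i _ => ?_
  rw [← Finset.prod_filter]
  congr 1
  ext j
  simp

theorem prod_lt_pairs_mul {n : ℕ} (g : Fin (n + 1) → ℝ) :
    ∏ i, ∏ j ∈ Finset.Ioi i, g i * g j = (∏ i, g i) ^ n := by
  simp only [Finset.prod_mul_distrib, Finset.prod_const, Fin.card_Ioi]
  rw [Finset.prod_comm' (t' := Finset.univ) (s' := fun j => Finset.Iio j) (by simp)]
  simp only [Finset.prod_const, Fin.card_Iio]
  rw [← Finset.prod_mul_distrib, ← Finset.prod_pow]
  refine Finset.prod_congr rfl fun i _ => ?_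
  rw [← pow_add]
  congr 1
  omega

theorem absVand_eq_prod {n : ℕ} (y : Fin n → ℝ) :
    absVand y = ∏ i, ∏ j ∈ Finset.Ioi i, |y i - y j| := by
  simp only [absVand, Matrix.det_vandermonde, Finset.abs_prod, abs_sub_comm]

theorem prod_norm_exp_phase_sub (a : ℝ) {n : ℕ} (y : Fin (n + 1) → ℝ) :
    ∏ p ∈ Finset.univ.filter (fun p : Fin (n + 1) × Fin (n + 1) => p.1 < p.2),
        ‖Complex.exp (Complex.I * (phase (y p.1) : ℂ)) -
          Complex.exp (Complex.I * (phase (y p.2) : ℂ))‖ ^ (2 * a) =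
      absVand y ^ (2 * a) * (∏ i, 2 / (1 + y i ^ 2)) ^ (a * n) := by
  rw [Real.finsetProd_rpow _ _ fun _ _ => norm_nonneg _]
  simp only [norm_exp_phase_sub]
  rw [prod_lt_pairs fun i j => √(2 / (1 + y i ^ 2)) * √(2 / (1 + y j ^ 2)) * |y i - y j|]
  simp only [Finset.prod_mul_distrib (g := fun j => |y _ - y j|)]
  have hP : 0 ≤ ∏ i, √(2 / (1 + y i ^ 2)) := Finset.prod_nonneg fun i _ => Real.sqrt_nonneg _
  rw [Finset.prod_mul_distrib, prod_lt_pairs_mul fun i => √(2 / (1 + y i ^ 2)),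
    ← absVand_eq_prod, mul_comm,
    Real.mul_rpow (show 0 ≤ absVand y from abs_nonneg _) (by positivity)]
  congr 1
  rw [← Real.rpow_natCast, ← Real.rpow_mul hP, show (n : ℝ) * (2 * a) = (2 : ℕ) * (a * n) by
    push_cast; ring, Real.rpow_mul hP, Real.rpow_natCast, ← Finset.prod_pow]
  congr 2
  ext i
  exact Real.sq_sqrt (by positivity)

theorem lintegral_circle_eq {n : ℕ} {F : (Fin n → ℝ) → ENNReal} (hF : Measurable F) :
    ∫⁻ t in Set.univ.pi fun _ : Fin n => Set.Ico 0 (2 * Real.pi), F t =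
      ∫⁻ y : Fin n → ℝ, ENNReal.ofReal (∏ i, 2 / (1 + y i ^ 2)) * F fun i => phase (y i) := by
  have h := lintegral_fin_substitution measurable_phase
    (p := (Set.Ico 0 (2 * Real.pi)).indicator 1) (q := fun v => ENNReal.ofReal (2 / (1 + v ^ 2)))
    (measurable_one.indicator measurableSet_Ico) (by fun_prop) (fun f _ => by
      rw [← lintegral_comp_phase, setLIntegral_congr Ioo_ae_eq_Ico,
        ← lintegral_indicator measurableSet_Ico]
      refine lintegral_congr fun t => ?_
      by_cases ht : t ∈ Set.Ico 0 (2 * Real.pi) <;> simp [ht]) n hF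
  rw [← lintegral_indicator (MeasurableSet.univ_pi fun _ => measurableSet_Ico)]
  refine Eq.trans (lintegral_congr fun t => ?_) (h.trans (lintegral_congr fun y => ?_))
  · by_cases ht : ∀ i, t i ∈ Set.Ico 0 (2 * Real.pi)
    · rw [Set.indicator_of_mem (by simpa using ht), Finset.prod_eq_one, one_mul]
      exact fun i _ => by simp [ht i]
    · rw [Set.indicator_of_notMem (by simpa [Set.mem_pi] using ht)]
      push Not at ht
      obtain ⟨i, hi⟩ := ht
      rw [Finset.prod_eq_zero (Finset.mem_univ i) (Set.indicator_of_notMem hi _), zero_mul]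
  · rw [ENNReal.ofReal_prod_of_nonneg fun i _ => by positivity]

theorem cbeConst_mul {a : ℝ} (ha : 0 < a) (n : ℕ) :
    1 / cbeConst (2 * a) (n + 1) * 2 ^ ((n + 1) * (a * n + 1)) * (n + 1).factorial =
      (pairMass a n)⁻¹ * (Real.Gamma a ^ (n + 1) / Real.Gamma (a * (n + 1))) := by
  have hb : 0 < a * ((n : ℝ) + 1) := by positivity
  have hΓ := Real.Gamma_pos_of_pos hb
  have hΓa := Real.Gamma_pos_of_pos ha
  have hm := pairMass_pos ha n
  have hk := pairMass_mul ha n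
  have e1 : 2 * a * ((n + 1 : ℕ) : ℝ) / 2 = a * (n + 1) := by push_cast; ring
  have e2 : 2 * a / 2 = a := by ring
  have e3 : (2 : ℝ) ^ (((n : ℝ) + 1) * (a * n + 1)) = 2 ^ (a * n * (n + 1)) * 2 ^ (n + 1) := by
    rw [← Real.rpow_natCast, ← Real.rpow_add two_pos]
    congr 1
    push_cast
    ring
  rw [cbeConst, e1, e2, add_comm 1, add_comm 1, Real.Gamma_add_one hb.ne',
    Real.Gamma_add_one ha.ne', e3, mul_pow, ← hk, Nat.factorial_succ]
  have h2 : (0 : ℝ) < 2 ^ (a * n * (n + 1)) := by positivity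
  push_cast
  field_simp
  ring

theorem measurable_cbeDensity (β : ℝ) (n : ℕ) : Measurable fun y : Fin n → ℝ =>
    ENNReal.ofReal ((1 / cbeConst β n) *
      ∏ p ∈ Finset.univ.filter (fun p : Fin n × Fin n => p.1 < p.2),
        ‖Complex.exp (Complex.I * (y p.1 : ℂ)) - Complex.exp (Complex.I * (y p.2 : ℂ))‖ ^ β) := by
  refine Measurable.ennreal_ofReal (Measurable.const_mul (Finset.measurable_fun_prod _
    fun p _ => Measurable.pow_const ?_ _) _)
  fun_prop

theorem lintegral_cbe {a : ℝ} (ha : 0 < a) {n : ℕ} {F : (Fin (n + 1) → ℝ) → ENNReal}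
    (hF : Measurable F) (hperm : ∀ (σ : Equiv.Perm (Fin (n + 1))) y, F (fun i => y (σ i)) = F y) :
    ∫⁻ t, F t ∂cbe (2 * a) (n + 1) = ENNReal.ofReal (pairMass a n)⁻¹ *
      ∫⁻ y : Fin (n + 1) → ℝ, ∫⁻ x in {x | Interlaces y x},
        ENNReal.ofReal (pairDensity a y x) * F fun i => phase (y i) := by
  have hm := measurable_cbeDensity (2 * a) (n + 1)
  have hΓ := Real.Gamma_pos_of_pos (show 0 < a * ((n : ℝ) + 1) by positivity)
  have hΓa := Real.Gamma_pos_of_pos ha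
  have hC : 0 ≤ 1 / cbeConst (2 * a) (n + 1) := by
    have h1 := Real.Gamma_pos_of_pos (show 0 < 1 + 2 * a * ((n + 1 : ℕ) : ℝ) / 2 by positivity)
    have h2 := Real.Gamma_pos_of_pos (show 0 < 1 + 2 * a / 2 by positivity)
    unfold cbeConst
    positivity
  have hpm := pairMass_pos ha n
  have hFφ : Measurable fun y : Fin (n + 1) → ℝ => F fun i => phase (y i) :=
    hF.comp (measurable_pi_iff.2 fun i => measurable_phase.comp (measurable_pi_apply i))
  have hmc := (measurable_cauchyDensity a (n := n)).ennreal_ofReal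
  have hmG : Measurable fun y : Fin (n + 1) → ℝ =>
      ENNReal.ofReal (cauchyDensity a y) * F fun i => phase (y i) := hmc.mul hFφ
  rw [lintegral_pairDensity_mul ha, cbe, lintegral_withDensity_eq_lintegral_mul _ hm hF,
    lintegral_circle_eq (hm.mul hF)]
  have e : ∀ y : Fin (n + 1) → ℝ, ENNReal.ofReal (∏ i, 2 / (1 + y i ^ 2)) *
      (ENNReal.ofReal ((1 / cbeConst (2 * a) (n + 1)) *
        ∏ p ∈ Finset.univ.filter (fun p : Fin (n + 1) × Fin (n + 1) => p.1 < p.2),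
          ‖Complex.exp (Complex.I * (phase (y p.1) : ℂ)) -
            Complex.exp (Complex.I * (phase (y p.2) : ℂ))‖ ^ (2 * a)) * F fun i => phase (y i)) =
      ENNReal.ofReal (1 / cbeConst (2 * a) (n + 1) * 2 ^ (((n : ℝ) + 1) * (a * n + 1))) *
        (ENNReal.ofReal (cauchyDensity a y) * F fun i => phase (y i)) := by
    intro y
    have hQ : (0 : ℝ) < ∏ i, (1 + y i ^ 2) := Finset.prod_pos fun i _ => by positivity
    have hP : ∏ i, 2 / (1 + y i ^ 2) = 2 ^ ((n : ℝ) + 1) / ∏ i, (1 + y i ^ 2) := by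
      rw [Finset.prod_div_distrib, Finset.prod_const, Finset.card_univ, Fintype.card_fin,
        ← Real.rpow_natCast]
      push_cast
      rfl
    have hmul : ∀ {p q r s : ℝ} (G : ENNReal), 0 ≤ p → 0 ≤ r → p * q = r * s →
        ENNReal.ofReal p * (ENNReal.ofReal q * G) = ENNReal.ofReal r * (ENNReal.ofReal s * G) :=
      fun G hp hr h => by
        rw [← mul_assoc, ← ENNReal.ofReal_mul hp, h, ENNReal.ofReal_mul hr, mul_assoc]
    have h2 : (2 : ℝ) ^ (((n : ℝ) + 1) * (a * n + 1)) =
        2 ^ (((n : ℝ) + 1) * (a * n)) * 2 ^ ((n : ℝ) + 1) := by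
      rw [← Real.rpow_add two_pos]
      ring_nf
    refine hmul _ (Finset.prod_nonneg fun i _ => by positivity) (by positivity) ?_
    rw [prod_norm_exp_phase_sub, hP, cauchyDensity, Real.div_rpow (by positivity) hQ.le,
      ← Real.rpow_mul zero_le_two,
      h2, Real.rpow_neg hQ.le, Real.rpow_add hQ, Real.rpow_one]
    have hR := Real.rpow_pos_of_pos hQ (a * n)
    generalize (2 : ℝ) ^ ((n : ℝ) + 1) = T
    generalize (∏ i, (1 + y i ^ 2)) ^ (a * (n : ℝ)) = R at hR ⊢
    generalize ∏ i, (1 + y i ^ 2) = Q at hQ ⊢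
    field_simp
  simp only [Pi.mul_apply]
  rw [lintegral_congr e, lintegral_const_mul' _ _ ENNReal.ofReal_ne_top,
    lintegral_eq_factorial_mul hmG, ← mul_assoc, ← mul_assoc,
    ← ENNReal.ofReal_mul (by positivity), ← cbeConst_mul ha n,
    ENNReal.ofReal_mul (p := _ * _) (by positivity), ENNReal.ofReal_natCast]
  · intro σ y
    simp only [cauchyDensity]
    rw [absVand_comp_perm, Equiv.prod_comp σ fun i => 1 + y i ^ 2,
      hperm σ fun i => phase (y i)]
  · intro y hy
    simp only [cauchyDensity]
    rw [absVand_eq_zero hy, Real.zero_rpow (by positivity)]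
    simp

theorem countIn_eq_sum {n : ℕ} (b c : ℝ) (y : Fin n → ℝ) :
    countIn b c y = ∑ i, if b ≤ y i ∧ y i < c then 1 else 0 := by
  rw [countIn, Finset.card_filter]

theorem measurable_countIn {n : ℕ} (b c : ℝ) : Measurable (countIn b c : (Fin n → ℝ) → ℕ) := by
  have h : (countIn b c : (Fin n → ℝ) → ℕ) = fun y => ∑ i, if b ≤ y i ∧ y i < c then 1 else 0 :=
    funext fun y => countIn_eq_sum b c y
  rw [h]
  refine Finset.measurable_fun_sum _ fun i _ => Measurable.ite ?_ measurable_const measurable_const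
  exact measurable_pi_apply i measurableSet_Ico

theorem countIn_comp_perm {n : ℕ} (b c : ℝ) (σ : Equiv.Perm (Fin n)) (y : Fin n → ℝ) :
    countIn b c (fun i => y (σ i)) = countIn b c y := by
  rw [countIn_eq_sum, countIn_eq_sum]
  exact Equiv.sum_comp σ fun i => if b ≤ y i ∧ y i < c then 1 else 0

theorem countIn_phase {n : ℕ} (u : ℝ) (y : Fin n → ℝ) :
    countIn 0 (phase u) (fun i => phase (y i)) = countAbove u y := by
  rw [countIn_eq_sum, countAbove]
  refine Finset.sum_congr rfl fun i _ => ?_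
  simp only [(phase_pos (y i)).le, true_and, phase_strictAnti.lt_iff_gt]

theorem lintegral_countIn {a : ℝ} (ha : 0 < a) (u m : ℝ) (n : ℕ) :
    ∫⁻ t, ENNReal.ofReal ((countIn 0 (phase u) t - m) ^ 2) ∂cbe (2 * a) (n + 1) =
      ∫⁻ ψ, ENNReal.ofReal ((ψ / (2 * Real.pi) - m) ^ 2 + Int.fract (ψ / (2 * Real.pi)) *
          (1 - Int.fract (ψ / (2 * Real.pi)))) ∂phaseLaw (phase u) a n := by
  have hF : Measurable fun t : Fin (n + 1) → ℝ =>
      ENNReal.ofReal ((countIn 0 (phase u) t - m) ^ 2) := by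
    have h : Measurable fun t : Fin (n + 1) → ℝ => (countIn 0 (phase u) t : ℝ) :=
      measurable_from_nat.comp (measurable_countIn _ _)
    fun_prop
  rw [lintegral_cbe ha hF fun σ y => by rw [countIn_comp_perm]]
  simp only [countIn_phase]
  rw [lintegral_pair_countAbove ha, ← mul_assoc, ← ENNReal.ofReal_mul
    (inv_nonneg.2 (pairMass_pos ha n).le), inv_mul_cancel₀ (pairMass_pos ha n).ne',
    ENNReal.ofReal_one, one_mul]

theorem integral_countIn {a : ℝ} (ha : 0 < a) (u m : ℝ) (n : ℕ) :
    ∫ t, ((countIn 0 (phase u) t : ℝ) - m) ^ 2 ∂cbe (2 * a) (n + 1) =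
      ∫ ψ, ((ψ / (2 * Real.pi) - m) ^ 2 + Int.fract (ψ / (2 * Real.pi)) *
          (1 - Int.fract (ψ / (2 * Real.pi)))) ∂phaseLaw (phase u) a n := by
  have h : Measurable fun t : Fin (n + 1) → ℝ => (countIn 0 (phase u) t : ℝ) :=
    measurable_from_nat.comp (measurable_countIn _ _)
  rw [integral_eq_lintegral_of_nonneg_ae, integral_eq_lintegral_of_nonneg_ae,
    lintegral_countIn ha]
  · exact Eventually.of_forall fun ψ => add_nonneg (sq_nonneg _)
      (mul_nonneg (Int.fract_nonneg _) (sub_nonneg.2 (Int.fract_lt_one _).le))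
  · exact (by fun_prop : Measurable fun ψ : ℝ => (ψ / (2 * Real.pi) - m) ^ 2 +
      Int.fract (ψ / (2 * Real.pi)) * (1 - Int.fract (ψ / (2 * Real.pi)))).aestronglyMeasurable
  · exact Eventually.of_forall fun t => sq_nonneg _
  · exact (by fun_prop : Measurable fun t : Fin (n + 1) → ℝ =>
      ((countIn 0 (phase u) t : ℝ) - m) ^ 2).aestronglyMeasurable

theorem abs_integral_countIn_sub_le {a : ℝ} (ha : 0 < a) (u : ℝ) (n : ℕ) :
    |∫ t, ((countIn 0 (phase u) t : ℝ) - (n + 1) * phase u / (2 * Real.pi)) ^ 2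
        ∂cbe (2 * a) (n + 1) - phaseVar (phase u) a n / (4 * Real.pi ^ 2)| ≤ 1 := by
  have hP := isProbabilityMeasure_phaseLaw (phase u) ha n
  have hb : ∀ ψ : ℝ, Int.fract (ψ / (2 * Real.pi)) * (1 - Int.fract (ψ / (2 * Real.pi))) ∈
      Set.Icc (0 : ℝ) 1 := fun ψ => by
    have h0 := Int.fract_nonneg (ψ / (2 * Real.pi))
    have h1 := (Int.fract_lt_one (ψ / (2 * Real.pi))).le
    exact ⟨mul_nonneg h0 (sub_nonneg.2 h1), mul_le_one₀ h1 (sub_nonneg.2 h1) (by linarith)⟩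
  have hn : ∀ ψ : ℝ, ‖Int.fract (ψ / (2 * Real.pi)) * (1 - Int.fract (ψ / (2 * Real.pi)))‖ ≤ 1 :=
    fun ψ => by rw [Real.norm_eq_abs, abs_of_nonneg (hb ψ).1]; exact (hb ψ).2
  have hi : Integrable (fun ψ : ℝ => Int.fract (ψ / (2 * Real.pi)) *
      (1 - Int.fract (ψ / (2 * Real.pi)))) (phaseLaw (phase u) a n) :=
    Integrable.of_bound (by fun_prop : Measurable fun ψ : ℝ => Int.fract (ψ / (2 * Real.pi)) *
      (1 - Int.fract (ψ / (2 * Real.pi)))).aestronglyMeasurable 1 (Eventually.of_forall hn)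
  have e : ∀ ψ : ℝ, (ψ / (2 * Real.pi) - (n + 1) * phase u / (2 * Real.pi)) ^ 2 =
      (ψ - (n + 1) * phase u) ^ 2 / (4 * Real.pi ^ 2) := fun ψ => by
    rw [← sub_div, div_pow]
    ring
  rw [integral_countIn ha, integral_add (integrable_phaseLaw (phase_pos u).le ha n
    (by fun_prop)) hi]
  simp only [e]
  rw [integral_div, ← phaseVar, add_sub_cancel_left]
  refine (norm_integral_le_of_norm_le_const (Eventually.of_forall hn)).trans ?_
  simp

/-- Matching uniform upper and lower logarithmic bounds for the variance of the
counting function of the CβE: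
`|E[|N_n(0,θ) − nθ/(2π)|²] − (2/(π²β)) ln(2+nθ)| ≤ C` for `θ ∈ (0,π]`,
with `C` depending only on `β`. -/
theorem counting_variance_bound (β : ℝ) (hβ : 0 < β) :
    ∃ C > 0, ∀ n : ℕ, 1 ≤ n → ∀ θ ∈ Set.Ioc (0:ℝ) Real.pi,
      |(∫ y, ((countIn 0 θ y : ℝ) - n * θ / (2 * Real.pi)) ^ 2 ∂(cbe β n))
          - (2 / (Real.pi ^ 2 * β)) * Real.log (2 + n * θ)| ≤ C := by
  have hpi := Real.pi_pos
  obtain ⟨C, hC⟩ := exists_abs_phaseVar_sub_log_le (half_pos hβ)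
  refine ⟨1 + |C| / (4 * Real.pi ^ 2), by positivity, fun n hn θ hθ => ?_⟩
  obtain ⟨n, rfl⟩ := Nat.exists_eq_add_of_le' hn
  have h1 := hC n θ hθ.1 hθ.2
  obtain ⟨u, -, rfl⟩ : θ ∈ phase '' Set.univ := by
    rw [range_phase]
    exact ⟨hθ.1, by linarith [hθ.2]⟩
  have h2 := abs_integral_countIn_sub_le (half_pos hβ) u n
  rw [mul_div_cancel₀ β two_ne_zero] at h2
  push_cast
  refine (abs_sub_le _ (phaseVar (phase u) (β / 2) n / (4 * Real.pi ^ 2)) _).trans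
    (add_le_add h2 ?_)
  rw [show phaseVar (phase u) (β / 2) n / (4 * Real.pi ^ 2) -
      2 / (Real.pi ^ 2 * β) * Real.log (2 + (n + 1) * phase u) =
      (phaseVar (phase u) (β / 2) n - 4 / (β / 2) * Real.log (2 + (n + 1) * phase u)) /
        (4 * Real.pi ^ 2) by field_simp,
    abs_div, abs_of_pos (show 0 < 4 * Real.pi ^ 2 by positivity)]
  exact div_le_div_of_nonneg_right (h1.trans (le_abs_self C)) (by positivity)
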